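/- There exist a constant c > 0 and data (T, s, G) — a finite tile set T, a seed tile s ∈ T, and a glue function G with all glue strengths at most 9 — such that for every integer n ≥ 22 there is a sequence {τ_i}_{i=1}^k of positive integer temperatures, each at most 9, with k ≤ c · log₂ n, such that the multiple temperature tile system ⟨T, s, G, {τ_i}_{i=1}^k⟩ uniquely assembles the n × n square (the shape {0, …, n−1} × {0, …, n−1}, up to translation). -/

import Mathlib

/-! ## The multiple temperature tile self-assembly model -/

/-- Glues are drawn from a countable alphabet; glue `0` is the distinguished `null` glue. -/
abbrev Glue := ℕ

/-- A tile is a quadruple of glues (north, east, south, west). -/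
structure Tile where
  north : Glue
  east : Glue
  south : Glue
  west : Glue
deriving DecidableEq

/-- A configuration maps positions of `ℤ²` to a tile or to `none` (the empty tile). -/
abbrev Config := ℤ × ℤ → Option Tile

/-- Two abutting edges bond with strength `G x` when they carry the same glue `x`,
and with strength `0` otherwise. -/
def bond (G : Glue → ℕ) (x y : Glue) : ℕ := if x = y then G x else 0

/-- Bonding strength between the edges of tile `t` at position `p` and tile `u`
at (neighboring) position `q`. -/
def edgeBond (G : Glue → ℕ) (t u : Tile) (p q : ℤ × ℤ) : ℕ :=
  if q = (p.1, p.2 + 1) then bond G t.north u.south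
  else if q = (p.1 + 1, p.2) then bond G t.east u.west
  else if q = (p.1, p.2 - 1) then bond G t.south u.north
  else if q = (p.1 - 1, p.2) then bond G t.west u.east
  else 0

/-- The four L¹-neighbors of a position. -/
def neighbors (p : ℤ × ℤ) : List (ℤ × ℤ) :=
  [(p.1, p.2 + 1), (p.1 + 1, p.2), (p.1, p.2 - 1), (p.1 - 1, p.2)]

/-- The shape of a configuration: its set of non-empty positions. -/
def shape (C : Config) : Set (ℤ × ℤ) := {p | C p ≠ none}

/-- Total bonding strength between a tile `t` placed at position `p` and the tiles of `C`
at the four neighboring positions. -/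
def attachStrength (G : Glue → ℕ) (C : Config) (t : Tile) (p : ℤ × ℤ) : ℕ :=
  ((neighbors p).map (fun q =>
    match C q with
    | some u => edgeBond G t u p q
    | none => 0)).sum

/-- Bonding strength between the tiles of `C` at adjacent positions `p` and `q`. -/
def bondAt (G : Glue → ℕ) (C : Config) (p q : ℤ × ℤ) : ℕ :=
  match C p, C q with
  | some t, some u => edgeBond G t u p q
  | _, _ => 0

/-- Total strength of the bonds from `p ∈ Q` leaving the set `Q` in configuration `C`. -/
def outStrength (G : Glue → ℕ) (C : Config) (Q : Finset (ℤ × ℤ)) (p : ℤ × ℤ) : ℕ :=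
  (((neighbors p).filter (fun q => q ∉ Q)).map (fun q => bondAt G C p q)).sum

/-- Strength of the cut of (the adjacency graph of) `C` separating `Q` from its complement:
the sum over crossing edges of the bonding strengths of the corresponding abutting edges. -/
def cutStrength (G : Glue → ℕ) (C : Config) (Q : Finset (ℤ × ℤ)) : ℕ :=
  ∑ p ∈ Q, outStrength G C Q p

/-- The initial configuration: the seed tile `s` at the origin. -/
def seedConfig (s : Tile) : Config := fun p => if p = (0, 0) then some s else none

/-- One step of assembly of the (standard) multiple temperature model at temperature `τ`:
either a tile of `T` attaches at an empty position with total bonding strength at least `τ`,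
or the portion `Q` of the supertile on the non-seed side of a cut of strength `< τ`
is removed. -/
inductive Step (T : Finset Tile) (G : Glue → ℕ) (τ : ℕ) : Config → Config → Prop
  | attach (C : Config) (t : Tile) (p : ℤ × ℤ) :
      t ∈ T → C p = none → τ ≤ attachStrength G C t p →
      Step T G τ C (Function.update C p (some t))
  | detach (C : Config) (Q : Finset (ℤ × ℤ)) :
      Q.Nonempty → ((0, 0) : ℤ × ℤ) ∉ Q → (↑Q : Set (ℤ × ℤ)) ⊆ shape C →
      cutStrength G C Q < τ →
      Step T G τ C (fun q => if q ∈ Q then none else C q)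

/-- A configuration is terminal for a step relation if no step applies. -/
def Terminal (step : Config → Config → Prop) (C : Config) : Prop := ∀ D, ¬ step C D

/-- A phase finishes from `C`: there is no infinite sequence of steps starting at `C`. -/
def PhaseTerminates (step : Config → Config → Prop) (C : Config) : Prop :=
  ¬ ∃ f : ℕ → Config, f 0 = C ∧ ∀ n, step (f n) (f (n + 1))

/-- `MultiReach step τs C E`: starting from `C`, running each phase (one per temperature
in `τs`) to a terminal configuration can produce `E`. -/
inductive MultiReach (step : ℕ → Config → Config → Prop) : List ℕ → Config → Config → Prop
  | nil {C : Config} : MultiReach step [] C C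
  | cons {τ : ℕ} {τs : List ℕ} {C D E : Config} :
      Relation.ReflTransGen (step τ) C D → Terminal (step τ) D →
      MultiReach step τs D E → MultiReach step (τ :: τs) C E

/-- Every phase finishes, no matter which additions and removals are chosen. -/
inductive AllFinish (step : ℕ → Config → Config → Prop) : List ℕ → Config → Prop
  | nil {C : Config} : AllFinish step [] C
  | cons {τ : ℕ} {τs : List ℕ} {C : Config} :
      PhaseTerminates (step τ) C →
      (∀ D, Relation.ReflTransGen (step τ) C D → Terminal (step τ) D → AllFinish step τs D) →
      AllFinish step (τ :: τs) C

/-- The tile system with seed `s` and temperature sequence `τs` uniquely produces the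
configuration (supertile) `R`: all phases always finish, and every terminal configuration
produced after the last phase equals `R`. -/
def UniquelyProduces (step : ℕ → Config → Config → Prop) (s : Tile) (τs : List ℕ)
    (R : Config) : Prop :=
  AllFinish step τs (seedConfig s) ∧
  MultiReach step τs (seedConfig s) R ∧
  ∀ C, MultiReach step τs (seedConfig s) C → C = R

/-- Translation of a set of positions by `d`. -/
def translateSet (d : ℤ × ℤ) (S : Set (ℤ × ℤ)) : Set (ℤ × ℤ) := (fun p => p + d) '' S

/-- The system uniquely assembles the shape `Υ` (up to translation). -/
def UniquelyAssembles (step : ℕ → Config → Config → Prop) (s : Tile) (τs : List ℕ)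
    (Υ : Set (ℤ × ℤ)) : Prop :=
  ∃ R : Config, UniquelyProduces step s τs R ∧ ∃ d : ℤ × ℤ, shape R = translateSet d Υ

/-- The `n × n` square shape `{0,…,n−1} × {0,…,n−1}`. -/
def square (n : ℕ) : Set (ℤ × ℤ) :=
  {p : ℤ × ℤ | 0 ≤ p.1 ∧ p.1 < (n : ℤ) ∧ 0 ≤ p.2 ∧ p.2 < (n : ℤ)}

/-- The `a × b` rectangle shape `{0,…,b−1} × {0,…,a−1}` (`b` columns, `a` rows). -/
def rect (a b : ℕ) : Set (ℤ × ℤ) :=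
  {p : ℤ × ℤ | 0 ≤ p.1 ∧ p.1 < (b : ℤ) ∧ 0 ≤ p.2 ∧ p.2 < (a : ℤ)}

namespace TT

def gl : List ℕ := [0, 4, 4, 4, 4, 4, 4, 4, 8, 8, 8, 6, 1, 5, 8, 8, 1, 8, 3, 8, 4, 8, 8, 8, 8, 8, 8, 8, 8, 8, 8]
def gs (x : Glue) : ℕ := gl.getD x 0

theorem gs0 : gs 0 = 0 := rfl
theorem gs_le (x : ℕ) : gs x ≤ 9 := by
  by_cases h : x < 31
  · revert x; decide
  · have : gs x = 0 := by
      unfold gs gl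
      rw [List.getD_eq_default]
      simp; omega
    omega

abbrev bd (x y : Glue) : ℕ := bond gs x y
theorem bd0 (x : Glue) : bond gs x 0 = 0 := by
  unfold bond; split_ifs with h
  · rw [h]; rfl
  · rfl
theorem bd0' (x : Glue) : bond gs 0 x = 0 := by
  unfold bond; split_ifs with h
  · rfl
  · rfl
theorem bd_le (x y : Glue) : bond gs x y ≤ gs y := by
  unfold bond; split_ifs with h
  · rw [h]
  · omega

def nG (C : Config) (x y : ℤ) : Glue := match C (x, y) with | some t => t.north | none => 0
def eG (C : Config) (x y : ℤ) : Glue := match C (x, y) with | some t => t.east | none => 0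
def sG (C : Config) (x y : ℤ) : Glue := match C (x, y) with | some t => t.south | none => 0
def wG (C : Config) (x y : ℤ) : Glue := match C (x, y) with | some t => t.west | none => 0

theorem att_eq (C : Config) (t : Tile) (x y : ℤ) : attachStrength gs C t (x, y) =
    bond gs t.north (sG C x (y+1)) + bond gs t.east (wG C (x+1) y) +
    bond gs t.south (nG C x (y-1)) + bond gs t.west (eG C (x-1) y) := by
  unfold attachStrength neighbors sG wG nG eG
  simp only [List.map_cons, List.map_nil, List.sum_cons, List.sum_nil]
  have h1 : ((x, y+1) : ℤ × ℤ) ≠ (x+1, y) := by simp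
  have a1 : ((x+1, y) : ℤ × ℤ) ≠ (x, y+1) := by simp
  have a2 : ((x, y-1) : ℤ × ℤ) ≠ (x, y+1) := by simp; omega
  have a3 : ((x, y-1) : ℤ × ℤ) ≠ (x+1, y) := by simp
  have a4 : ((x-1, y) : ℤ × ℤ) ≠ (x, y+1) := by simp
  have a5 : ((x-1, y) : ℤ × ℤ) ≠ (x+1, y) := by simp; omega
  have a6 : ((x-1, y) : ℤ × ℤ) ≠ (x, y-1) := by simp
  have e1 : (match C (x, y+1) with | some u => edgeBond gs t u (x,y) (x, y+1) | none => 0)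
      = bond gs t.north (match C (x, y+1) with | some t => t.south | none => 0) := by
    cases C (x, y+1) <;> simp [edgeBond, bd0]
  have e2 : (match C (x+1, y) with | some u => edgeBond gs t u (x,y) (x+1, y) | none => 0)
      = bond gs t.east (match C (x+1, y) with | some t => t.west | none => 0) := by
    cases C (x+1, y) <;> simp [edgeBond, bd0]
  have e3 : (match C (x, y-1) with | some u => edgeBond gs t u (x,y) (x, y-1) | none => 0)
      = bond gs t.south (match C (x, y-1) with | some t => t.north | none => 0) := by
    cases C (x, y-1) <;> simp [edgeBond, bd0, a2]
  have e4 : (match C (x-1, y) with | some u => edgeBond gs t u (x,y) (x-1, y) | none => 0)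
      = bond gs t.west (match C (x-1, y) with | some t => t.east | none => 0) := by
    cases C (x-1, y) <;> simp [edgeBond, bd0, a5]
  refine (congrArg₂ (· + ·) e1 (congrArg₂ (· + ·) e2 (congrArg₂ (· + ·) e3
    (congrArg (· + 0) e4)))).trans ?_
  simp only [add_zero, add_assoc]

def bN (C : Config) (x y : ℤ) : ℕ := bond gs (nG C x y) (sG C x (y+1))
def bE (C : Config) (x y : ℤ) : ℕ := bond gs (eG C x y) (wG C (x+1) y)
def bS (C : Config) (x y : ℤ) : ℕ := bond gs (sG C x y) (nG C x (y-1))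
def bW (C : Config) (x y : ℤ) : ℕ := bond gs (wG C x y) (eG C (x-1) y)

theorem filt_sum {α : Type} (P : α → Prop) [DecidablePred P] (f : α → ℕ) (a : α) (l : List α) :
    (((a :: l).filter (fun q => ¬ P q)).map f).sum = (if P a then 0 else f a) +
      ((l.filter (fun q => ¬ P q)).map f).sum := by
  by_cases h : P a <;> simp [h]

theorem out_fe (C : Config) (Q : Finset (ℤ × ℤ)) (p : ℤ × ℤ) : outStrength gs C Q p =
      (if (p.1, p.2+1) ∈ Q then 0 else bondAt gs C p (p.1, p.2+1)) +
      (if (p.1+1, p.2) ∈ Q then 0 else bondAt gs C p (p.1+1, p.2)) +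
      (if (p.1, p.2-1) ∈ Q then 0 else bondAt gs C p (p.1, p.2-1)) +
      (if (p.1-1, p.2) ∈ Q then 0 else bondAt gs C p (p.1-1, p.2)) := by
  unfold outStrength neighbors
  rw [filt_sum (fun q => q ∈ Q), filt_sum (fun q => q ∈ Q), filt_sum (fun q => q ∈ Q), filt_sum (fun q => q ∈ Q)]
  simp only [List.filter_nil, List.map_nil, List.sum_nil]
  ring

theorem out_eq (C : Config) (Q : Finset (ℤ × ℤ)) (x y : ℤ) : outStrength gs C Q (x, y) =
    (if (x, y+1) ∈ Q then 0 else bN C x y) + (if (x+1, y) ∈ Q then 0 else bE C x y) +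
    (if (x, y-1) ∈ Q then 0 else bS C x y) + (if (x-1, y) ∈ Q then 0 else bW C x y) := by
  have a2 : ((x, y-1) : ℤ × ℤ) ≠ (x, y+1) := by simp; omega
  have a5 : ((x-1, y) : ℤ × ℤ) ≠ (x+1, y) := by simp; omega
  have e1 : bondAt gs C (x,y) (x,y+1) = bN C x y := by
    unfold bondAt bN nG sG
    cases C (x,y) <;> cases C (x, y+1) <;> simp [edgeBond, bd0, bd0']
  have e2 : bondAt gs C (x,y) (x+1,y) = bE C x y := by
    unfold bondAt bE eG wG
    cases C (x,y) <;> cases C (x+1, y) <;> simp [edgeBond, bd0, bd0']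
  have e3 : bondAt gs C (x,y) (x,y-1) = bS C x y := by
    unfold bondAt bS nG sG
    cases C (x,y) <;> cases C (x, y-1) <;> simp [edgeBond, bd0, bd0', a2]
  have e4 : bondAt gs C (x,y) (x-1,y) = bW C x y := by
    unfold bondAt bW eG wG
    cases C (x,y) <;> cases C (x-1, y) <;> simp [edgeBond, bd0, bd0', a5]
  rw [← e1, ← e2, ← e3, ← e4, out_fe]

def Stable (τ : ℕ) (C : Config) : Prop := ∀ Q : Finset (ℤ × ℤ), Q.Nonempty → ((0,0) : ℤ × ℤ) ∉ Q →
  (↑Q : Set (ℤ × ℤ)) ⊆ shape C → τ ≤ cutStrength gs C Q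

def Le (C D : Config) : Prop := ∀ p, C p ≠ none → D p = C p

theorem out_le_cut {C : Config} {Q : Finset (ℤ × ℤ)} {p : ℤ × ℤ} (h : p ∈ Q) :
    outStrength gs C Q p ≤ cutStrength gs C Q :=
  Finset.single_le_sum (f := fun p => outStrength gs C Q p) (fun _ _ => Nat.zero_le _) h

theorem out2_le_cut {C : Config} {Q : Finset (ℤ × ℤ)} {p q : ℤ × ℤ} (h : p ∈ Q) (h' : q ∈ Q) (hne : p ≠ q) :
    outStrength gs C Q p + outStrength gs C Q q ≤ cutStrength gs C Q := by
  unfold cutStrength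
  rw [← Finset.sum_pair hne]
  apply Finset.sum_le_sum_of_subset
  intro z hz; simp at hz; rcases hz with rfl | rfl <;> assumption

theorem bondAt_mono {C D : Config} (h : Le C D) {p q} (hb : bondAt gs C p q ≠ 0) :
    C p ≠ none ∧ C q ≠ none ∧ bondAt gs D p q = bondAt gs C p q := by
  have h1 : C p ≠ none := by intro e; apply hb; unfold bondAt; rw [e]
  have h2 : C q ≠ none := by intro e; apply hb; unfold bondAt; rw [e]; cases C p <;> rfl
  refine ⟨h1, h2, ?_⟩
  unfold bondAt; rw [h p h1, h q h2]

theorem cut_mono {C D : Config} (h : Le C D) (Q : Finset (ℤ × ℤ)) :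
    cutStrength gs C (Q.filter (fun p => C p ≠ none)) ≤ cutStrength gs D Q := by
  unfold cutStrength
  refine le_trans (Finset.sum_le_sum (g := fun p => outStrength gs D Q p) ?_)
    (Finset.sum_le_sum_of_subset (Finset.filter_subset _ _))
  intro p hp
  have hpQ := (Finset.mem_filter.1 hp).1
  have key : ∀ q, (if q ∈ Q.filter (fun p => C p ≠ none) then 0 else bondAt gs C p q) ≤
      (if q ∈ Q then 0 else bondAt gs D p q) := by
    intro q
    by_cases hb : bondAt gs C p q = 0
    · rw [hb]; simp
    · obtain ⟨_, h2, h3⟩ := bondAt_mono h hb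
      rw [h3]
      by_cases hq : q ∈ Q
      · rw [if_pos (Finset.mem_filter.2 ⟨hq, h2⟩)]; exact Nat.zero_le _
      · rw [if_neg hq, if_neg (fun h => hq (Finset.mem_filter.1 h).1)]
  rw [out_fe, out_fe]
  have k1 := key (p.1, p.2+1)
  have k2 := key (p.1+1, p.2)
  have k3 := key (p.1, p.2-1)
  have k4 := key (p.1-1, p.2)
  omega

theorem Stable.mono {C : Config} {a b : ℕ} (h : Stable b C) (hab : a ≤ b) : Stable a C :=
  fun Q h1 h2 h3 => le_trans hab (h Q h1 h2 h3)

/-- a cut of weak strength avoids a stable subconfiguration -/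
theorem avoid {C D : Config} {τ : ℕ} (h : Le C D) (hs : Stable τ C) {Q : Finset (ℤ × ℤ)}
    (h0 : ((0,0) : ℤ × ℤ) ∉ Q) (hc : cutStrength gs D Q < τ) : ∀ p ∈ Q, C p = none := by
  by_contra hcon
  push Not at hcon
  obtain ⟨p, hp, hpC⟩ := hcon
  have := hs (Q.filter (fun p => C p ≠ none)) ⟨p, by simp [hp, hpC]⟩ (by simp [h0])
    (by intro q hq; simp at hq; exact hq.2)
  have := cut_mono h Q
  omega

theorem stable_ext {C D : Config} {τ : ℕ} (h : Le C D) (hs : Stable τ C)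
    (H : ∀ Q : Finset (ℤ × ℤ), Q.Nonempty → (∀ p ∈ Q, D p ≠ none ∧ C p = none) → τ ≤ cutStrength gs D Q) :
    Stable τ D := by
  intro Q h1 h2 h3
  by_contra hc
  push Not at hc
  have := avoid h hs h2 hc
  have := H Q h1 (fun p hp => ⟨h3 hp, this p hp⟩)
  omega

end TT

namespace TT

def tF : Tile := ⟨1, 2, 1, 2⟩
def tFc : Tile := ⟨3, 2, 3, 2⟩
def tFl : Tile := ⟨1, 4, 1, 4⟩
def tF0 : Tile := ⟨3, 5, 0, 5⟩
def tD : Tile := ⟨1, 2, 7, 8⟩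
def tA1 : Tile := ⟨7, 8, 3, 2⟩
def tAz : Tile := ⟨7, 5, 0, 5⟩
def tAT : Tile := ⟨9, 2, 1, 6⟩
def tP : Tile := ⟨11, 6, 9, 10⟩
def tFx : Tile := ⟨1, 10, 0, 4⟩
def tX : Tile := ⟨23, 13, 11, 12⟩
def tXs : Tile := ⟨20, 24, 23, 0⟩
def tX3 : Tile := ⟨1, 25, 0, 24⟩
def tX4 : Tile := ⟨0, 6, 18, 25⟩
def tBe : Tile := ⟨1, 12, 1, 4⟩
def tK1 : Tile := ⟨0, 14, 0, 13⟩
def tK2 : Tile := ⟨0, 0, 15, 14⟩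
def tK3 : Tile := ⟨15, 0, 0, 16⟩
def tR3 : Tile := ⟨9, 16, 17, 6⟩
def tGa : Tile := ⟨17, 2, 3, 2⟩
def tJ : Tile := ⟨18, 2, 19, 6⟩
def tM1 : Tile := ⟨19, 2, 7, 0⟩
def tT1 : Tile := ⟨1, 4, 20, 21⟩
def tT2 : Tile := ⟨1, 21, 22, 4⟩
def tT3 : Tile := ⟨22, 0, 0, 4⟩
def tS0 : Tile := ⟨0, 26, 0, 0⟩
def tB1 : Tile := ⟨0, 27, 0, 26⟩
def tB2 : Tile := ⟨28, 5, 0, 27⟩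
def tB3 : Tile := ⟨9, 2, 28, 29⟩
def tB4 : Tile := ⟨0, 29, 0, 30⟩
def tB5 : Tile := ⟨1, 30, 0, 0⟩
def Tl : List Tile := [tF, tFc, tFl, tF0, tD, tA1, tAz, tAT, tP, tFx, tX, tXs, tX3, tX4, tBe, tK1, tK2, tK3, tR3, tGa, tJ, tM1, tT1, tT2, tT3, tS0, tB1, tB2, tB3, tB4, tB5]
def inN (t : Tile) : Bool := [tFc, tF0, tA1, tAz, tK3, tGa, tJ, tM1, tT3].contains t
def inE (t : Tile) : Bool := [tFl, tFx, tBe, tR3, tT1, tT2, tB4, tB5].contains t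
def inS (t : Tile) : Bool := [tF, tFl, tAT, tP, tX, tXs, tBe, tT1, tB3].contains t
def inW (t : Tile) : Bool := [tF, tFc, tF0, tD, tA1, tAz, tAT, tX3, tX4, tK1, tK2, tR3, tJ, tB1, tB2].contains t
def guN (t : Tile) : Bool := inN t || t == tR3
def TT : Finset Tile := Tl.toFinset

def ov (C : Config) (f : ℤ → ℤ → Option Tile) : Config :=
  fun p => match C p with | some t => some t | none => f p.1 p.2

theorem ov_old {C f p} (h : C p ≠ none) : ov C f p = C p := by
  unfold ov; cases hC : C p
  · exact absurd hC h
  · rfl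
theorem ov_new {C f} {x y : ℤ} (h : C (x,y) = none) : ov C f (x,y) = f x y := by
  unfold ov; rw [h]
theorem ov_le (C f) : Le C (ov C f) := fun _ h => ov_old h

def EN (C : Config) (f : ℤ → ℤ → Option Tile) (x y : ℤ) : Glue :=
  match C (x, y+1) with
  | some u => u.south
  | none => match f x (y+1) with | some u => if inS u then 0 else u.south | none => 0
def EE (C : Config) (f : ℤ → ℤ → Option Tile) (x y : ℤ) : Glue :=
  match C (x+1, y) with
  | some u => u.west
  | none => match f (x+1) y with | some u => if inW u then 0 else u.west | none => 0
def ES (C : Config) (f : ℤ → ℤ → Option Tile) (x y : ℤ) : Glue :=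
  match C (x, y-1) with
  | some u => u.north
  | none => match f x (y-1) with | some u => if guN u then 0 else u.north | none => 0
def EW (C : Config) (f : ℤ → ℤ → Option Tile) (x y : ℤ) : Glue :=
  match C (x-1, y) with
  | some u => u.east
  | none => match f (x-1) y with | some u => if inE u then 0 else u.east | none => 0

structure Good (C0 : Config) (f : ℤ → ℤ → Option Tile) (C : Config) : Prop where
  le0 : Le C0 C
  ler : Le C (ov C0 f)
  cl : ∀ x y t, C0 (x,y) = none → C (x,y) = some t →
    (guN t = true → C (x,y+1) ≠ none) ∧ (inE t = true → C (x+1,y) ≠ none) ∧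
    (inS t = true → C (x,y-1) ≠ none) ∧ (inW t = true → C (x-1,y) ≠ none)

theorem Good.le0n {C0 f C} (h : Good C0 f C) {p} (hp : C p = none) : C0 p = none := by
  by_contra hc; rw [h.le0 p hc] at hp; exact hc hp

theorem Good.f_eq {C0 f C} (h : Good C0 f C) {x y : ℤ} {t} (h0 : C0 (x,y) = none) (hp : C (x,y) = some t) :
    f x y = some t := by
  have := h.ler (x,y) (by rw [hp]; simp)
  rw [ov_new h0, hp] at this; exact this

theorem Good.n {C0 f C} (h : Good C0 f C) {x y} (hp : C (x,y) = none) :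
    sG C x (y+1) = 0 ∨ sG C x (y+1) = EN C0 f x y := by
  unfold sG EN
  cases hq : C (x, y+1) with
  | none => left; rfl
  | some u =>
    right
    cases h0 : C0 (x, y+1) with
    | some v => have := h.le0 _ (by rw [h0]; simp); rw [hq, h0] at this; cases this; rfl
    | none =>
      have hf := h.f_eq h0 hq
      have := (h.cl _ _ _ h0 hq).2.2.1
      simp only [hf]
      by_cases hi : inS u = true
      · exact absurd (by simpa using hp) (this hi)
      · simp [hi]
theorem Good.e {C0 f C} (h : Good C0 f C) {x y} (hp : C (x,y) = none) :
    wG C (x+1) y = 0 ∨ wG C (x+1) y = EE C0 f x y := by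
  unfold wG EE
  cases hq : C (x+1, y) with
  | none => left; rfl
  | some u =>
    right
    cases h0 : C0 (x+1, y) with
    | some v => have := h.le0 _ (by rw [h0]; simp); rw [hq, h0] at this; cases this; rfl
    | none =>
      have hf := h.f_eq h0 hq
      have := (h.cl _ _ _ h0 hq).2.2.2
      simp only [hf]
      by_cases hi : inW u = true
      · exact absurd (by simpa using hp) (this hi)
      · simp [hi]
theorem Good.s {C0 f C} (h : Good C0 f C) {x y} (hp : C (x,y) = none) :
    nG C x (y-1) = 0 ∨ nG C x (y-1) = ES C0 f x y := by
  unfold nG ES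
  cases hq : C (x, y-1) with
  | none => left; rfl
  | some u =>
    right
    cases h0 : C0 (x, y-1) with
    | some v => have := h.le0 _ (by rw [h0]; simp); rw [hq, h0] at this; cases this; rfl
    | none =>
      have hf := h.f_eq h0 hq
      have := (h.cl _ _ _ h0 hq).1
      simp only [hf]
      by_cases hi : guN u = true
      · exact absurd (by simpa using hp) (this hi)
      · simp [hi]
theorem Good.w {C0 f C} (h : Good C0 f C) {x y} (hp : C (x,y) = none) :
    eG C (x-1) y = 0 ∨ eG C (x-1) y = EW C0 f x y := by
  unfold eG EW
  cases hq : C (x-1, y) with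
  | none => left; rfl
  | some u =>
    right
    cases h0 : C0 (x-1, y) with
    | some v => have := h.le0 _ (by rw [h0]; simp); rw [hq, h0] at this; cases this; rfl
    | none =>
      have hf := h.f_eq h0 hq
      have := (h.cl _ _ _ h0 hq).2.1
      simp only [hf]
      by_cases hi : inE u = true
      · exact absurd (by simpa using hp) (this hi)
      · simp [hi]

theorem E_R (C0 f) (x y : ℤ) :
    (EN C0 f x y = 0 ∨ sG (ov C0 f) x (y+1) = EN C0 f x y) ∧
    (EE C0 f x y = 0 ∨ wG (ov C0 f) (x+1) y = EE C0 f x y) ∧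
    (ES C0 f x y = 0 ∨ nG (ov C0 f) x (y-1) = ES C0 f x y) ∧
    (EW C0 f x y = 0 ∨ eG (ov C0 f) (x-1) y = EW C0 f x y) := by
  refine ⟨?_, ?_, ?_, ?_⟩
  · unfold EN sG ov; cases C0 (x, y+1) <;> simp; cases f x (y+1) <;> simp; rename_i u; cases inS u <;> simp
  · unfold EE wG ov; cases C0 (x+1, y) <;> simp; cases f (x+1) y <;> simp; rename_i u; cases inW u <;> simp
  · unfold ES nG ov; cases C0 (x, y-1) <;> simp; cases f x (y-1) <;> simp; rename_i u; cases guN u <;> simp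
  · unfold EW eG ov; cases C0 (x-1, y) <;> simp; cases f (x-1) y <;> simp; rename_i u; cases inE u <;> simp

/-- sum of the input bonds -/
def isum (t : Tile) (n e s w : Glue) : ℕ :=
  (if inN t then bond gs t.north n else 0) + (if inE t then bond gs t.east e else 0) +
  (if inS t then bond gs t.south s else 0) + (if inW t then bond gs t.west w else 0)

def chk1 (τ : ℕ) (t : Tile) (n e s w : Glue) (u : Tile) : Prop :=
    τ ≤ bond gs u.north n + bond gs u.east e + bond gs u.south s + bond gs u.west w → u = t ∧
    (inN t = true → bond gs u.east e + bond gs u.south s + bond gs u.west w < τ) ∧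
    (inE t = true → bond gs u.north n + bond gs u.south s + bond gs u.west w < τ) ∧
    (inS t = true → bond gs u.north n + bond gs u.east e + bond gs u.west w < τ) ∧
    (inW t = true → bond gs u.north n + bond gs u.east e + bond gs u.south s < τ)
instance (τ t n e s w u) : Decidable (chk1 τ t n e s w u) := by unfold chk1; infer_instance
def chk (τ : ℕ) (t : Tile) (n e s w : Glue) : Prop :=
  t ∈ Tl ∧ (∀ u ∈ Tl, chk1 τ t n e s w u) ∧ τ ≤ isum t n e s w
instance (τ t n e s w) : Decidable (chk τ t n e s w) := by unfold chk; infer_instance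

theorem bz {a b c : Glue} (h : b = 0 ∨ b = c) : bond gs a b ≤ bond gs a c := by
  rcases h with rfl | rfl
  · rw [bd0]; exact Nat.zero_le _
  · exact le_rfl

theorem chk_att {τ t n e s w} (h : chk τ t n e s w) {u} (hu : u ∈ Tl) {n' e' s' w' : Glue}
    (hn : n' = 0 ∨ n' = n) (he : e' = 0 ∨ e' = e) (hs : s' = 0 ∨ s' = s) (hw : w' = 0 ∨ w' = w)
    (ha : τ ≤ bond gs u.north n' + bond gs u.east e' + bond gs u.south s' + bond gs u.west w') :
    u = t ∧ (inN t = true → n' ≠ 0) ∧ (inE t = true → e' ≠ 0) ∧ (inS t = true → s' ≠ 0) ∧ (inW t = true → w' ≠ 0) := by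
  have bn := bz (a := u.north) hn
  have be := bz (a := u.east) he
  have bs := bz (a := u.south) hs
  have bw := bz (a := u.west) hw
  obtain ⟨h1, h2, h3, h4, h5⟩ := h.2.1 u hu (by omega)
  refine ⟨h1, fun hi h0 => ?_, fun hi h0 => ?_, fun hi h0 => ?_, fun hi h0 => ?_⟩
  · have := h2 hi; rw [h0, bd0] at ha; omega
  · have := h3 hi; rw [h0, bd0] at ha; omega
  · have := h4 hi; rw [h0, bd0] at ha; omega
  · have := h5 hi; rw [h0, bd0] at ha; omega

structure Loc (τ : ℕ) (C0 : Config) (f : ℤ → ℤ → Option Tile) : Prop where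
  out : ∀ x y, C0 (x,y) = none → f x y = none →
    gs (EN C0 f x y) + gs (EE C0 f x y) + gs (ES C0 f x y) + gs (EW C0 f x y) < τ
  loc : ∀ x y t, C0 (x,y) = none → f x y = some t →
    chk τ t (EN C0 f x y) (EE C0 f x y) (ES C0 f x y) (EW C0 f x y)
  r3 : ∀ C, Good C0 f C → ∀ x y, C0 (x,y) = none → f x y = some tR3 → C (x+1,y) ≠ none → C (x,y+1) ≠ none

theorem sG_ne {C x y} (h : sG C x y ≠ 0) : C (x,y) ≠ none := by
  intro hc; apply h; unfold sG; rw [hc]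
theorem nG_ne {C x y} (h : nG C x y ≠ 0) : C (x,y) ≠ none := by
  intro hc; apply h; unfold nG; rw [hc]
theorem wG_ne {C x y} (h : wG C x y ≠ 0) : C (x,y) ≠ none := by
  intro hc; apply h; unfold wG; rw [hc]
theorem eG_ne {C x y} (h : eG C x y ≠ 0) : C (x,y) ≠ none := by
  intro hc; apply h; unfold eG; rw [hc]

theorem att_sound {τ C0 f} (H : Loc τ C0 f) {C} (hC : Good C0 f C) {x y u} (hu : u ∈ TT)
    (hp : C (x,y) = none) (ha : τ ≤ attachStrength gs C u (x,y)) :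
    f x y = some u ∧ (inN u = true → C (x,y+1) ≠ none) ∧ (inE u = true → C (x+1,y) ≠ none) ∧
    (inS u = true → C (x,y-1) ≠ none) ∧ (inW u = true → C (x-1,y) ≠ none) := by
  have h0 := hC.le0n hp
  rw [att_eq] at ha
  have hn := hC.n hp
  have he := hC.e hp
  have hs := hC.s hp
  have hw := hC.w hp
  cases hf : f x y with
  | none =>
    exfalso
    have := H.out x y h0 hf
    have b1 := (bz (a := u.north) hn).trans (bd_le _ _)
    have b2 := (bz (a := u.east) he).trans (bd_le _ _)
    have b3 := (bz (a := u.south) hs).trans (bd_le _ _)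
    have b4 := (bz (a := u.west) hw).trans (bd_le _ _)
    omega
  | some t =>
    have := H.loc x y t h0 hf
    obtain ⟨rfl, h1, h2, h3, h4⟩ := chk_att this (List.mem_toFinset.1 hu) hn he hs hw ha
    exact ⟨rfl, fun h => sG_ne (h1 h), fun h => wG_ne (h2 h), fun h => nG_ne (h3 h), fun h => eG_ne (h4 h)⟩

theorem upd_ne {C : Config} {p q t} (h : C q ≠ none) : Function.update C p (some t) q ≠ none := by
  by_cases hq : q = p
  · subst hq; simp
  · rw [Function.update_of_ne hq]; exact h

theorem good_att {τ C0 f} (H : Loc τ C0 f) {C} (hC : Good C0 f C) {x y u} (hu : u ∈ TT)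
    (hp : C (x,y) = none) (ha : τ ≤ attachStrength gs C u (x,y)) :
    Good C0 f (Function.update C (x,y) (some u)) := by
  obtain ⟨hf, h1, h2, h3, h4⟩ := att_sound H hC hu hp ha
  have h0 := hC.le0n hp
  refine ⟨?_, ?_, ?_⟩
  · intro q hq
    rw [Function.update_of_ne, hC.le0 q hq]
    rintro rfl; exact hq h0
  · intro q hq
    by_cases e : q = (x,y)
    · subst e; rw [ov_new h0, hf]; simp
    · rw [Function.update_of_ne e] at hq ⊢; exact hC.ler q hq
  · intro x' y' t ht0 ht
    by_cases e : (x',y') = (x,y)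
    · cases e
      rw [Function.update_self] at ht; cases ht
      refine ⟨fun h => upd_ne ?_, fun h => upd_ne (h2 h), fun h => upd_ne (h3 h), fun h => upd_ne (h4 h)⟩
      unfold guN at h
      rw [Bool.or_eq_true] at h
      rcases h with h | h
      · exact h1 h
      · have := of_decide_eq_true h
        subst this
        exact H.r3 C hC x y h0 hf (h2 (by decide))
    · rw [Function.update_of_ne e] at ht
      obtain ⟨a, b, c, d⟩ := hC.cl x' y' t ht0 ht
      exact ⟨fun h => upd_ne (a h), fun h => upd_ne (b h), fun h => upd_ne (c h), fun h => upd_ne (d h)⟩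

theorem good_refl (C0 f) : Good C0 f C0 :=
  ⟨fun _ _ => rfl, ov_le _ _, fun x y t h h' => by rw [h] at h'; cases h'⟩

theorem stable_att {τ C} (hs : Stable τ C) {x y u} (hp : C (x,y) = none)
    (ha : τ ≤ attachStrength gs C u (x,y)) : Stable τ (Function.update C (x,y) (some u)) := by
  have hle : Le C (Function.update C (x,y) (some u)) := by
    intro q hq; rw [Function.update_of_ne]; rintro rfl; exact hq hp
  apply stable_ext hle hs
  intro Q hQ hQ2
  have hall : ∀ p ∈ Q, p = (x,y) := by
    intro p hpQ
    by_contra hc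
    obtain ⟨h1, h2⟩ := hQ2 p hpQ
    rw [Function.update_of_ne hc] at h1; exact h1 h2
  obtain ⟨p, hpQ⟩ := hQ
  have := hall p hpQ; subst this
  refine le_trans ?_ (out_le_cut hpQ)
  rw [out_eq, if_neg, if_neg, if_neg, if_neg]
  · refine ha.trans (le_of_eq ?_)
    rw [att_eq]
    have e : ∀ q, q ≠ (x,y) → Function.update C (x,y) (some u) q = C q := fun q h => Function.update_of_ne h _ _
    unfold bN bE bS bW nG eG sG wG
    rw [e (x,y+1) (by simp), e (x+1,y) (by simp), e (x,y-1) (by simp), e (x-1,y) (by simp)]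
    simp
  · intro h; have := hall _ h; simp at this
  · intro h; have := hall _ h; simp at this
  · intro h; have := hall _ h; simp at this
  · intro h; have := hall _ h; simp at this

def Rk (C0 : Config) (f : ℤ → ℤ → Option Tile) (rk : ℤ → ℤ → ℤ) : Prop :=
  ∀ x y t, C0 (x,y) = none → f x y = some t →
    (inN t = true → C0 (x,y+1) ≠ none ∨ rk x (y+1) < rk x y) ∧
    (inE t = true → C0 (x+1,y) ≠ none ∨ rk (x+1) y < rk x y) ∧
    (inS t = true → C0 (x,y-1) ≠ none ∨ rk x (y-1) < rk x y) ∧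
    (inW t = true → C0 (x-1,y) ≠ none ∨ rk (x-1) y < rk x y)

theorem bze {a b c : Glue} (h : c = 0 ∨ b = c) : bond gs a c ≤ bond gs a b := by
  rcases h with rfl | rfl
  · rw [bd0]; exact Nat.zero_le _
  · exact le_rfl

theorem isum_le {t : Tile} {n e s w n' e' s' w' : Glue}
    (hn : inN t = true → n = 0 ∨ n' = n) (he : inE t = true → e = 0 ∨ e' = e)
    (hs : inS t = true → s = 0 ∨ s' = s) (hw : inW t = true → w = 0 ∨ w' = w) :
    isum t n e s w ≤ bond gs t.north n' + bond gs t.east e' + bond gs t.south s' + bond gs t.west w' := by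
  unfold isum
  have a1 : (if inN t then bond gs t.north n else 0) ≤ bond gs t.north n' := by
    split_ifs with h
    · exact bze (hn h)
    · exact Nat.zero_le _
  have a2 : (if inE t then bond gs t.east e else 0) ≤ bond gs t.east e' := by
    split_ifs with h
    · exact bze (he h)
    · exact Nat.zero_le _
  have a3 : (if inS t then bond gs t.south s else 0) ≤ bond gs t.south s' := by
    split_ifs with h
    · exact bze (hs h)
    · exact Nat.zero_le _
  have a4 : (if inW t then bond gs t.west w else 0) ≤ bond gs t.west w' := by
    split_ifs with h
    · exact bze (hw h)
    · exact Nat.zero_le _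
  omega

theorem eq_of_missing {C0 f C} (hC : Good C0 f C) {p} (h : C p ≠ none ∨ ov C0 f p = none) :
    C p = ov C0 f p := by
  by_cases hc : C p = none
  · rcases h with h | h
    · exact absurd hc h
    · rw [hc, h]
  · exact (hC.ler p hc).symm

theorem exists_att {τ C0 f rk} (H : Loc τ C0 f) (hr : Rk C0 f rk) (hfin : (shape (ov C0 f)).Finite)
    {C} (hC : Good C0 f C) (hne : C ≠ ov C0 f) :
    ∃ x y t, C (x,y) = none ∧ t ∈ TT ∧ τ ≤ attachStrength gs C t (x,y) := by
  set M : Set (ℤ × ℤ) := {p | C p = none ∧ ov C0 f p ≠ none} with hM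
  have hMf : M.Finite := hfin.subset (fun p hp => hp.2)
  have hMne : M.Nonempty := by
    by_contra hc
    rw [Set.not_nonempty_iff_eq_empty] at hc
    apply hne; funext p
    apply eq_of_missing hC
    by_contra h2
    push Not at h2
    have : p ∈ M := ⟨h2.1, h2.2⟩
    rw [hc] at this; exact this
  obtain ⟨⟨x,y⟩, hp, hmin⟩ := Set.exists_min_image M (fun p => rk p.1 p.2) hMf hMne
  obtain ⟨hp1, hp2⟩ := hp
  have h0 := hC.le0n hp1
  rw [ov_new h0] at hp2
  obtain ⟨t, ht⟩ := Option.ne_none_iff_exists'.1 hp2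
  have hc := H.loc x y t h0 ht
  obtain ⟨r1, r2, r3, r4⟩ := hr x y t h0 ht
  have key : ∀ a b : ℤ, (C0 (a,b) ≠ none ∨ rk a b < rk x y) → C (a,b) = ov C0 f (a,b) := by
    intro a b h
    apply eq_of_missing hC
    by_contra h2
    push Not at h2
    rcases h with h | h
    · exact h (hC.le0n h2.1)
    · have := hmin (a,b) ⟨h2.1, h2.2⟩
      simp at this; omega
  obtain ⟨e1, e2, e3, e4⟩ := E_R C0 f x y
  refine ⟨x, y, t, hp1, List.mem_toFinset.2 hc.1, ?_⟩
  rw [att_eq]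
  refine hc.2.2.trans (isum_le ?_ ?_ ?_ ?_)
  · intro h; have := key _ _ (r1 h); unfold sG at e1 ⊢; rw [this]; exact e1
  · intro h; have := key _ _ (r2 h); unfold wG at e2 ⊢; rw [this]; exact e2
  · intro h; have := key _ _ (r3 h); unfold nG at e3 ⊢; rw [this]; exact e3
  · intro h; have := key _ _ (r4 h); unfold eG at e4 ⊢; rw [this]; exact e4

theorem stable_rank {τ C0 f rk D} (hr : Rk C0 f rk) (h0D : Le C0 D) (hD : Le D (ov C0 f)) (hs : Stable τ D)
    (hi : ∀ x y t, D (x,y) = none → C0 (x,y) = none → f x y = some t →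
      τ ≤ isum t (EN C0 f x y) (EE C0 f x y) (ES C0 f x y) (EW C0 f x y)) : Stable τ (ov C0 f) := by
  apply stable_ext hD hs
  intro Q hQ hQ2
  obtain ⟨⟨x,y⟩, hp, hmin⟩ := Finset.exists_min_image Q (fun p => rk p.1 p.2) hQ
  obtain ⟨h1, h2⟩ := hQ2 _ hp
  have h0 : C0 (x,y) = none := by
    by_contra hc; rw [h0D _ hc] at h2; exact hc h2
  rw [ov_new h0] at h1
  obtain ⟨t, ht⟩ := Option.ne_none_iff_exists'.1 h1
  have hc := hi x y t h2 h0 ht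
  obtain ⟨r1, r2, r3, r4⟩ := hr x y t h0 ht
  obtain ⟨e1, e2, e3, e4⟩ := E_R C0 f x y
  have key : ∀ a b : ℤ, (C0 (a,b) ≠ none ∨ rk a b < rk x y) → (a,b) ∉ Q := by
    intro a b h hab
    rcases h with h | h
    · have := (hQ2 _ hab).2
      rw [h0D _ h] at this; exact h this
    · have := hmin (a,b) hab
      simp at this; omega
  refine le_trans ?_ (out_le_cut hp)
  rw [out_eq]
  have hR : ov C0 f (x,y) = some t := by rw [ov_new h0, ht]
  have g1 : nG (ov C0 f) x y = t.north := by unfold nG; rw [hR]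
  have g2 : eG (ov C0 f) x y = t.east := by unfold eG; rw [hR]
  have g3 : sG (ov C0 f) x y = t.south := by unfold sG; rw [hR]
  have g4 : wG (ov C0 f) x y = t.west := by unfold wG; rw [hR]
  unfold bN bE bS bW
  rw [g1, g2, g3, g4]
  refine hc.trans ?_
  unfold isum
  have a1 : (if inN t then bond gs t.north (EN C0 f x y) else 0) ≤
      if (x, y+1) ∈ Q then 0 else bond gs t.north (sG (ov C0 f) x (y+1)) := by
    by_cases h : inN t = true
    · rw [if_pos h, if_neg (key _ _ (r1 h))]; exact bze e1
    · rw [if_neg h]; exact Nat.zero_le _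
  have a2 : (if inE t then bond gs t.east (EE C0 f x y) else 0) ≤
      if (x+1, y) ∈ Q then 0 else bond gs t.east (wG (ov C0 f) (x+1) y) := by
    by_cases h : inE t = true
    · rw [if_pos h, if_neg (key _ _ (r2 h))]; exact bze e2
    · rw [if_neg h]; exact Nat.zero_le _
  have a3 : (if inS t then bond gs t.south (ES C0 f x y) else 0) ≤
      if (x, y-1) ∈ Q then 0 else bond gs t.south (nG (ov C0 f) x (y-1)) := by
    by_cases h : inS t = true
    · rw [if_pos h, if_neg (key _ _ (r3 h))]; exact bze e3
    · rw [if_neg h]; exact Nat.zero_le _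
  have a4 : (if inW t then bond gs t.west (EW C0 f x y) else 0) ≤
      if (x-1, y) ∈ Q then 0 else bond gs t.west (eG (ov C0 f) (x-1) y) := by
    by_cases h : inW t = true
    · rw [if_pos h, if_neg (key _ _ (r4 h))]; exact bze e4
    · rw [if_neg h]; exact Nat.zero_le _
  omega

end TT

namespace TT

structure PhaseOK (step : Config → Config → Prop) (C R : Config) : Prop where
  fin : PhaseTerminates step C
  uniq : ∀ D, Relation.ReflTransGen step C D → Terminal step D → D = R
  reach : Relation.ReflTransGen step C R
  term : Terminal step R

theorem PhaseOK.of_step {step : Config → Config → Prop} {C R : Config}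
    (h : ∀ D, step C D → PhaseOK step D R) (hex : ∃ D, step C D) : PhaseOK step C R := by
  obtain ⟨D0, hD0⟩ := hex
  refine ⟨?_, ?_, ?_, (h _ hD0).term⟩
  · rintro ⟨f, h0, hf⟩
    have := hf 0
    rw [h0] at this
    exact (h _ this).fin ⟨fun n => f (n+1), rfl, fun n => hf (n+1)⟩
  · intro D hD hT
    rcases Relation.ReflTransGen.cases_head hD with rfl | ⟨E, h1, h2⟩
    · exact absurd hD0 (hT D0)
    · exact (h E h1).uniq D h2 hT
  · exact Relation.ReflTransGen.head hD0 (h _ hD0).reach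

theorem PhaseOK.of_term {step : Config → Config → Prop} {C : Config}
    (h : Terminal step C) : PhaseOK step C C := by
  refine ⟨?_, ?_, Relation.ReflTransGen.refl, h⟩
  · rintro ⟨f, h0, hf⟩
    have := hf 0
    rw [h0] at this
    exact h _ this
  · intro D hD _
    rcases Relation.ReflTransGen.cases_head hD with rfl | ⟨E, h1, _⟩
    · rfl
    · exact absurd h1 (h E)

theorem PhaseOK.next {step : Config → Config → Prop} {C D R : Config} (h : PhaseOK step C R)
    (hs : step C D) (hR : Relation.ReflTransGen step D R) : PhaseOK step D R := by
  refine ⟨?_, fun E hE hT => h.uniq E (Relation.ReflTransGen.head hs hE) hT, hR, h.term⟩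
  rintro ⟨f, h0, hf⟩
  apply h.fin
  refine ⟨fun n => match n with | 0 => C | k+1 => f k, rfl, ?_⟩
  intro n
  cases n with
  | zero => simpa [h0] using hs
  | succ k => exact hf k

theorem grow_aux {τ C0 f rk} (H : Loc τ C0 f) (hr : Rk C0 f rk)
    (hfin : (shape (ov C0 f)).Finite) : ∀ (N : ℕ) (C : Config), Good C0 f C → Stable τ C →
      (shape (ov C0 f) \ shape C).ncard = N →
      PhaseOK (Step TT gs τ) C (ov C0 f) ∧ Stable τ (ov C0 f) := by
  intro N
  induction N using Nat.strong_induction_on with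
  | _ N ih =>
    intro C hC hs hN
    have hst : ∀ D, Step TT gs τ C D → PhaseOK (Step TT gs τ) D (ov C0 f) ∧ Stable τ (ov C0 f) := by
      intro D hD
      cases hD with
      | detach Q h1 h2 h3 h4 => exact absurd (hs Q h1 h2 h3) (by omega)
      | attach t p ht hp ha =>
        obtain ⟨x, y⟩ := p
        have hG := good_att H hC ht hp ha
        refine ih _ ?_ _ hG (stable_att hs hp ha) rfl
        rw [← hN]
        apply Set.ncard_lt_ncard _ (hfin.subset Set.sdiff_subset)
        rw [Set.ssubset_iff_of_subset]
        · refine ⟨(x,y), ⟨?_, fun h => h hp⟩, fun h => h.2 ?_⟩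
          · have := hG.ler (x,y) (by simp)
            show ov C0 f (x,y) ≠ none
            rw [this]; simp
          · show Function.update C (x,y) (some t) (x,y) ≠ none
            simp
        · rintro q ⟨h1, h2⟩
          exact ⟨h1, fun h => h2 (upd_ne h)⟩
    by_cases he : C = ov C0 f
    · refine ⟨?_, he ▸ hs⟩
      rw [he] at hst hC
      rw [he]
      apply PhaseOK.of_term
      intro D hD
      cases hD with
      | detach Q h1 h2 h3 h4 => rw [he] at hs; exact absurd (hs Q h1 h2 h3) (by omega)
      | attach t p ht hp ha =>
        obtain ⟨x, y⟩ := p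
        have := (good_att H hC ht hp ha).ler (x,y) (by simp)
        rw [hp] at this; simp at this
    · obtain ⟨x, y, t, hp, ht, ha⟩ := exists_att H hr hfin hC he
      have hex := Step.attach (T := TT) (G := gs) (τ := τ) C t (x,y) ht hp ha
      exact ⟨PhaseOK.of_step (fun D hD => (hst D hD).1) ⟨_, hex⟩, (hst _ hex).2⟩

theorem grow {τ C0 f rk} (H : Loc τ C0 f) (hr : Rk C0 f rk)
    (hfin : (shape (ov C0 f)).Finite) (hs : Stable τ C0) :
    PhaseOK (Step TT gs τ) C0 (ov C0 f) ∧ Stable τ (ov C0 f) :=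
  grow_aux H hr hfin _ C0 (good_refl _ _) hs rfl

def Run (τs : List ℕ) (C R : Config) : Prop :=
  AllFinish (Step TT gs) τs C ∧ MultiReach (Step TT gs) τs C R ∧
    ∀ D, MultiReach (Step TT gs) τs C D → D = R

theorem Run.nil (C : Config) : Run [] C C :=
  ⟨AllFinish.nil, MultiReach.nil, fun D h => by cases h; rfl⟩

theorem Run.cons {τ τs C D R} (h : PhaseOK (Step TT gs τ) C D) (h2 : Run τs D R) : Run (τ :: τs) C R := by
  refine ⟨AllFinish.cons h.fin (fun E h1 h3 => ?_), MultiReach.cons h.reach h.term h2.2.1, ?_⟩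
  · rw [h.uniq E h1 h3]; exact h2.1
  · intro E hE
    cases hE with
    | cons h1 h3 h4 => rw [h.uniq _ h1 h3] at h4; exact h2.2.2 E h4

inductive Ch : List ℕ → Config → Config → Prop
  | nil (C : Config) : Ch [] C C
  | cons {τ : ℕ} {τs : List ℕ} {C D R : Config} : PhaseOK (Step TT gs τ) C D → Ch τs D R → Ch (τ :: τs) C R

theorem Ch.run {τs C R} (h : Ch τs C R) : Run τs C R := by
  induction h with
  | nil C => exact Run.nil C
  | cons h1 _ ih => exact Run.cons h1 ih

theorem Ch.append {τs σs C D R} (h : Ch τs C D) (h' : Ch σs D R) : Ch (τs ++ σs) C R := by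
  induction h with
  | nil C => exact h'
  | cons h1 _ ih => exact Ch.cons h1 (ih h')

end TT

set_option linter.all false
namespace TT

theorem nN {C0 f} {x y : ℤ} (h : C0 (x, y+1) = none) (hf : f x (y+1) = none) : EN C0 f x y = 0 := by
  unfold EN; rw [h, hf]
theorem nO {C0 f u} {x y : ℤ} (h : C0 (x, y+1) = some u) : EN C0 f x y = u.south := by
  unfold EN; rw [h]
theorem nF {C0 f u} {x y : ℤ} (h : C0 (x, y+1) = none) (hf : f x (y+1) = some u) :
    EN C0 f x y = if inS u then 0 else u.south := by
  unfold EN; rw [h, hf]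
theorem nS {C0 f} {x y : ℤ} (h : C0 (x, y+1) ≠ none) : EN C0 f x y = sG C0 x (y+1) := by
  unfold EN sG
  obtain ⟨u, hu⟩ := Option.ne_none_iff_exists'.1 h
  rw [hu]
theorem eN {C0 f} {x y : ℤ} (h : C0 (x+1, y) = none) (hf : f (x+1) y = none) : EE C0 f x y = 0 := by
  unfold EE; rw [h, hf]
theorem eO {C0 f u} {x y : ℤ} (h : C0 (x+1, y) = some u) : EE C0 f x y = u.west := by
  unfold EE; rw [h]
theorem eF {C0 f u} {x y : ℤ} (h : C0 (x+1, y) = none) (hf : f (x+1) y = some u) :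
    EE C0 f x y = if inW u then 0 else u.west := by
  unfold EE; rw [h, hf]
theorem eS {C0 f} {x y : ℤ} (h : C0 (x+1, y) ≠ none) : EE C0 f x y = wG C0 (x+1) y := by
  unfold EE wG
  obtain ⟨u, hu⟩ := Option.ne_none_iff_exists'.1 h
  rw [hu]
theorem sN {C0 f} {x y : ℤ} (h : C0 (x, y-1) = none) (hf : f x (y-1) = none) : ES C0 f x y = 0 := by
  unfold ES; rw [h, hf]
theorem sO {C0 f u} {x y : ℤ} (h : C0 (x, y-1) = some u) : ES C0 f x y = u.north := by
  unfold ES; rw [h]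
theorem sF {C0 f u} {x y : ℤ} (h : C0 (x, y-1) = none) (hf : f x (y-1) = some u) :
    ES C0 f x y = if guN u then 0 else u.north := by
  unfold ES; rw [h, hf]
theorem sS {C0 f} {x y : ℤ} (h : C0 (x, y-1) ≠ none) : ES C0 f x y = nG C0 x (y-1) := by
  unfold ES nG
  obtain ⟨u, hu⟩ := Option.ne_none_iff_exists'.1 h
  rw [hu]
theorem wN {C0 f} {x y : ℤ} (h : C0 (x-1, y) = none) (hf : f (x-1) y = none) : EW C0 f x y = 0 := by
  unfold EW; rw [h, hf]
theorem wO {C0 f u} {x y : ℤ} (h : C0 (x-1, y) = some u) : EW C0 f x y = u.east := by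
  unfold EW; rw [h]
theorem wF {C0 f u} {x y : ℤ} (h : C0 (x-1, y) = none) (hf : f (x-1) y = some u) :
    EW C0 f x y = if inE u then 0 else u.east := by
  unfold EW; rw [h, hf]
theorem wS {C0 f} {x y : ℤ} (h : C0 (x-1, y) ≠ none) : EW C0 f x y = eG C0 (x-1) y := by
  unfold EW eG
  obtain ⟨u, hu⟩ := Option.ne_none_iff_exists'.1 h
  rw [hu]

structure Inv (s : ℤ) (S : Config) : Prop where
  hs : 3 ≤ s
  sh : ∀ x y, S (x,y) ≠ none ↔ 0 ≤ x ∧ x < s ∧ 0 ≤ y ∧ y < s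
  top : ∀ x, 0 ≤ x → x ≤ s-2 → nG S x (s-1) = 1
  cor : nG S (s-1) (s-1) = 11
  e0 : eG S (s-1) 0 = 5
  e1 : ∀ y, 1 ≤ y → y ≤ s-3 → eG S (s-1) y = 2
  e2 : eG S (s-1) (s-2) = 2 ∨ eG S (s-1) (s-2) = 16
  e3 : eG S (s-1) (s-1) = 6
  bot : ∀ x, gs (sG S x 0) ≤ 4
  lef : ∀ y, gs (wG S 0 y) ≤ 4
  st : Stable 8 S

theorem Inv.no {s S} (h : Inv s S) {x y : ℤ} (hp : x < 0 ∨ y < 0 ∨ s ≤ x ∨ s ≤ y) : S (x,y) = none := by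
  by_contra hc
  have := (h.sh x y).1 hc
  omega
theorem Inv.ye {s S} (h : Inv s S) {x y : ℤ} (hp : 0 ≤ x ∧ x < s ∧ 0 ≤ y ∧ y < s) : S (x,y) ≠ none :=
  (h.sh x y).2 hp
theorem Inv.nn {s S} (h : Inv s S) {x y : ℤ} (hp : S (x,y) = none) : x < 0 ∨ y < 0 ∨ s ≤ x ∨ s ≤ y := by
  by_contra hc
  exact h.ye (x := x) (y := y) (by omega) hp

theorem Inv.ov {s S f} (h : Inv s S) {x y : ℤ} (hp : x < 0 ∨ y < 0 ∨ s ≤ x ∨ s ≤ y) :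
    TT.ov S f (x,y) = f x y := ov_new (h.no hp)

def k1 (s x y : ℤ) : Option Tile :=
  if y = s ∧ 0 ≤ x ∧ x ≤ s-3 then some tFl
  else if y = s ∧ x = s-2 then some tBe
  else if x = s ∧ y = s-1 then some tR3
  else if x = s ∧ y = s-2 then some tGa
  else if x = s ∧ 1 ≤ y ∧ y ≤ s-3 then some tFc
  else if x = s ∧ y = 0 then some tF0
  else none
def c1 (s x y : ℤ) : Option Tile :=
  if x = s-1 ∧ y = s then some tX
  else if x = s-1 ∧ y = s+1 then some tXs
  else if x = s ∧ y = s+1 then some tX3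
  else if x = s+1 ∧ y = s+1 then some tX4
  else k1 s x y
def f5 (s x y : ℤ) : Option Tile :=
  if x = s ∧ y = s then some tK1
  else if x = s+1 ∧ y = s then some tK2
  else if x = s+1 ∧ y = s-1 then some tK3
  else c1 s x y

theorem k1_Fl {s x y : ℤ} (hs : 3 ≤ s) (h : y = s ∧ 0 ≤ x ∧ x ≤ s-3) : k1 s x y = some tFl := by
  unfold k1; split_ifs <;> first | rfl | omega
theorem k1_Be {s x y : ℤ} (hs : 3 ≤ s) (h : y = s ∧ x = s-2) : k1 s x y = some tBe := by
  unfold k1; split_ifs <;> first | rfl | omega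
theorem k1_R3 {s x y : ℤ} (hs : 3 ≤ s) (h : x = s ∧ y = s-1) : k1 s x y = some tR3 := by
  unfold k1; split_ifs <;> first | rfl | omega
theorem k1_Ga {s x y : ℤ} (hs : 3 ≤ s) (h : x = s ∧ y = s-2) : k1 s x y = some tGa := by
  unfold k1; split_ifs <;> first | rfl | omega
theorem k1_Fc {s x y : ℤ} (hs : 3 ≤ s) (h : x = s ∧ 1 ≤ y ∧ y ≤ s-3) : k1 s x y = some tFc := by
  unfold k1; split_ifs <;> first | rfl | omega
theorem k1_F0 {s x y : ℤ} (hs : 3 ≤ s) (h : x = s ∧ y = 0) : k1 s x y = some tF0 := by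
  unfold k1; split_ifs <;> first | rfl | omega
theorem k1_no {s x y : ℤ} (hs : 3 ≤ s) (h : (y = s → x < 0 ∨ s-1 ≤ x) ∧ (x = s → y < 0 ∨ s ≤ y)) : k1 s x y = none := by
  unfold k1; split_ifs <;> first | rfl | omega
theorem c1_X {s x y : ℤ} (hs : 3 ≤ s) (h : x = s-1 ∧ y = s) : c1 s x y = some tX := by
  unfold c1; split_ifs <;> first | rfl | omega
theorem c1_Xs {s x y : ℤ} (hs : 3 ≤ s) (h : x = s-1 ∧ y = s+1) : c1 s x y = some tXs := by
  unfold c1; split_ifs <;> first | rfl | omega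
theorem c1_X3 {s x y : ℤ} (hs : 3 ≤ s) (h : x = s ∧ y = s+1) : c1 s x y = some tX3 := by
  unfold c1; split_ifs <;> first | rfl | omega
theorem c1_X4 {s x y : ℤ} (hs : 3 ≤ s) (h : x = s+1 ∧ y = s+1) : c1 s x y = some tX4 := by
  unfold c1; split_ifs <;> first | rfl | omega
theorem c1_k {s x y : ℤ} (h : ¬(x = s-1 ∧ y = s) ∧ ¬(x = s-1 ∧ y = s+1) ∧ ¬(x = s ∧ y = s+1) ∧ ¬(x = s+1 ∧ y = s+1)) : c1 s x y = k1 s x y := by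
  unfold c1; split_ifs <;> first | rfl | omega
theorem c1_Fl {s x y : ℤ} (hs : 3 ≤ s) (h : y = s ∧ 0 ≤ x ∧ x ≤ s-3) : c1 s x y = some tFl :=
  (c1_k (by omega)).trans (k1_Fl hs h)
theorem c1_Be {s x y : ℤ} (hs : 3 ≤ s) (h : y = s ∧ x = s-2) : c1 s x y = some tBe :=
  (c1_k (by omega)).trans (k1_Be hs h)
theorem c1_R3 {s x y : ℤ} (hs : 3 ≤ s) (h : x = s ∧ y = s-1) : c1 s x y = some tR3 :=
  (c1_k (by omega)).trans (k1_R3 hs h)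
theorem c1_Ga {s x y : ℤ} (hs : 3 ≤ s) (h : x = s ∧ y = s-2) : c1 s x y = some tGa :=
  (c1_k (by omega)).trans (k1_Ga hs h)
theorem c1_Fc {s x y : ℤ} (hs : 3 ≤ s) (h : x = s ∧ 1 ≤ y ∧ y ≤ s-3) : c1 s x y = some tFc :=
  (c1_k (by omega)).trans (k1_Fc hs h)
theorem c1_F0 {s x y : ℤ} (hs : 3 ≤ s) (h : x = s ∧ y = 0) : c1 s x y = some tF0 :=
  (c1_k (by omega)).trans (k1_F0 hs h)
theorem c1_no {s x y : ℤ} (hs : 3 ≤ s) (h : (y = s → x < 0 ∨ s-1 ≤ x) ∧ (x = s → y < 0 ∨ s ≤ y)) (h2 : ¬(x = s-1 ∧ y = s) ∧ ¬(x = s-1 ∧ y = s+1) ∧ ¬(x = s ∧ y = s+1) ∧ ¬(x = s+1 ∧ y = s+1)) : c1 s x y = none :=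
  (c1_k h2).trans (k1_no hs h)
theorem f5_K1 {s x y : ℤ} (hs : 3 ≤ s) (h : x = s ∧ y = s) : f5 s x y = some tK1 := by
  unfold f5; split_ifs <;> first | rfl | omega
theorem f5_K2 {s x y : ℤ} (hs : 3 ≤ s) (h : x = s+1 ∧ y = s) : f5 s x y = some tK2 := by
  unfold f5; split_ifs <;> first | rfl | omega
theorem f5_K3 {s x y : ℤ} (hs : 3 ≤ s) (h : x = s+1 ∧ y = s-1) : f5 s x y = some tK3 := by
  unfold f5; split_ifs <;> first | rfl | omega
theorem f5_c {s x y : ℤ} (h : ¬(x = s ∧ y = s) ∧ ¬(x = s+1 ∧ y = s) ∧ ¬(x = s+1 ∧ y = s-1)) : f5 s x y = c1 s x y := by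
  unfold f5; split_ifs <;> first | rfl | omega
theorem f5_Fl {s x y : ℤ} (hs : 3 ≤ s) (h : y = s ∧ 0 ≤ x ∧ x ≤ s-3) : f5 s x y = some tFl :=
  (f5_c (by omega)).trans (c1_Fl hs h)
theorem f5_Be {s x y : ℤ} (hs : 3 ≤ s) (h : y = s ∧ x = s-2) : f5 s x y = some tBe :=
  (f5_c (by omega)).trans (c1_Be hs h)
theorem f5_R3 {s x y : ℤ} (hs : 3 ≤ s) (h : x = s ∧ y = s-1) : f5 s x y = some tR3 :=
  (f5_c (by omega)).trans (c1_R3 hs h)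
theorem f5_Ga {s x y : ℤ} (hs : 3 ≤ s) (h : x = s ∧ y = s-2) : f5 s x y = some tGa :=
  (f5_c (by omega)).trans (c1_Ga hs h)
theorem f5_Fc {s x y : ℤ} (hs : 3 ≤ s) (h : x = s ∧ 1 ≤ y ∧ y ≤ s-3) : f5 s x y = some tFc :=
  (f5_c (by omega)).trans (c1_Fc hs h)
theorem f5_F0 {s x y : ℤ} (hs : 3 ≤ s) (h : x = s ∧ y = 0) : f5 s x y = some tF0 :=
  (f5_c (by omega)).trans (c1_F0 hs h)
theorem f5_X {s x y : ℤ} (hs : 3 ≤ s) (h : x = s-1 ∧ y = s) : f5 s x y = some tX :=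
  (f5_c (by omega)).trans (c1_X hs h)
theorem f5_Xs {s x y : ℤ} (hs : 3 ≤ s) (h : x = s-1 ∧ y = s+1) : f5 s x y = some tXs :=
  (f5_c (by omega)).trans (c1_Xs hs h)
theorem f5_X3 {s x y : ℤ} (hs : 3 ≤ s) (h : x = s ∧ y = s+1) : f5 s x y = some tX3 :=
  (f5_c (by omega)).trans (c1_X3 hs h)
theorem f5_X4 {s x y : ℤ} (hs : 3 ≤ s) (h : x = s+1 ∧ y = s+1) : f5 s x y = some tX4 :=
  (f5_c (by omega)).trans (c1_X4 hs h)
theorem f5_no {s x y : ℤ} (hs : 3 ≤ s) (h : (y = s → x < 0 ∨ s-1 ≤ x) ∧ (x = s → y < 0 ∨ s ≤ y)) (h2 : ¬(x = s-1 ∧ y = s) ∧ ¬(x = s-1 ∧ y = s+1) ∧ ¬(x = s ∧ y = s+1) ∧ ¬(x = s+1 ∧ y = s+1)) (h3 : ¬(x = s ∧ y = s) ∧ ¬(x = s+1 ∧ y = s) ∧ ¬(x = s+1 ∧ y = s-1)) : f5 s x y = none :=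
  (f5_c h3).trans (c1_no hs h h2)
theorem k1_cases {s x y : ℤ} {t} (h : k1 s x y = some t) :
    ((y = s ∧ 0 ≤ x ∧ x ≤ s-3) ∧ t = tFl) ∨ ((y = s ∧ x = s-2) ∧ t = tBe) ∨ ((x = s ∧ y = s-1) ∧ t = tR3) ∨ ((x = s ∧ y = s-2) ∧ t = tGa) ∨ ((x = s ∧ 1 ≤ y ∧ y ≤ s-3) ∧ t = tFc) ∨ ((x = s ∧ y = 0) ∧ t = tF0) := by
  unfold k1 at h
  split at h
  · next hh => exact Or.inl ⟨hh, (Option.some.inj h).symm⟩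
  split at h
  · next hh => exact Or.inr (Or.inl ⟨hh, (Option.some.inj h).symm⟩)
  split at h
  · next hh => exact Or.inr (Or.inr (Or.inl ⟨hh, (Option.some.inj h).symm⟩))
  split at h
  · next hh => exact Or.inr (Or.inr (Or.inr (Or.inl ⟨hh, (Option.some.inj h).symm⟩)))
  split at h
  · next hh => exact Or.inr (Or.inr (Or.inr (Or.inr (Or.inl ⟨hh, (Option.some.inj h).symm⟩))))
  split at h
  · next hh => exact Or.inr (Or.inr (Or.inr (Or.inr (Or.inr (⟨hh, (Option.some.inj h).symm⟩)))))
  · cases h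
theorem c1_cases {s x y : ℤ} {t} (h : c1 s x y = some t) :
    ((x = s-1 ∧ y = s) ∧ t = tX) ∨ ((x = s-1 ∧ y = s+1) ∧ t = tXs) ∨ ((x = s ∧ y = s+1) ∧ t = tX3) ∨ ((x = s+1 ∧ y = s+1) ∧ t = tX4) ∨ ((¬(x = s-1 ∧ y = s) ∧ ¬(x = s-1 ∧ y = s+1) ∧ ¬(x = s ∧ y = s+1) ∧ ¬(x = s+1 ∧ y = s+1)) ∧ k1 s x y = some t) := by
  unfold c1 at h
  split at h
  · next hh => exact Or.inl ⟨hh, (Option.some.inj h).symm⟩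
  split at h
  · next hh => exact Or.inr (Or.inl ⟨hh, (Option.some.inj h).symm⟩)
  split at h
  · next hh => exact Or.inr (Or.inr (Or.inl ⟨hh, (Option.some.inj h).symm⟩))
  split at h
  · next hh => exact Or.inr (Or.inr (Or.inr (Or.inl ⟨hh, (Option.some.inj h).symm⟩)))
  · exact Or.inr (Or.inr (Or.inr (Or.inr (⟨by refine ⟨?_, ?_, ?_, ?_⟩ <;> assumption, h⟩))))
theorem f5_cases {s x y : ℤ} {t} (h : f5 s x y = some t) :
    ((x = s ∧ y = s) ∧ t = tK1) ∨ ((x = s+1 ∧ y = s) ∧ t = tK2) ∨ ((x = s+1 ∧ y = s-1) ∧ t = tK3) ∨ ((¬(x = s ∧ y = s) ∧ ¬(x = s+1 ∧ y = s) ∧ ¬(x = s+1 ∧ y = s-1)) ∧ c1 s x y = some t) := by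
  unfold f5 at h
  split at h
  · next hh => exact Or.inl ⟨hh, (Option.some.inj h).symm⟩
  split at h
  · next hh => exact Or.inr (Or.inl ⟨hh, (Option.some.inj h).symm⟩)
  split at h
  · next hh => exact Or.inr (Or.inr (Or.inl ⟨hh, (Option.some.inj h).symm⟩))
  · exact Or.inr (Or.inr (Or.inr (⟨by refine ⟨?_, ?_, ?_⟩ <;> assumption, h⟩)))

end TT

set_option linter.all false
namespace TT

theorem l5_Fl {s S} (h : Inv s S) {x y : ℤ} (hr : y = s ∧ 0 ≤ x ∧ x ≤ s-3) : chk 5 tFl (EN S (f5 s) x y) (EE S (f5 s) x y) (ES S (f5 s) x y) (EW S (f5 s) x y) := by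
  have h3 := h.hs
  have g0 : EN S (f5 s) x y = 0 := nN (h.no (by omega)) (f5_no h.hs (by omega) (by omega) (by omega))
  have g1 : EE S (f5 s) x y = 4 := by
    rcases (by omega : x = s-3 ∨ x ≤ s-4) with hh | hh
    · exact (eF (h.no (by omega)) (f5_Be h.hs (by omega)))
    · exact (eF (h.no (by omega)) (f5_Fl h.hs (by omega)))
  have g2 : ES S (f5 s) x y = 1 := by
    rw [sS (h.ye (by omega)), (by omega : y - 1 = s - 1)]; exact (h.top _ (by omega) (by omega))
  have g3 : EW S (f5 s) x y = 0 := by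
    rcases (by omega : x = 0 ∨ 1 ≤ x) with hh | hh
    · exact wN (h.no (by omega)) (f5_no h.hs (by omega) (by omega) (by omega))
    · exact (wF (h.no (by omega)) (f5_Fl h.hs (by omega)))
  rw [g0, g1, g2, g3]; decide
theorem l5_Be {s S} (h : Inv s S) {x y : ℤ} (hr : y = s ∧ x = s-2) : chk 5 tBe (EN S (f5 s) x y) (EE S (f5 s) x y) (ES S (f5 s) x y) (EW S (f5 s) x y) := by
  have h3 := h.hs
  have g0 : EN S (f5 s) x y = 0 := nN (h.no (by omega)) (f5_no h.hs (by omega) (by omega) (by omega))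
  have g1 : EE S (f5 s) x y = 12 := (eF (h.no (by omega)) (f5_X h.hs (by omega)))
  have g2 : ES S (f5 s) x y = 1 := by
    rw [sS (h.ye (by omega)), (by omega : y - 1 = s - 1)]; exact (h.top _ (by omega) (by omega))
  have g3 : EW S (f5 s) x y = 0 := (wF (h.no (by omega)) (f5_Fl h.hs (by omega)))
  rw [g0, g1, g2, g3]; decide
theorem l5_R3 {s S} (h : Inv s S) {x y : ℤ} (hr : x = s ∧ y = s-1) : chk 5 tR3 (EN S (f5 s) x y) (EE S (f5 s) x y) (ES S (f5 s) x y) (EW S (f5 s) x y) := by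
  have h3 := h.hs
  have g0 : EN S (f5 s) x y = 0 := (nF (h.no (by omega)) (f5_K1 h.hs (by omega)))
  have g1 : EE S (f5 s) x y = 16 := (eF (h.no (by omega)) (f5_K3 h.hs (by omega)))
  have g2 : ES S (f5 s) x y = 0 := (sF (h.no (by omega)) (f5_Ga h.hs (by omega)))
  have g3 : EW S (f5 s) x y = 6 := by
    rw [wS (h.ye (by omega)), (by omega : x - 1 = s - 1), (by omega : y = s - 1)]; exact h.e3
  rw [g0, g1, g2, g3]; decide
theorem l5_Ga {s S} (h : Inv s S) {x y : ℤ} (hr : x = s ∧ y = s-2) : chk 5 tGa (EN S (f5 s) x y) (EE S (f5 s) x y) (ES S (f5 s) x y) (EW S (f5 s) x y) := by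
  have h3 := h.hs
  have g0 : EN S (f5 s) x y = 17 := (nF (h.no (by omega)) (f5_R3 h.hs (by omega)))
  have g1 : EE S (f5 s) x y = 0 := eN (h.no (by omega)) (f5_no h.hs (by omega) (by omega) (by omega))
  have g2 : ES S (f5 s) x y = 0 := by
    rcases (by omega : s = 3 ∨ 4 ≤ s) with hh | hh
    · exact (sF (h.no (by omega)) (f5_F0 h.hs (by omega)))
    · exact (sF (h.no (by omega)) (f5_Fc h.hs (by omega)))
  have g3 : EW S (f5 s) x y = 2 ∨ EW S (f5 s) x y = 16 := by
    rw [wS (h.ye (by omega)), (by omega : x - 1 = s - 1), (by omega : y = s - 2)]; exact h.e2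
  rw [g0, g1, g2]; rcases g3 with g3 | g3 <;> rw [g3] <;> decide
theorem l5_Fc {s S} (h : Inv s S) {x y : ℤ} (hr : x = s ∧ 1 ≤ y ∧ y ≤ s-3) : chk 5 tFc (EN S (f5 s) x y) (EE S (f5 s) x y) (ES S (f5 s) x y) (EW S (f5 s) x y) := by
  have h3 := h.hs
  have g0 : EN S (f5 s) x y = 3 := by
    rcases (by omega : y = s-3 ∨ y ≤ s-4) with hh | hh
    · exact (nF (h.no (by omega)) (f5_Ga h.hs (by omega)))
    · exact (nF (h.no (by omega)) (f5_Fc h.hs (by omega)))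
  have g1 : EE S (f5 s) x y = 0 := eN (h.no (by omega)) (f5_no h.hs (by omega) (by omega) (by omega))
  have g2 : ES S (f5 s) x y = 0 := by
    rcases (by omega : y = 1 ∨ 2 ≤ y) with hh | hh
    · exact (sF (h.no (by omega)) (f5_F0 h.hs (by omega)))
    · exact (sF (h.no (by omega)) (f5_Fc h.hs (by omega)))
  have g3 : EW S (f5 s) x y = 2 := by
    rw [wS (h.ye (by omega)), (by omega : x - 1 = s - 1)]; exact (h.e1 _ (by omega) (by omega))
  rw [g0, g1, g2, g3]; decide
theorem l5_F0 {s S} (h : Inv s S) {x y : ℤ} (hr : x = s ∧ y = 0) : chk 5 tF0 (EN S (f5 s) x y) (EE S (f5 s) x y) (ES S (f5 s) x y) (EW S (f5 s) x y) := by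
  have h3 := h.hs
  have g0 : EN S (f5 s) x y = 3 := by
    rcases (by omega : s = 3 ∨ 4 ≤ s) with hh | hh
    · exact (nF (h.no (by omega)) (f5_Ga h.hs (by omega)))
    · exact (nF (h.no (by omega)) (f5_Fc h.hs (by omega)))
  have g1 : EE S (f5 s) x y = 0 := eN (h.no (by omega)) (f5_no h.hs (by omega) (by omega) (by omega))
  have g2 : ES S (f5 s) x y = 0 := sN (h.no (by omega)) (f5_no h.hs (by omega) (by omega) (by omega))
  have g3 : EW S (f5 s) x y = 5 := by
    rw [wS (h.ye (by omega)), (by omega : x - 1 = s - 1), (by omega : y = 0)]; exact h.e0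
  rw [g0, g1, g2, g3]; decide
theorem l5_X {s S} (h : Inv s S) {x y : ℤ} (hr : x = s-1 ∧ y = s) : chk 5 tX (EN S (f5 s) x y) (EE S (f5 s) x y) (ES S (f5 s) x y) (EW S (f5 s) x y) := by
  have h3 := h.hs
  have g0 : EN S (f5 s) x y = 0 := (nF (h.no (by omega)) (f5_Xs h.hs (by omega)))
  have g1 : EE S (f5 s) x y = 0 := (eF (h.no (by omega)) (f5_K1 h.hs (by omega)))
  have g2 : ES S (f5 s) x y = 11 := by
    rw [sS (h.ye (by omega)), (by omega : y - 1 = s - 1), (by omega : x = s - 1)]; exact h.cor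
  have g3 : EW S (f5 s) x y = 0 := (wF (h.no (by omega)) (f5_Be h.hs (by omega)))
  rw [g0, g1, g2, g3]; decide
theorem l5_Xs {s S} (h : Inv s S) {x y : ℤ} (hr : x = s-1 ∧ y = s+1) : chk 5 tXs (EN S (f5 s) x y) (EE S (f5 s) x y) (ES S (f5 s) x y) (EW S (f5 s) x y) := by
  have h3 := h.hs
  have g0 : EN S (f5 s) x y = 0 := nN (h.no (by omega)) (f5_no h.hs (by omega) (by omega) (by omega))
  have g1 : EE S (f5 s) x y = 0 := (eF (h.no (by omega)) (f5_X3 h.hs (by omega)))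
  have g2 : ES S (f5 s) x y = 23 := (sF (h.no (by omega)) (f5_X h.hs (by omega)))
  have g3 : EW S (f5 s) x y = 0 := wN (h.no (by omega)) (f5_no h.hs (by omega) (by omega) (by omega))
  rw [g0, g1, g2, g3]; decide
theorem l5_X3 {s S} (h : Inv s S) {x y : ℤ} (hr : x = s ∧ y = s+1) : chk 5 tX3 (EN S (f5 s) x y) (EE S (f5 s) x y) (ES S (f5 s) x y) (EW S (f5 s) x y) := by
  have h3 := h.hs
  have g0 : EN S (f5 s) x y = 0 := nN (h.no (by omega)) (f5_no h.hs (by omega) (by omega) (by omega))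
  have g1 : EE S (f5 s) x y = 0 := (eF (h.no (by omega)) (f5_X4 h.hs (by omega)))
  have g2 : ES S (f5 s) x y = 0 := (sF (h.no (by omega)) (f5_K1 h.hs (by omega)))
  have g3 : EW S (f5 s) x y = 24 := (wF (h.no (by omega)) (f5_Xs h.hs (by omega)))
  rw [g0, g1, g2, g3]; decide
theorem l5_X4 {s S} (h : Inv s S) {x y : ℤ} (hr : x = s+1 ∧ y = s+1) : chk 5 tX4 (EN S (f5 s) x y) (EE S (f5 s) x y) (ES S (f5 s) x y) (EW S (f5 s) x y) := by
  have h3 := h.hs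
  have g0 : EN S (f5 s) x y = 0 := nN (h.no (by omega)) (f5_no h.hs (by omega) (by omega) (by omega))
  have g1 : EE S (f5 s) x y = 0 := eN (h.no (by omega)) (f5_no h.hs (by omega) (by omega) (by omega))
  have g2 : ES S (f5 s) x y = 0 := (sF (h.no (by omega)) (f5_K2 h.hs (by omega)))
  have g3 : EW S (f5 s) x y = 25 := (wF (h.no (by omega)) (f5_X3 h.hs (by omega)))
  rw [g0, g1, g2, g3]; decide
theorem l5_K1 {s S} (h : Inv s S) {x y : ℤ} (hr : x = s ∧ y = s) : chk 5 tK1 (EN S (f5 s) x y) (EE S (f5 s) x y) (ES S (f5 s) x y) (EW S (f5 s) x y) := by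
  have h3 := h.hs
  have g0 : EN S (f5 s) x y = 0 := (nF (h.no (by omega)) (f5_X3 h.hs (by omega)))
  have g1 : EE S (f5 s) x y = 0 := (eF (h.no (by omega)) (f5_K2 h.hs (by omega)))
  have g2 : ES S (f5 s) x y = 0 := (sF (h.no (by omega)) (f5_R3 h.hs (by omega)))
  have g3 : EW S (f5 s) x y = 13 := (wF (h.no (by omega)) (f5_X h.hs (by omega)))
  rw [g0, g1, g2, g3]; decide
theorem l5_K2 {s S} (h : Inv s S) {x y : ℤ} (hr : x = s+1 ∧ y = s) : chk 5 tK2 (EN S (f5 s) x y) (EE S (f5 s) x y) (ES S (f5 s) x y) (EW S (f5 s) x y) := by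
  have h3 := h.hs
  have g0 : EN S (f5 s) x y = 18 := (nF (h.no (by omega)) (f5_X4 h.hs (by omega)))
  have g1 : EE S (f5 s) x y = 0 := eN (h.no (by omega)) (f5_no h.hs (by omega) (by omega) (by omega))
  have g2 : ES S (f5 s) x y = 0 := (sF (h.no (by omega)) (f5_K3 h.hs (by omega)))
  have g3 : EW S (f5 s) x y = 14 := (wF (h.no (by omega)) (f5_K1 h.hs (by omega)))
  rw [g0, g1, g2, g3]; decide
theorem l5_K3 {s S} (h : Inv s S) {x y : ℤ} (hr : x = s+1 ∧ y = s-1) : chk 5 tK3 (EN S (f5 s) x y) (EE S (f5 s) x y) (ES S (f5 s) x y) (EW S (f5 s) x y) := by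
  have h3 := h.hs
  have g0 : EN S (f5 s) x y = 15 := (nF (h.no (by omega)) (f5_K2 h.hs (by omega)))
  have g1 : EE S (f5 s) x y = 0 := eN (h.no (by omega)) (f5_no h.hs (by omega) (by omega) (by omega))
  have g2 : ES S (f5 s) x y = 0 := sN (h.no (by omega)) (f5_no h.hs (by omega) (by omega) (by omega))
  have g3 : EW S (f5 s) x y = 0 := (wF (h.no (by omega)) (f5_R3 h.hs (by omega)))
  rw [g0, g1, g2, g3]; decide

end TT

set_option linter.all false
namespace TT

theorem f5_none {s x y : ℤ} (hs : 3 ≤ s) (h : f5 s x y = none) : ¬(y = s ∧ 0 ≤ x ∧ x ≤ s-3) ∧ ¬(y = s ∧ x = s-2) ∧ ¬(x = s ∧ y = s-1) ∧ ¬(x = s ∧ y = s-2) ∧ ¬(x = s ∧ 1 ≤ y ∧ y ≤ s-3) ∧ ¬(x = s ∧ y = 0) ∧ ¬(x = s-1 ∧ y = s) ∧ ¬(x = s-1 ∧ y = s+1) ∧ ¬(x = s ∧ y = s+1) ∧ ¬(x = s+1 ∧ y = s+1) ∧ ¬(x = s ∧ y = s) ∧ ¬(x = s+1 ∧ y = s)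 ∧ ¬(x = s+1 ∧ y = s-1) := by
  refine ⟨fun hr => ?_, fun hr => ?_, fun hr => ?_, fun hr => ?_, fun hr => ?_, fun hr => ?_, fun hr => ?_, fun hr => ?_, fun hr => ?_, fun hr => ?_, fun hr => ?_, fun hr => ?_, fun hr => ?_⟩
  · rw [f5_Fl hs hr] at h; cases h
  · rw [f5_Be hs hr] at h; cases h
  · rw [f5_R3 hs hr] at h; cases h
  · rw [f5_Ga hs hr] at h; cases h
  · rw [f5_Fc hs hr] at h; cases h
  · rw [f5_F0 hs hr] at h; cases h
  · rw [f5_X hs hr] at h; cases h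
  · rw [f5_Xs hs hr] at h; cases h
  · rw [f5_X3 hs hr] at h; cases h
  · rw [f5_X4 hs hr] at h; cases h
  · rw [f5_K1 hs hr] at h; cases h
  · rw [f5_K2 hs hr] at h; cases h
  · rw [f5_K3 hs hr] at h; cases h
theorem f5_nz {s x y : ℤ} (hs : 3 ≤ s) (h : f5 s x y = none) :
    (y = s → x < 0 ∨ s+2 ≤ x) ∧ (x = s → y < 0 ∨ s+2 ≤ y) ∧ (y = s+1 → x < s-1 ∨ s+2 ≤ x) ∧ ¬(x = s+1 ∧ y = s-1) := by
  obtain ⟨h1, h2, h3, h4, h5, h6, h7, h8, h9, h10, h11, h12, h13⟩ := f5_none hs h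
  refine ⟨?_, ?_, ?_, h13⟩
  · intro e; clear h3 h4 h5 h6 h8 h9 h10 h13; omega
  · intro e; clear h1 h2 h7 h8 h10 h12 h13; omega
  · intro e; clear h1 h2 h3 h4 h5 h6 h7 h11 h12 h13; omega
theorem o5_N {s S} (h : Inv s S) {x y : ℤ} (h0 : S (x,y) = none) (hf : f5 s x y = none) :
    gs (EN S (f5 s) x y) = 0 ∨ (gs (EN S (f5 s) x y) ≤ 4 ∧ (y = -1 ∧ 0 ≤ x ∧ x < s)) := by
  have h3 := h.hs
  have hx := h.nn h0
  have hz := f5_nz h.hs hf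
  by_cases hn : S (x, (y+1)) = none
  · have hw := h.nn hn
    cases hu : f5 s x (y+1) with
    | none => rw [nN hn hu]; exact Or.inl rfl
    | some u =>
      rw [nF hn hu]
      rcases f5_cases hu with ⟨hr, rfl⟩ | ⟨hr, rfl⟩ | ⟨hr, rfl⟩ | ⟨-, hc⟩
      · first | exact Or.inl rfl | exact Or.inr ⟨by decide, by omega⟩ | omega
      · first | exact Or.inl rfl | exact Or.inr ⟨by decide, by omega⟩ | omega
      · first | exact Or.inl rfl | exact Or.inr ⟨by decide, by omega⟩ | omega
      rcases c1_cases hc with ⟨hr, rfl⟩ | ⟨hr, rfl⟩ | ⟨hr, rfl⟩ | ⟨hr, rfl⟩ | ⟨-, hc⟩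
      · first | exact Or.inl rfl | exact Or.inr ⟨by decide, by omega⟩ | omega
      · first | exact Or.inl rfl | exact Or.inr ⟨by decide, by omega⟩ | omega
      · first | exact Or.inl rfl | exact Or.inr ⟨by decide, by omega⟩ | omega
      · first | exact Or.inl rfl | exact Or.inr ⟨by decide, by omega⟩ | omega
      rcases k1_cases hc with ⟨hr, rfl⟩ | ⟨hr, rfl⟩ | ⟨hr, rfl⟩ | ⟨hr, rfl⟩ | ⟨hr, rfl⟩ | ⟨hr, rfl⟩ <;>
        first | exact Or.inl rfl | exact Or.inr ⟨by decide, by omega⟩ | omega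
  · have hw := (h.sh _ _).1 hn
    rw [nS hn]
    have h2 : y + 1 = 0 := by omega
    rw [h2]; exact Or.inr ⟨h.bot x, by omega⟩
theorem o5_E {s S} (h : Inv s S) {x y : ℤ} (h0 : S (x,y) = none) (hf : f5 s x y = none) :
    gs (EE S (f5 s) x y) = 0 ∨ (gs (EE S (f5 s) x y) ≤ 4 ∧ (x = -1 ∧ 0 ≤ y ∧ y ≤ s)) := by
  have h3 := h.hs
  have hx := h.nn h0
  have hz := f5_nz h.hs hf
  by_cases hn : S ((x+1), y) = none
  · have hw := h.nn hn
    cases hu : f5 s (x+1) y with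
    | none => rw [eN hn hu]; exact Or.inl rfl
    | some u =>
      rw [eF hn hu]
      rcases f5_cases hu with ⟨hr, rfl⟩ | ⟨hr, rfl⟩ | ⟨hr, rfl⟩ | ⟨-, hc⟩
      · first | exact Or.inl rfl | exact Or.inr ⟨by decide, by omega⟩ | omega
      · first | exact Or.inl rfl | exact Or.inr ⟨by decide, by omega⟩ | omega
      · first | exact Or.inl rfl | exact Or.inr ⟨by decide, by omega⟩ | omega
      rcases c1_cases hc with ⟨hr, rfl⟩ | ⟨hr, rfl⟩ | ⟨hr, rfl⟩ | ⟨hr, rfl⟩ | ⟨-, hc⟩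
      · first | exact Or.inl rfl | exact Or.inr ⟨by decide, by omega⟩ | omega
      · first | exact Or.inl rfl | exact Or.inr ⟨by decide, by omega⟩ | omega
      · first | exact Or.inl rfl | exact Or.inr ⟨by decide, by omega⟩ | omega
      · first | exact Or.inl rfl | exact Or.inr ⟨by decide, by omega⟩ | omega
      rcases k1_cases hc with ⟨hr, rfl⟩ | ⟨hr, rfl⟩ | ⟨hr, rfl⟩ | ⟨hr, rfl⟩ | ⟨hr, rfl⟩ | ⟨hr, rfl⟩ <;>
        first | exact Or.inl rfl | exact Or.inr ⟨by decide, by omega⟩ | omega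
  · have hw := (h.sh _ _).1 hn
    rw [eS hn]
    have h2 : x + 1 = 0 := by omega
    rw [h2]; exact Or.inr ⟨h.lef y, by omega⟩
theorem o5_S {s S} (h : Inv s S) {x y : ℤ} (h0 : S (x,y) = none) (hf : f5 s x y = none) :
    gs (ES S (f5 s) x y) = 0 ∨ (gs (ES S (f5 s) x y) ≤ 4 ∧ ((y = s+1 ∧ 0 ≤ x ∧ x ≤ s-2) ∨ (y = s+2 ∧ s-1 ≤ x ∧ x ≤ s))) := by
  have h3 := h.hs
  have hx := h.nn h0
  have hz := f5_nz h.hs hf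
  by_cases hn : S (x, (y-1)) = none
  · have hw := h.nn hn
    cases hu : f5 s x (y-1) with
    | none => rw [sN hn hu]; exact Or.inl rfl
    | some u =>
      rw [sF hn hu]
      rcases f5_cases hu with ⟨hr, rfl⟩ | ⟨hr, rfl⟩ | ⟨hr, rfl⟩ | ⟨-, hc⟩
      · first | exact Or.inl rfl | exact Or.inr ⟨by decide, by omega⟩ | omega
      · first | exact Or.inl rfl | exact Or.inr ⟨by decide, by omega⟩ | omega
      · first | exact Or.inl rfl | exact Or.inr ⟨by decide, by omega⟩ | omega
      rcases c1_cases hc with ⟨hr, rfl⟩ | ⟨hr, rfl⟩ | ⟨hr, rfl⟩ | ⟨hr, rfl⟩ | ⟨-, hc⟩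
      · first | exact Or.inl rfl | exact Or.inr ⟨by decide, by omega⟩ | omega
      · first | exact Or.inl rfl | exact Or.inr ⟨by decide, by omega⟩ | omega
      · first | exact Or.inl rfl | exact Or.inr ⟨by decide, by omega⟩ | omega
      · first | exact Or.inl rfl | exact Or.inr ⟨by decide, by omega⟩ | omega
      rcases k1_cases hc with ⟨hr, rfl⟩ | ⟨hr, rfl⟩ | ⟨hr, rfl⟩ | ⟨hr, rfl⟩ | ⟨hr, rfl⟩ | ⟨hr, rfl⟩ <;>
        first | exact Or.inl rfl | exact Or.inr ⟨by decide, by omega⟩ | omega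
  · have hw := (h.sh _ _).1 hn
    omega
theorem o5_W {s S} (h : Inv s S) {x y : ℤ} (h0 : S (x,y) = none) (hf : f5 s x y = none) :
    gs (EW S (f5 s) x y) = 0 ∨ (gs (EW S (f5 s) x y) ≤ 4 ∧ ((x = s+1 ∧ 0 ≤ y ∧ y ≤ s-2) ∨ (x = s+2 ∧ y = s+1))) := by
  have h3 := h.hs
  have hx := h.nn h0
  have hz := f5_nz h.hs hf
  by_cases hn : S ((x-1), y) = none
  · have hw := h.nn hn
    cases hu : f5 s (x-1) y with
    | none => rw [wN hn hu]; exact Or.inl rfl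
    | some u =>
      rw [wF hn hu]
      rcases f5_cases hu with ⟨hr, rfl⟩ | ⟨hr, rfl⟩ | ⟨hr, rfl⟩ | ⟨-, hc⟩
      · first | exact Or.inl rfl | exact Or.inr ⟨by decide, by omega⟩ | omega
      · first | exact Or.inl rfl | exact Or.inr ⟨by decide, by omega⟩ | omega
      · first | exact Or.inl rfl | exact Or.inr ⟨by decide, by omega⟩ | omega
      rcases c1_cases hc with ⟨hr, rfl⟩ | ⟨hr, rfl⟩ | ⟨hr, rfl⟩ | ⟨hr, rfl⟩ | ⟨-, hc⟩
      · first | exact Or.inl rfl | exact Or.inr ⟨by decide, by omega⟩ | omega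
      · first | exact Or.inl rfl | exact Or.inr ⟨by decide, by omega⟩ | omega
      · first | exact Or.inl rfl | exact Or.inr ⟨by decide, by omega⟩ | omega
      · first | exact Or.inl rfl | exact Or.inr ⟨by decide, by omega⟩ | omega
      rcases k1_cases hc with ⟨hr, rfl⟩ | ⟨hr, rfl⟩ | ⟨hr, rfl⟩ | ⟨hr, rfl⟩ | ⟨hr, rfl⟩ | ⟨hr, rfl⟩ <;>
        first | exact Or.inl rfl | exact Or.inr ⟨by decide, by omega⟩ | omega
  · have hw := (h.sh _ _).1 hn
    omega

theorem loc5 {s S} (h : Inv s S) : Loc 5 S (f5 s) := by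
  refine ⟨?_, ?_, ?_⟩
  · intro x y h0 hf
    have h3 := h.hs
    have a := o5_N h h0 hf
    have b := o5_E h h0 hf
    have c := o5_S h h0 hf
    have d := o5_W h h0 hf
    omega
  · intro x y t h0 hf
    rcases f5_cases hf with ⟨hr, rfl⟩ | ⟨hr, rfl⟩ | ⟨hr, rfl⟩ | ⟨-, hc⟩
    · exact l5_K1 h hr
    · exact l5_K2 h hr
    · exact l5_K3 h hr
    rcases c1_cases hc with ⟨hr, rfl⟩ | ⟨hr, rfl⟩ | ⟨hr, rfl⟩ | ⟨hr, rfl⟩ | ⟨-, hc⟩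
    · exact l5_X h hr
    · exact l5_Xs h hr
    · exact l5_X3 h hr
    · exact l5_X4 h hr
    rcases k1_cases hc with ⟨hr, rfl⟩ | ⟨hr, rfl⟩ | ⟨hr, rfl⟩ | ⟨hr, rfl⟩ | ⟨hr, rfl⟩ | ⟨hr, rfl⟩
    · exact l5_Fl h hr
    · exact l5_Be h hr
    · exact l5_R3 h hr
    · exact l5_Ga h hr
    · exact l5_Fc h hr
    · exact l5_F0 h hr
  · intro C hC x y h0 hf he
    have h3 := h.hs
    have hr : x = s ∧ y = s-1 := by
      rcases f5_cases hf with ⟨hr, ht⟩ | ⟨hr, ht⟩ | ⟨hr, ht⟩ | ⟨-, hc⟩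
      · exact absurd ht (by decide)
      · exact absurd ht (by decide)
      · exact absurd ht (by decide)
      rcases c1_cases hc with ⟨hr, ht⟩ | ⟨hr, ht⟩ | ⟨hr, ht⟩ | ⟨hr, ht⟩ | ⟨-, hc⟩
      · exact absurd ht (by decide)
      · exact absurd ht (by decide)
      · exact absurd ht (by decide)
      · exact absurd ht (by decide)
      rcases k1_cases hc with ⟨hr, ht⟩ | ⟨hr, ht⟩ | ⟨hr, ht⟩ | ⟨hr, ht⟩ | ⟨hr, ht⟩ | ⟨hr, ht⟩
      · exact absurd ht (by decide)
      · exact absurd ht (by decide)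
      · exact hr
      · exact absurd ht (by decide)
      · exact absurd ht (by decide)
      · exact absurd ht (by decide)
    obtain ⟨rfl, rfl⟩ := hr
    have key : ∀ a b : ℤ, (a < 0 ∨ b < 0 ∨ x ≤ a ∨ x ≤ b) → C (a,b) ≠ none → ∃ t, f5 x a b = some t ∧ C (a,b) = some t := by
      intro a b hab hne
      obtain ⟨t, ht⟩ := Option.ne_none_iff_exists'.1 hne
      exact ⟨t, hC.f_eq (h.no hab) ht, ht⟩
    obtain ⟨t, h1, h2⟩ := key _ _ (by omega) he
    rw [f5_K3 h3 (by omega)] at h1; cases h1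
    have := (hC.cl _ _ _ (h.no (by omega)) h2).1 (by decide)
    obtain ⟨t, h1, h2⟩ := key _ _ (by omega) this
    rw [f5_K2 h3 (by omega)] at h1; cases h1
    have := (hC.cl _ _ _ (h.no (by omega)) h2).2.2.2 (by decide)
    rw [(by omega : x + 1 - 1 = x)] at this
    exact this

def rk5 (s x y : ℤ) : ℤ :=
  if s+1 ≤ y then x + y - 2*s + 1
  else if y = s then (if x ≤ s-1 then s-1-x else x-s+1)
  else if x = s+1 then 3 else 4 + (s-1-y)

theorem rk5h {s S} (h : Inv s S) : Rk S (f5 s) (rk5 s) := by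
  intro x y t h0 hf
  have h3 := h.hs
  rcases f5_cases hf with ⟨hr, rfl⟩ | ⟨hr, rfl⟩ | ⟨hr, rfl⟩ | ⟨-, hc⟩
  · refine ⟨fun hi => ?_, fun hi => ?_, fun hi => ?_, fun hi => ?_⟩ <;>
      first
      | exact absurd hi (by decide)
      | exact Or.inl (h.ye (by omega))
      | (right; unfold rk5; split_ifs <;> omega)
  · refine ⟨fun hi => ?_, fun hi => ?_, fun hi => ?_, fun hi => ?_⟩ <;>
      first
      | exact absurd hi (by decide)
      | exact Or.inl (h.ye (by omega))
      | (right; unfold rk5; split_ifs <;> omega)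
  · refine ⟨fun hi => ?_, fun hi => ?_, fun hi => ?_, fun hi => ?_⟩ <;>
      first
      | exact absurd hi (by decide)
      | exact Or.inl (h.ye (by omega))
      | (right; unfold rk5; split_ifs <;> omega)
  rcases c1_cases hc with ⟨hr, rfl⟩ | ⟨hr, rfl⟩ | ⟨hr, rfl⟩ | ⟨hr, rfl⟩ | ⟨-, hc⟩
  · refine ⟨fun hi => ?_, fun hi => ?_, fun hi => ?_, fun hi => ?_⟩ <;>
      first
      | exact absurd hi (by decide)
      | exact Or.inl (h.ye (by omega))
      | (right; unfold rk5; split_ifs <;> omega)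
  · refine ⟨fun hi => ?_, fun hi => ?_, fun hi => ?_, fun hi => ?_⟩ <;>
      first
      | exact absurd hi (by decide)
      | exact Or.inl (h.ye (by omega))
      | (right; unfold rk5; split_ifs <;> omega)
  · refine ⟨fun hi => ?_, fun hi => ?_, fun hi => ?_, fun hi => ?_⟩ <;>
      first
      | exact absurd hi (by decide)
      | exact Or.inl (h.ye (by omega))
      | (right; unfold rk5; split_ifs <;> omega)
  · refine ⟨fun hi => ?_, fun hi => ?_, fun hi => ?_, fun hi => ?_⟩ <;>
      first
      | exact absurd hi (by decide)
      | exact Or.inl (h.ye (by omega))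
      | (right; unfold rk5; split_ifs <;> omega)
  rcases k1_cases hc with ⟨hr, rfl⟩ | ⟨hr, rfl⟩ | ⟨hr, rfl⟩ | ⟨hr, rfl⟩ | ⟨hr, rfl⟩ | ⟨hr, rfl⟩ <;>
    refine ⟨fun hi => ?_, fun hi => ?_, fun hi => ?_, fun hi => ?_⟩ <;>
      first
      | exact absurd hi (by decide)
      | exact Or.inl (h.ye (by omega))
      | (right; unfold rk5; split_ifs <;> omega)

theorem fin_of {C : Config} (N : ℤ) (H : ∀ x y, C (x,y) ≠ none → 0 ≤ x ∧ x ≤ N ∧ 0 ≤ y ∧ y ≤ N) : (shape C).Finite := by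
  apply (Set.finite_Icc ((0,0) : ℤ × ℤ) (N,N)).subset
  rintro ⟨x, y⟩ hp
  have := H x y hp
  exact ⟨Prod.mk_le_mk.2 ⟨this.1, this.2.2.1⟩, Prod.mk_le_mk.2 ⟨this.2.1, this.2.2.2⟩⟩

theorem k1_box {s x y : ℤ} (hs : 3 ≤ s) (h : k1 s x y ≠ none) :
    (y = s ∧ 0 ≤ x ∧ x ≤ s-2) ∨ (x = s ∧ 0 ≤ y ∧ y ≤ s-1) := by
  by_contra hc; exact h (k1_no hs (by omega))
theorem c1_box {s x y : ℤ} (hs : 3 ≤ s) (h : c1 s x y ≠ none) :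
    (y = s ∧ 0 ≤ x ∧ x ≤ s-1) ∨ (x = s ∧ 0 ≤ y ∧ y ≤ s-1) ∨ (y = s+1 ∧ s-1 ≤ x ∧ x ≤ s+1) := by
  by_contra hc; exact h (c1_no hs (by omega) (by omega))
theorem f5_box {s x y : ℤ} (hs : 3 ≤ s) (h : f5 s x y ≠ none) :
    0 ≤ x ∧ x ≤ s+1 ∧ 0 ≤ y ∧ y ≤ s+1 := by
  by_contra hc; exact h (f5_no hs (by omega) (by omega) (by omega))

theorem ov_some {S f} {x y : ℤ} (h : ov S f (x,y) ≠ none) : S (x,y) ≠ none ∨ f x y ≠ none := by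
  by_cases h0 : S (x,y) = none
  · rw [ov_new h0] at h; exact Or.inr h
  · exact Or.inl h0

theorem phase5 {s S} (h : Inv s S) : PhaseOK (Step TT gs 5) S (ov S (f5 s)) := by
  refine (grow (loc5 h) (rk5h h) (fin_of (s+1) ?_) (h.st.mono (by omega))).1
  intro x y hp
  rcases ov_some hp with h1 | h1
  · have := (h.sh x y).1 h1; omega
  · exact f5_box h.hs h1

end TT

set_option linter.all false
namespace TT

theorem bN_of {C : Config} {x y : ℤ} {t u} (h : C (x,y) = some t) (h' : C (x,y+1) = some u) :
    bN C x y = bond gs t.north u.south := by unfold bN nG sG; rw [h, h']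
theorem bE_of {C : Config} {x y : ℤ} {t u} (h : C (x,y) = some t) (h' : C (x+1,y) = some u) :
    bE C x y = bond gs t.east u.west := by unfold bE eG wG; rw [h, h']
theorem bS_of {C : Config} {x y : ℤ} {t u} (h : C (x,y) = some t) (h' : C (x,y-1) = some u) :
    bS C x y = bond gs t.south u.north := by unfold bS nG sG; rw [h, h']
theorem bW_of {C : Config} {x y : ℤ} {t u} (h : C (x,y) = some t) (h' : C (x-1,y) = some u) :
    bW C x y = bond gs t.west u.east := by unfold bW eG wG; rw [h, h']

theorem ov_nG {S f} {x y : ℤ} (h : S (x,y) ≠ none) : nG (ov S f) x y = nG S x y := by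
  unfold nG; rw [ov_old h]
theorem ov_eG {S f} {x y : ℤ} (h : S (x,y) ≠ none) : eG (ov S f) x y = eG S x y := by
  unfold eG; rw [ov_old h]
theorem ov_sG {S f} {x y : ℤ} (h : S (x,y) ≠ none) : sG (ov S f) x y = sG S x y := by
  unfold sG; rw [ov_old h]
theorem ov_wG {S f} {x y : ℤ} (h : S (x,y) ≠ none) : wG (ov S f) x y = wG S x y := by
  unfold wG; rw [ov_old h]

theorem Inv.k {s S f} (h : Inv s S) {x y : ℤ} {t} (hf : f x y = some t)
    (hp : x < 0 ∨ y < 0 ∨ s ≤ x ∨ s ≤ y) : TT.ov S f (x,y) = some t := by rw [h.ov hp, hf]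

theorem kRowS {s : ℤ} {S : Config} (h : Inv s S) {x : ℤ} (hx : 0 ≤ x ∧ x ≤ s-2) : bS (ov S (k1 s)) x s = 4 := by
  have h3 := h.hs
  unfold bS
  rw [ov_nG (h.ye (by omega)), h.top x hx.1 hx.2]
  rcases (by omega : x = s-2 ∨ x ≤ s-3) with h1 | h1
  · unfold sG; rw [h.k (k1_Be h3 (by omega)) (by omega)]; rfl
  · unfold sG; rw [h.k (k1_Fl h3 (by omega)) (by omega)]; rfl
theorem kRowW {s : ℤ} {S : Config} (h : Inv s S) {x : ℤ} (hx : 1 ≤ x ∧ x ≤ s-2) : bW (ov S (k1 s)) x s = 4 := by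
  have h3 := h.hs
  rcases (by omega : x = s-2 ∨ x ≤ s-3) with h1 | h1
  · rw [bW_of (h.k (k1_Be h3 (by omega)) (by omega)) (h.k (k1_Fl h3 (by omega)) (by omega))]; rfl
  · rw [bW_of (h.k (k1_Fl h3 (by omega)) (by omega)) (h.k (k1_Fl h3 (by omega)) (by omega))]; rfl
theorem kRowE0 {s : ℤ} {S : Config} (h : Inv s S) : bE (ov S (k1 s)) 0 s = 4 := by
  have h3 := h.hs
  rcases (by omega : 0 = s-3 ∨ 1 ≤ s-3) with h1 | h1
  · rw [bE_of (h.k (k1_Fl h3 (by omega)) (by omega)) (h.k (k1_Be h3 (by omega)) (by omega))]; rfl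
  · rw [bE_of (h.k (k1_Fl h3 (by omega)) (by omega)) (h.k (k1_Fl h3 (by omega)) (by omega))]; rfl
theorem kColW {s : ℤ} {S : Config} (h : Inv s S) {y : ℤ} (hy : 0 ≤ y ∧ y ≤ s-3 ∨ y = s-1) : bW (ov S (k1 s)) s y = 4 := by
  have h3 := h.hs
  unfold bW
  rw [ov_eG (h.ye (by omega))]
  rcases (by omega : y = 0 ∨ (1 ≤ y ∧ y ≤ s-3) ∨ y = s-1) with h1 | h1 | h1
  · unfold wG; rw [h.k (k1_F0 h3 (by omega)) (by omega), h1, h.e0]; rfl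
  · unfold wG; rw [h.k (k1_Fc h3 (by omega)) (by omega), h.e1 y h1.1 h1.2]; rfl
  · unfold wG; rw [h.k (k1_R3 h3 (by omega)) (by omega), h1, h.e3]; rfl
theorem kColS {s : ℤ} {S : Config} (h : Inv s S) {y : ℤ} (hy : 1 ≤ y ∧ y ≤ s-2) : bS (ov S (k1 s)) s y = 4 := by
  have h3 := h.hs
  rcases (by omega : y = s-2 ∨ y ≤ s-3) with h1 | h1 <;> rcases (by omega : y = 1 ∨ 2 ≤ y) with h2 | h2
  · rw [bS_of (h.k (k1_Ga h3 (by omega)) (by omega)) (h.k (k1_F0 h3 (by omega)) (by omega))]; rfl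
  · rw [bS_of (h.k (k1_Ga h3 (by omega)) (by omega)) (h.k (k1_Fc h3 (by omega)) (by omega))]; rfl
  · rw [bS_of (h.k (k1_Fc h3 (by omega)) (by omega)) (h.k (k1_F0 h3 (by omega)) (by omega))]; rfl
  · rw [bS_of (h.k (k1_Fc h3 (by omega)) (by omega)) (h.k (k1_Fc h3 (by omega)) (by omega))]; rfl
theorem kColS1 {s : ℤ} {S : Config} (h : Inv s S) : bS (ov S (k1 s)) s (s-1) = 8 := by
  have h3 := h.hs
  rw [bS_of (h.k (k1_R3 h3 (by omega)) (by omega)) (h.k (k1_Ga h3 (by omega)) (by omega))]; rfl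
theorem kColN0 {s : ℤ} {S : Config} (h : Inv s S) : bN (ov S (k1 s)) s 0 = 4 := by
  have h3 := h.hs
  rcases (by omega : s = 3 ∨ 4 ≤ s) with h1 | h1
  · rw [bN_of (h.k (k1_F0 h3 (by omega)) (by omega)) (h.k (k1_Ga h3 (by omega)) (by omega))]; rfl
  · rw [bN_of (h.k (k1_F0 h3 (by omega)) (by omega)) (h.k (k1_Fc h3 (by omega)) (by omega))]; rfl
theorem kColN2 {s : ℤ} {S : Config} (h : Inv s S) : bN (ov S (k1 s)) s (s-2) = 8 := by
  have h3 := h.hs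
  rw [bN_of (h.k (k1_Ga h3 (by omega)) (by omega)) (h.k (k1_R3 h3 (by omega)) (by omega))]; rfl

theorem k1_stable {s : ℤ} {S : Config} (h : Inv s S) : Stable 8 (ov S (k1 s)) := by
  have h3 := h.hs
  apply stable_ext (ov_le _ _) h.st
  intro Q hQ hQ2
  set K := ov S (k1 s) with hK
  have hin : ∀ x y : ℤ, (x,y) ∈ Q → (y = s ∧ 0 ≤ x ∧ x ≤ s-2) ∨ (x = s ∧ 0 ≤ y ∧ y ≤ s-1) := by
    intro x y hxy
    obtain ⟨h1, h2⟩ := hQ2 _ hxy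
    rw [hK, ov_new h2] at h1
    exact k1_box h3 h1
  have hno : ∀ x y : ℤ, ¬ ((y = s ∧ 0 ≤ x ∧ x ≤ s-2) ∨ (x = s ∧ 0 ≤ y ∧ y ≤ s-1)) → (x,y) ∉ Q :=
    fun x y h1 h2 => h1 (hin x y h2)
  by_cases hrow : (Q.filter (fun p => p.2 = s)).Nonempty
  · obtain ⟨⟨x,y⟩, hp, hmin⟩ := Finset.exists_min_image _ (fun p => p.1) hrow
    have hpf := hp
    have hy := (Finset.mem_filter.1 hp).2
    replace hp := (Finset.mem_filter.1 hpf).1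
    simp only at hy
    subst hy
    have hx := hin _ _ hp
    have hw : (x-1,y) ∉ Q := by
      intro hc
      have := hmin (x-1,y) (Finset.mem_filter.2 ⟨hc, rfl⟩)
      simp at this
    have hs' : ∀ x, x < y → (x, y-1) ∉ Q := fun x hx => hno _ _ (by omega)
    have o := out_le_cut (C := K) hp
    rw [out_eq, if_neg (hs' x (by omega)), if_neg hw, kRowS h (by omega)] at o
    by_cases hx0 : x = 0
    · subst hx0
      by_cases h1 : (1, y) ∈ Q
      · have o2 := out2_le_cut (C := K) hp h1 (by simp)
        rw [out_eq, out_eq, if_neg (hs' 0 (by omega)), if_neg (hs' 1 (by omega)), kRowS h (by omega), kRowS h (by omega)] at o2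
        omega
      · rw [zero_add, if_neg h1, kRowE0 h] at o
        omega
    · rw [kRowW h (by omega)] at o
      omega
  · have hin2 : ∀ x y : ℤ, (x,y) ∈ Q → (x = s ∧ 0 ≤ y ∧ y ≤ s-1) := by
      intro x y hxy
      rcases hin x y hxy with h1 | h1
      · exact absurd ⟨(x,y), Finset.mem_filter.2 ⟨hxy, h1.1⟩⟩ hrow
      · exact h1
    obtain ⟨⟨x,y⟩, hp, hmin⟩ := Finset.exists_min_image _ (fun p => p.2) hQ
    have hx := hin2 _ _ hp
    obtain ⟨rfl, hx⟩ := hx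
    have hw : ∀ y, (x-1,y) ∉ Q := fun y hc => by have := hin2 _ _ hc; omega
    have hso : (x,y-1) ∉ Q := by
      intro hc
      have := hmin _ hc
      simp at this
    have o := out_le_cut (C := K) hp
    rw [out_eq, if_neg hso, if_neg (hw y)] at o
    rcases (by omega : y = 0 ∨ (1 ≤ y ∧ y ≤ x-3) ∨ (1 ≤ y ∧ y = x-2) ∨ y = x-1) with h1 | h1 | h1 | h1
    · subst h1
      rw [kColW h (by omega)] at o
      by_cases hn : (x, 0+1) ∈ Q
      · by_cases h4 : x = 3
        · by_cases hr : (x, 0+1+1) ∈ Q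
          · have o2 := out2_le_cut (C := K) hp hr (by simp)
            rw [out_eq, out_eq, if_neg (hw _), if_neg (hw _), kColW h (by omega), kColW h (by omega)] at o2
            omega
          · have o2 := out_le_cut (C := K) hn
            have e := kColN2 h
            rw [(by omega : x - 2 = 0+1)] at e
            rw [out_eq, if_neg hr, e] at o2
            omega
        · have o2 := out2_le_cut (C := K) hp hn (by simp)
          rw [out_eq, out_eq, if_neg (hw _), if_neg (hw _), kColW h (by omega), kColW h (by omega)] at o2
          omega
      · rw [if_neg hn, kColN0 h] at o
        omega
    · rw [kColW h (by omega), kColS h (by omega)] at o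
      omega
    · rw [kColS h (by omega)] at o
      by_cases hr : (x, y+1) ∈ Q
      · have o2 := out2_le_cut (C := K) hp hr (by simp)
        rw [out_eq, out_eq, if_neg hso, if_neg (hw _), if_neg (hw _), kColW h (y := y+1) (by omega), kColS h (by omega)] at o2
        omega
      · have e := kColN2 h
        rw [← h1.2] at e
        rw [if_neg hr, e] at o
        omega
    · have e := kColS1 h
      rw [← h1] at e
      rw [e] at o
      omega

end TT

set_option linter.all false
namespace TT

theorem bond_comm (a b : Glue) : bond gs a b = bond gs b a := by
  unfold bond
  by_cases h : a = b
  · rw [h]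
  · rw [if_neg h, if_neg (Ne.symm h)]
theorem bd_le' (x y : Glue) : bond gs x y ≤ gs x := by rw [bond_comm]; exact bd_le _ _

theorem geN {C Q} {x y : ℤ} (h : (x,y+1) ∉ Q) : bN C x y ≤ outStrength gs C Q (x,y) := by
  rw [out_eq, if_neg h]; omega
theorem geE {C Q} {x y : ℤ} (h : (x+1,y) ∉ Q) : bE C x y ≤ outStrength gs C Q (x,y) := by
  rw [out_eq, if_neg h]; omega
theorem geS {C Q} {x y : ℤ} (h : (x,y-1) ∉ Q) : bS C x y ≤ outStrength gs C Q (x,y) := by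
  rw [out_eq, if_neg h]; omega
theorem geW {C Q} {x y : ℤ} (h : (x-1,y) ∉ Q) : bW C x y ≤ outStrength gs C Q (x,y) := by
  rw [out_eq, if_neg h]; omega

theorem tieV {D : Config} {Q : Finset (ℤ × ℤ)} {x y y' : ℤ} {t u} (k : ℕ) (ht : D (x,y) = some t) (hu : D (x,y') = some u)
    (hy : y' = y+1) (hb : k ≤ bond gs t.north u.south) (hc : cutStrength gs D Q < k) :
    (x,y) ∈ Q ↔ (x,y') ∈ Q := by
  subst hy
  constructor
  · intro h; by_contra h'
    have := (geN (C := D) h').trans (out_le_cut h)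
    rw [bN_of ht hu] at this; omega
  · intro h; by_contra h'
    have ht' : D (x, y+1-1) = some t := by rw [add_sub_cancel_right]; exact ht
    have := (geS (C := D) (x := x) (y := y+1) (Q := Q) (by rw [add_sub_cancel_right]; exact h')).trans (out_le_cut h)
    rw [bS_of hu ht', bond_comm] at this; omega
theorem tieH {D : Config} {Q : Finset (ℤ × ℤ)} {x y x' : ℤ} {t u} (k : ℕ) (ht : D (x,y) = some t) (hu : D (x',y) = some u)
    (hx : x' = x+1) (hb : k ≤ bond gs t.east u.west) (hc : cutStrength gs D Q < k) :
    (x,y) ∈ Q ↔ (x',y) ∈ Q := by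
  subst hx
  constructor
  · intro h; by_contra h'
    have := (geE (C := D) h').trans (out_le_cut h)
    rw [bE_of ht hu] at this; omega
  · intro h; by_contra h'
    have ht' : D (x+1-1, y) = some t := by rw [add_sub_cancel_right]; exact ht
    have := (geW (C := D) (x := x+1) (y := y) (Q := Q) (by rw [add_sub_cancel_right]; exact h')).trans (out_le_cut h)
    rw [bW_of hu ht', bond_comm] at this; omega

structure HX (s : ℤ) (D : Config) : Prop where
  X : D (s-1,s) = some tX
  Xs : D (s-1,s+1) = some tXs
  X3 : D (s,s+1) = some tX3
  X4 : D (s+1,s+1) = some tX4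
  Be : D (s-1-1,s) = some tBe
  co : nG D (s-1) (s-1) = 11

theorem HX.tie {s D} (h : HX s D) {Q : Finset (ℤ × ℤ)} (hc : cutStrength gs D Q < 8) :
    ((s-1,s) ∈ Q ↔ (s-1,s+1) ∈ Q) ∧ ((s-1,s+1) ∈ Q ↔ (s,s+1) ∈ Q) ∧ ((s,s+1) ∈ Q ↔ (s+1,s+1) ∈ Q) :=
  ⟨tieV 8 h.X h.Xs rfl (by decide) hc, tieH 8 h.Xs h.X3 (by omega) (by decide) hc, tieH 8 h.X3 h.X4 rfl (by decide) hc⟩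

theorem HX.out {s D} (h : HX s D) {Q : Finset (ℤ × ℤ)} (h1 : (s-1,s-1) ∉ Q) (h2 : (s-1-1,s) ∉ Q) :
    7 ≤ outStrength gs D Q (s-1,s) := by
  rw [out_eq, if_neg h1, if_neg h2, bW_of h.X h.Be]
  have : bS D (s-1) s = 6 := by
    unfold bS; rw [h.co]; unfold sG; rw [h.X]; rfl
  have e : bond gs tX.west tBe.east = 1 := rfl
  omega
theorem HX.out2 {s D} (h : HX s D) {Q : Finset (ℤ × ℤ)} (h1 : (s-1,s-1) ∉ Q) (h2 : (s-1-1,s) ∉ Q)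
    (h3 : (s,s) ∉ Q) (hA : D (s,s) = some tK1) : 12 ≤ outStrength gs D Q (s-1,s) := by
  have hA' : D (s-1+1,s) = some tK1 := by rw [sub_add_cancel]; exact hA
  rw [out_eq, if_neg h1, if_neg h2, if_neg (by rw [sub_add_cancel]; exact h3 : (s-1+1,s) ∉ Q), bW_of h.X h.Be, bE_of h.X hA']
  have : bS D (s-1) s = 6 := by
    unfold bS; rw [h.co]; unfold sG; rw [h.X]; rfl
  have e : bond gs tX.west tBe.east = 1 := rfl
  have e' : bond gs tX.east tK1.west = 5 := rfl
  omega

theorem hx_c {s S} (h : Inv s S) : HX s (ov S (c1 s)) := by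
  have h3 := h.hs
  refine ⟨h.k (c1_X h3 (by omega)) (by omega), h.k (c1_Xs h3 (by omega)) (by omega), h.k (c1_X3 h3 (by omega)) (by omega),
    h.k (c1_X4 h3 (by omega)) (by omega), h.k (c1_Be h3 (by omega)) (by omega), ?_⟩
  rw [ov_nG (h.ye (by omega))]; exact h.cor
theorem hx_f {s S} (h : Inv s S) : HX s (ov S (f5 s)) := by
  have h3 := h.hs
  refine ⟨h.k (f5_X h3 (by omega)) (by omega), h.k (f5_Xs h3 (by omega)) (by omega), h.k (f5_X3 h3 (by omega)) (by omega),
    h.k (f5_X4 h3 (by omega)) (by omega), h.k (f5_Be h3 (by omega)) (by omega), ?_⟩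
  rw [ov_nG (h.ye (by omega))]; exact h.cor

theorem le_kc {s S} (h : Inv s S) : Le (ov S (k1 s)) (ov S (c1 s)) := by
  rintro ⟨x,y⟩ hp
  by_cases h0 : S (x,y) = none
  · rw [ov_new h0] at hp ⊢
    rw [ov_new h0]
    have := k1_box h.hs hp
    exact c1_k (by omega)
  · rw [ov_old h0, ov_old h0]
theorem le_kf {s S} (h : Inv s S) : Le (ov S (k1 s)) (ov S (f5 s)) := by
  rintro ⟨x,y⟩ hp
  have h3 := h.hs
  by_cases h0 : S (x,y) = none
  · rw [ov_new h0] at hp ⊢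
    rw [ov_new h0]
    have := k1_box h.hs hp
    exact (f5_c (by omega)).trans (c1_k (by omega))
  · rw [ov_old h0, ov_old h0]

theorem kin {s S} (h : Inv s S) {x y : ℤ} (hp : (0 ≤ x ∧ x < s ∧ 0 ≤ y ∧ y < s) ∨ (y = s ∧ 0 ≤ x ∧ x ≤ s-2) ∨ (x = s ∧ 0 ≤ y ∧ y ≤ s-1)) :
    ov S (k1 s) (x,y) ≠ none := by
  have h3 := h.hs
  rcases hp with hp | hp | hp
  · rw [ov_old (h.ye hp)]; exact h.ye hp
  · rcases (by omega : x = s-2 ∨ x ≤ s-3) with h1 | h1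
    · rw [h.k (k1_Be h3 (by omega)) (by omega)]; simp
    · rw [h.k (k1_Fl h3 (by omega)) (by omega)]; simp
  · rcases (by omega : y = s-1 ∨ y = s-2 ∨ y = 0 ∨ (1 ≤ y ∧ y ≤ s-3)) with h1 | h1 | h1 | h1
    · rw [h.k (k1_R3 h3 (by omega)) (by omega)]; simp
    · rw [h.k (k1_Ga h3 (by omega)) (by omega)]; simp
    · rw [h.k (k1_F0 h3 (by omega)) (by omega)]; simp
    · rw [h.k (k1_Fc h3 (by omega)) (by omega)]; simp

theorem c_sub {s S} (h : Inv s S) {x y : ℤ} (h1 : ov S (c1 s) (x,y) ≠ none) (h2 : ov S (k1 s) (x,y) = none) :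
    (x = s-1 ∧ y = s) ∨ (x = s-1 ∧ y = s+1) ∨ (x = s ∧ y = s+1) ∨ (x = s+1 ∧ y = s+1) := by
  by_contra hc
  by_cases h0 : S (x,y) = none
  · rw [ov_new h0] at h1 h2
    rw [c1_k (by omega)] at h1; exact h1 h2
  · rw [ov_old h0] at h2; exact h0 h2
theorem f_sub {s S} (h : Inv s S) {x y : ℤ} (h1 : ov S (f5 s) (x,y) ≠ none) (h2 : ov S (k1 s) (x,y) = none) :
    ((x = s-1 ∧ y = s) ∨ (x = s-1 ∧ y = s+1) ∨ (x = s ∧ y = s+1) ∨ (x = s+1 ∧ y = s+1)) ∨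
    ((x = s ∧ y = s) ∨ (x = s+1 ∧ y = s) ∨ (x = s+1 ∧ y = s-1)) := by
  by_contra hc
  by_cases h0 : S (x,y) = none
  · rw [ov_new h0] at h1 h2
    rw [f5_c (by omega), c1_k (by omega)] at h1; exact h1 h2
  · rw [ov_old h0] at h2; exact h0 h2

theorem c1_stable {s S} (h : Inv s S) : Stable 7 (ov S (c1 s)) := by
  apply stable_ext (le_kc h) ((k1_stable h).mono (by omega))
  intro Q hQ hQ2
  have h3 := h.hs
  by_contra hc
  have hX := hx_c h
  obtain ⟨t1, t2, t3⟩ := hX.tie (Q := Q) (by omega)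
  have hm : (s-1,s) ∈ Q := by
    obtain ⟨⟨x,y⟩, hp⟩ := hQ
    obtain ⟨a, b⟩ := hQ2 _ hp
    rcases c_sub h a b with ⟨rfl, rfl⟩ | ⟨rfl, rfl⟩ | ⟨rfl, rfl⟩ | ⟨rfl, rfl⟩ <;> tauto
  have := (hX.out (Q := Q) (fun hq => kin h (by omega) (hQ2 _ hq).2) (fun hq => kin h (by omega) (hQ2 _ hq).2)).trans (out_le_cut hm)
  omega

theorem detA {s S} (h : Inv s S) {Q : Finset (ℤ × ℤ)} (h0 : ((0,0) : ℤ × ℤ) ∉ Q) (hne : Q.Nonempty)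
    (hsub : (↑Q : Set (ℤ × ℤ)) ⊆ shape (ov S (f5 s))) (hc : cutStrength gs (ov S (f5 s)) Q < 8) :
    (fun q => if q ∈ Q then none else ov S (f5 s) q) = ov S (c1 s) := by
  have h3 := h.hs
  have hk := avoid (le_kf h) (k1_stable h) h0 hc
  have hX := hx_f h
  obtain ⟨t1, t2, t3⟩ := hX.tie (Q := Q) hc
  have hK1 : ov S (f5 s) (s,s) = some tK1 := h.k (f5_K1 h3 (by omega)) (by omega)
  have hK2 : ov S (f5 s) (s+1,s) = some tK2 := h.k (f5_K2 h3 (by omega)) (by omega)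
  have hK3 : ov S (f5 s) (s+1,s-1) = some tK3 := h.k (f5_K3 h3 (by omega)) (by omega)
  have t4 := tieH 8 hK1 hK2 rfl (by decide) hc
  have t5 := tieV 8 hK3 hK2 (by omega) (by decide) hc
  have n1 : (s-1,s-1) ∉ Q := fun hq => kin h (by omega) (hk _ hq)
  have n2 : (s-1-1,s) ∉ Q := fun hq => kin h (by omega) (hk _ hq)
  have n3 : (s+1-1,s-1) ∉ Q := fun hq => kin h (by omega) (hk _ hq)
  have hxn : (s-1,s) ∉ Q := by
    intro hx
    by_cases ha : (s,s) ∈ Q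
    · have o := out2_le_cut (C := ov S (f5 s)) hx (t5.2 (t4.1 ha)) (by simp; omega)
      have o1 := hX.out n1 n2
      have o2 := geW (C := ov S (f5 s)) n3
      rw [bW_of hK3 (u := tR3) (h.k (f5_R3 h3 (by omega)) (by omega))] at o2
      have e : bond gs tK3.west tR3.east = 1 := rfl
      omega
    · have := (hX.out2 n1 n2 ha hK1).trans (out_le_cut hx)
      omega
  have hsb : ∀ x y, (x,y) ∈ Q → (x = s ∧ y = s) ∨ (x = s+1 ∧ y = s) ∨ (x = s+1 ∧ y = s-1) := by
    intro x y hq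
    rcases f_sub h (hsub hq) (hk _ hq) with hh | hh
    · rcases hh with ⟨rfl, rfl⟩ | ⟨rfl, rfl⟩ | ⟨rfl, rfl⟩ | ⟨rfl, rfl⟩ <;> tauto
    · exact hh
  have hin : (s,s) ∈ Q ∧ (s+1,s) ∈ Q ∧ (s+1,s-1) ∈ Q := by
    obtain ⟨⟨x,y⟩, hp⟩ := hne
    rcases hsb _ _ hp with ⟨rfl, rfl⟩ | ⟨rfl, rfl⟩ | ⟨rfl, rfl⟩ <;> tauto
  funext ⟨x, y⟩
  by_cases hq : (x,y) ∈ Q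
  · rw [if_pos hq]
    have := hsb _ _ hq
    rw [h.ov (by omega), c1_no h3 (by omega) (by omega)]
  · rw [if_neg hq]
    by_cases hS : S (x,y) = none
    · rw [ov_new hS, ov_new hS]
      apply f5_c
      refine ⟨fun e => hq ?_, fun e => hq ?_, fun e => hq ?_⟩
      · rw [e.1, e.2]; exact hin.1
      · rw [e.1, e.2]; exact hin.2.1
      · rw [e.1, e.2]; exact hin.2.2
    · rw [ov_old hS, ov_old hS]

def setA (s : ℤ) : Finset (ℤ × ℤ) := {(s,s), (s+1,s), (s+1,s-1)}

theorem cutA {s S} (h : Inv s S) : cutStrength gs (ov S (f5 s)) (setA s) ≤ 6 := by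
  have h3 := h.hs
  unfold cutStrength setA
  rw [Finset.sum_insert (by simp), Finset.sum_insert (by simp; omega), Finset.sum_singleton]
  set Q : Finset (ℤ × ℤ) := {(s,s), (s+1,s), (s+1,s-1)} with hQ
  have m1 : (s,s) ∈ Q := by simp [hQ]
  have m2 : (s+1,s) ∈ Q := by simp [hQ]
  have m3 : (s+1,s-1) ∈ Q := by simp [hQ]
  have hK1 : ov S (f5 s) (s,s) = some tK1 := h.k (f5_K1 h3 (by omega)) (by omega)
  have hK2 : ov S (f5 s) (s+1,s) = some tK2 := h.k (f5_K2 h3 (by omega)) (by omega)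
  have hK3 : ov S (f5 s) (s+1,s-1) = some tK3 := h.k (f5_K3 h3 (by omega)) (by omega)
  rw [out_eq, out_eq, out_eq, if_pos m2, if_pos m3, if_pos (by simpa using m1 : (s+1-1,s) ∈ Q), if_pos (by simpa using m2 : (s+1,s-1+1) ∈ Q)]
  unfold bN bE bS bW
  have e1 : nG (ov S (f5 s)) s s = 0 := by unfold nG; rw [hK1]; rfl
  have e2 : sG (ov S (f5 s)) s s = 0 := by unfold sG; rw [hK1]; rfl
  have e3 : wG (ov S (f5 s)) s s = 13 := by unfold wG; rw [hK1]; rfl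
  have e4 : nG (ov S (f5 s)) (s+1) s = 0 := by unfold nG; rw [hK2]; rfl
  have e5 : eG (ov S (f5 s)) (s+1) s = 0 := by unfold eG; rw [hK2]; rfl
  have e6 : eG (ov S (f5 s)) (s+1) (s-1) = 0 := by unfold eG; rw [hK3]; rfl
  have e7 : sG (ov S (f5 s)) (s+1) (s-1) = 0 := by unfold sG; rw [hK3]; rfl
  have e8 : wG (ov S (f5 s)) (s+1) (s-1) = 16 := by unfold wG; rw [hK3]; rfl
  rw [e1, e2, e3, e4, e5, e6, e7, e8]
  simp only [bd0', ite_self]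
  have b1 : (if (s-1, s) ∈ Q then 0 else bond gs 13 (eG (ov S (f5 s)) (s-1) s)) ≤ 5 := by
    split_ifs
    · omega
    · exact bd_le' _ _
  have b2 : (if (s+1-1, s-1) ∈ Q then 0 else bond gs 16 (eG (ov S (f5 s)) (s+1-1) (s-1))) ≤ 1 := by
    split_ifs
    · omega
    · exact bd_le' _ _
  omega

theorem stepA {s S} (h : Inv s S) {τ : ℕ} (ht : 7 ≤ τ) (ht' : τ ≤ 8) : Step TT gs τ (ov S (f5 s)) (ov S (c1 s)) := by
  have h3 := h.hs
  have hc := cutA h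
  have hn : (setA s).Nonempty := ⟨(s,s), by simp [setA]⟩
  have h0 : ((0,0) : ℤ × ℤ) ∉ setA s := by simp [setA]; omega
  have hsub : (↑(setA s) : Set (ℤ × ℤ)) ⊆ shape (ov S (f5 s)) := by
    intro q hq
    simp [setA] at hq
    rcases hq with rfl | rfl | rfl
    · show ov S (f5 s) _ ≠ none
      rw [h.k (f5_K1 h3 (by omega)) (by omega)]; simp
    · show ov S (f5 s) _ ≠ none
      rw [h.k (f5_K2 h3 (by omega)) (by omega)]; simp
    · show ov S (f5 s) _ ≠ none
      rw [h.k (f5_K3 h3 (by omega)) (by omega)]; simp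
  have := Step.detach (T := TT) (G := gs) (τ := τ) (ov S (f5 s)) (setA s) hn h0 hsub (by omega)
  rw [detA h h0 hn hsub (by omega)] at this
  exact this

theorem onlyA {s S} (h : Inv s S) {τ : ℕ} (ht : 7 ≤ τ) (ht' : τ ≤ 8) {D} (hD : Step TT gs τ (ov S (f5 s)) D) :
    D = ov S (c1 s) := by
  cases hD with
  | attach t p h1 h2 h3 =>
    exact absurd (Step.attach (T := TT) (G := gs) (τ := 5) _ t p h1 h2 (by omega)) ((phase5 h).term _)
  | detach Q h1 h2 h3 h4 => exact detA h h2 h1 h3 (by omega)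

end TT

set_option linter.all false
namespace TT

def fP (s x y : ℤ) : Option Tile := if x = s ∧ y = s then some tP else none
def f8 (s x y : ℤ) : Option Tile := if x = s ∧ y = s then some tP else if x = s-1 ∧ y = s then some tFx else none
theorem fP_P {s x y : ℤ} (h : x = s ∧ y = s) : fP s x y = some tP := if_pos h
theorem fP_no {s x y : ℤ} (h : ¬(x = s ∧ y = s)) : fP s x y = none := if_neg h
theorem fP_cases {s x y : ℤ} {t} (h : fP s x y = some t) : (x = s ∧ y = s) ∧ t = tP := by
  unfold fP at h; split at h
  · next hh => exact ⟨hh, (Option.some.inj h).symm⟩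
  · cases h
theorem f8_P {s x y : ℤ} (h : x = s ∧ y = s) : f8 s x y = some tP := if_pos h
theorem f8_Fx {s x y : ℤ} (h : x = s-1 ∧ y = s) : f8 s x y = some tFx := by
  unfold f8; rw [if_neg (by omega), if_pos h]
theorem f8_no {s x y : ℤ} (h : ¬(x = s ∧ y = s)) (h2 : ¬(x = s-1 ∧ y = s)) : f8 s x y = none := by
  unfold f8; rw [if_neg h, if_neg h2]
theorem f8_cases {s x y : ℤ} {t} (h : f8 s x y = some t) : ((x = s ∧ y = s) ∧ t = tP) ∨ ((x = s-1 ∧ y = s) ∧ t = tFx) := by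
  unfold f8 at h; split at h
  · next hh => exact Or.inl ⟨hh, (Option.some.inj h).symm⟩
  split at h
  · next hh => exact Or.inr ⟨hh, (Option.some.inj h).symm⟩
  · cases h
theorem k1_nz {s x y : ℤ} (hs : 3 ≤ s) (h : k1 s x y = none) :
    (y = s → x < 0 ∨ s-1 ≤ x) ∧ (x = s → y < 0 ∨ s ≤ y) := by
  constructor
  · intro e; by_contra hc
    rcases (by omega : x = s-2 ∨ x ≤ s-3) with h1 | h1
    · rw [k1_Be hs (by omega)] at h; cases h
    · rw [k1_Fl hs (by omega)] at h; cases h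
  · intro e; by_contra hc
    rcases (by omega : y = s-1 ∨ y = s-2 ∨ y = 0 ∨ (1 ≤ y ∧ y ≤ s-3)) with h1 | h1 | h1 | h1
    · rw [k1_R3 hs (by omega)] at h; cases h
    · rw [k1_Ga hs (by omega)] at h; cases h
    · rw [k1_F0 hs (by omega)] at h; cases h
    · rw [k1_Fc hs (by omega)] at h; cases h
theorem c1_nz {s x y : ℤ} (hs : 3 ≤ s) (h : c1 s x y = none) :
    (y = s → x < 0 ∨ s ≤ x) ∧ (x = s → y < 0 ∨ (s ≤ y ∧ y ≠ s+1)) ∧ (y = s+1 → x < s-1 ∨ s+2 ≤ x) := by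
  have a1 : ¬(x = s-1 ∧ y = s) := fun e => by rw [c1_X hs e] at h; cases h
  have a2 : ¬(x = s-1 ∧ y = s+1) := fun e => by rw [c1_Xs hs e] at h; cases h
  have a3 : ¬(x = s ∧ y = s+1) := fun e => by rw [c1_X3 hs e] at h; cases h
  have a4 : ¬(x = s+1 ∧ y = s+1) := fun e => by rw [c1_X4 hs e] at h; cases h
  rw [c1_k ⟨a1, a2, a3, a4⟩] at h
  have := k1_nz hs h
  omega
theorem ov_ne {S f} {p} (h : S p ≠ none) : ov S f p ≠ none := by rw [ov_old h]; exact h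
theorem Inv.ovn {s S f} (h : Inv s S) {x y : ℤ} (h0 : TT.ov S f (x,y) = none) : (x < 0 ∨ y < 0 ∨ s ≤ x ∨ s ≤ y) ∧ f x y = none := by
  by_cases hS : S (x,y) = none
  · rw [ov_new hS] at h0; exact ⟨h.nn hS, h0⟩
  · exact absurd h0 (ov_ne hS)
theorem oc_N {s S} (h : Inv s S) {x y : ℤ} (h0 : ov S (c1 s) (x,y) = none) (hf : fP s x y = none) :
    gs (EN (ov S (c1 s)) (fP s) x y) = 0 ∨ (gs (EN (ov S (c1 s)) (fP s) x y) ≤ 4 ∧ ((y = -1 ∧ 0 ≤ x ∧ x < s) ∨ (x = s+1 ∧ y = s ∧ gs (EN (ov S (c1 s)) (fP s) x y) ≤ 3))) := by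
  have h3 := h.hs
  have hx := h.ovn h0
  have hz := c1_nz h.hs hx.2
  have hx := hx.1
  have hz2 : ¬(x = s ∧ y = s) := fun e => by rw [fP_P e] at hf; cases hf
  by_cases hn : S (x, (y+1)) = none
  · have hw := h.nn hn
    cases hu : c1 s x (y+1) with
    | none =>
      cases hv : fP s x (y+1) with
      | none => rw [nN (by rw [ov_new hn]; exact hu) hv]; exact Or.inl rfl
      | some u =>
        rw [nF (by rw [ov_new hn]; exact hu) hv]
        rcases fP_cases hv with ⟨hr, rfl⟩ <;>
          first | exact Or.inl rfl | exact Or.inr ⟨by decide, by omega⟩ | exact Or.inr ⟨by decide, Or.inr ⟨by omega, by omega, by decide⟩⟩ | omega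
    | some u =>
      rw [nO (h.k hu hw)]
      rcases c1_cases hu with ⟨hr, rfl⟩ | ⟨hr, rfl⟩ | ⟨hr, rfl⟩ | ⟨hr, rfl⟩ | ⟨-, hu⟩ <;> try (first | exact Or.inl rfl | exact Or.inr ⟨by decide, by omega⟩ | exact Or.inr ⟨by decide, Or.inr ⟨by omega, by omega, by decide⟩⟩ | omega)
      rcases k1_cases hu with ⟨hr, rfl⟩ | ⟨hr, rfl⟩ | ⟨hr, rfl⟩ | ⟨hr, rfl⟩ | ⟨hr, rfl⟩ | ⟨hr, rfl⟩ <;>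
        first | exact Or.inl rfl | exact Or.inr ⟨by decide, by omega⟩ | exact Or.inr ⟨by decide, Or.inr ⟨by omega, by omega, by decide⟩⟩ | omega
  · have hw := (h.sh _ _).1 hn
    rw [nS (ov_ne hn), ov_sG hn]
    have h2 : y + 1 = 0 := by omega
    rw [h2]; exact Or.inr ⟨by have := h.bot x; omega, by omega⟩
theorem oc_E {s S} (h : Inv s S) {x y : ℤ} (h0 : ov S (c1 s) (x,y) = none) (hf : fP s x y = none) :
    gs (EE (ov S (c1 s)) (fP s) x y) = 0 ∨ (gs (EE (ov S (c1 s)) (fP s) x y) ≤ 4 ∧ (x = -1)) := by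
  have h3 := h.hs
  have hx := h.ovn h0
  have hz := c1_nz h.hs hx.2
  have hx := hx.1
  have hz2 : ¬(x = s ∧ y = s) := fun e => by rw [fP_P e] at hf; cases hf
  by_cases hn : S ((x+1), y) = none
  · have hw := h.nn hn
    cases hu : c1 s (x+1) y with
    | none =>
      cases hv : fP s (x+1) y with
      | none => rw [eN (by rw [ov_new hn]; exact hu) hv]; exact Or.inl rfl
      | some u =>
        rw [eF (by rw [ov_new hn]; exact hu) hv]
        rcases fP_cases hv with ⟨hr, rfl⟩ <;>
          first | exact Or.inl rfl | exact Or.inr ⟨by decide, by omega⟩ | omega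
    | some u =>
      rw [eO (h.k hu hw)]
      rcases c1_cases hu with ⟨hr, rfl⟩ | ⟨hr, rfl⟩ | ⟨hr, rfl⟩ | ⟨hr, rfl⟩ | ⟨-, hu⟩ <;> try (first | exact Or.inl rfl | exact Or.inr ⟨by decide, by omega⟩ | omega)
      rcases k1_cases hu with ⟨hr, rfl⟩ | ⟨hr, rfl⟩ | ⟨hr, rfl⟩ | ⟨hr, rfl⟩ | ⟨hr, rfl⟩ | ⟨hr, rfl⟩ <;>
        first | exact Or.inl rfl | exact Or.inr ⟨by decide, by omega⟩ | omega
  · have hw := (h.sh _ _).1 hn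
    rw [eS (ov_ne hn), ov_wG hn]
    have h2 : x + 1 = 0 := by omega
    rw [h2]; exact Or.inr ⟨by have := h.lef y; omega, by omega⟩
theorem oc_S {s S} (h : Inv s S) {x y : ℤ} (h0 : ov S (c1 s) (x,y) = none) (hf : fP s x y = none) :
    gs (ES (ov S (c1 s)) (fP s) x y) = 0 ∨ (gs (ES (ov S (c1 s)) (fP s) x y) ≤ 4 ∧ (s+1 ≤ y ∧ 0 ≤ x ∧ x ≤ s)) := by
  have h3 := h.hs
  have hx := h.ovn h0
  have hz := c1_nz h.hs hx.2
  have hx := hx.1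
  have hz2 : ¬(x = s ∧ y = s) := fun e => by rw [fP_P e] at hf; cases hf
  by_cases hn : S (x, (y-1)) = none
  · have hw := h.nn hn
    cases hu : c1 s x (y-1) with
    | none =>
      cases hv : fP s x (y-1) with
      | none => rw [sN (by rw [ov_new hn]; exact hu) hv]; exact Or.inl rfl
      | some u =>
        rw [sF (by rw [ov_new hn]; exact hu) hv]
        rcases fP_cases hv with ⟨hr, rfl⟩ <;>
          first | exact Or.inl rfl | exact Or.inr ⟨by decide, by omega⟩ | omega
    | some u =>
      rw [sO (h.k hu hw)]
      rcases c1_cases hu with ⟨hr, rfl⟩ | ⟨hr, rfl⟩ | ⟨hr, rfl⟩ | ⟨hr, rfl⟩ | ⟨-, hu⟩ <;> try (first | exact Or.inl rfl | exact Or.inr ⟨by decide, by omega⟩ | omega)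
      rcases k1_cases hu with ⟨hr, rfl⟩ | ⟨hr, rfl⟩ | ⟨hr, rfl⟩ | ⟨hr, rfl⟩ | ⟨hr, rfl⟩ | ⟨hr, rfl⟩ <;>
        first | exact Or.inl rfl | exact Or.inr ⟨by decide, by omega⟩ | omega
  · have hw := (h.sh _ _).1 hn
    omega
theorem oc_W {s S} (h : Inv s S) {x y : ℤ} (h0 : ov S (c1 s) (x,y) = none) (hf : fP s x y = none) :
    gs (EW (ov S (c1 s)) (fP s) x y) = 0 ∨ (gs (EW (ov S (c1 s)) (fP s) x y) ≤ 4 ∧ ((x = s+1 ∧ 0 ≤ y ∧ y ≤ s) ∨ (x = s+2 ∧ y = s+1))) := by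
  have h3 := h.hs
  have hx := h.ovn h0
  have hz := c1_nz h.hs hx.2
  have hx := hx.1
  have hz2 : ¬(x = s ∧ y = s) := fun e => by rw [fP_P e] at hf; cases hf
  by_cases hn : S ((x-1), y) = none
  · have hw := h.nn hn
    cases hu : c1 s (x-1) y with
    | none =>
      cases hv : fP s (x-1) y with
      | none => rw [wN (by rw [ov_new hn]; exact hu) hv]; exact Or.inl rfl
      | some u =>
        rw [wF (by rw [ov_new hn]; exact hu) hv]
        rcases fP_cases hv with ⟨hr, rfl⟩ <;>
          first | exact Or.inl rfl | exact Or.inr ⟨by decide, by omega⟩ | omega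
    | some u =>
      rw [wO (h.k hu hw)]
      rcases c1_cases hu with ⟨hr, rfl⟩ | ⟨hr, rfl⟩ | ⟨hr, rfl⟩ | ⟨hr, rfl⟩ | ⟨-, hu⟩ <;> try (first | exact Or.inl rfl | exact Or.inr ⟨by decide, by omega⟩ | omega)
      rcases k1_cases hu with ⟨hr, rfl⟩ | ⟨hr, rfl⟩ | ⟨hr, rfl⟩ | ⟨hr, rfl⟩ | ⟨hr, rfl⟩ | ⟨hr, rfl⟩ <;>
        first | exact Or.inl rfl | exact Or.inr ⟨by decide, by omega⟩ | omega
  · have hw := (h.sh _ _).1 hn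
    omega
theorem ok_N {s S} (h : Inv s S) {x y : ℤ} (h0 : ov S (k1 s) (x,y) = none) (hf : f8 s x y = none) :
    gs (EN (ov S (k1 s)) (f8 s) x y) = 0 ∨ (gs (EN (ov S (k1 s)) (f8 s) x y) ≤ 6 ∧ (y = -1 ∧ 0 ≤ x ∧ x < s)) := by
  have h3 := h.hs
  have hx := h.ovn h0
  have hz := k1_nz h.hs hx.2
  have hx := hx.1
  have hz2 : ¬(x = s ∧ y = s) := fun e => by rw [f8_P e] at hf; cases hf
  have hz3 : ¬(x = s-1 ∧ y = s) := fun e => by rw [f8_Fx e] at hf; cases hf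
  by_cases hn : S (x, (y+1)) = none
  · have hw := h.nn hn
    cases hu : k1 s x (y+1) with
    | none =>
      cases hv : f8 s x (y+1) with
      | none => rw [nN (by rw [ov_new hn]; exact hu) hv]; exact Or.inl rfl
      | some u =>
        rw [nF (by rw [ov_new hn]; exact hu) hv]
        rcases f8_cases hv with ⟨hr, rfl⟩ | ⟨hr, rfl⟩ <;>
          first | exact Or.inl rfl | exact Or.inr ⟨by decide, by omega⟩ | omega
    | some u =>
      rw [nO (h.k hu hw)]
      rcases k1_cases hu with ⟨hr, rfl⟩ | ⟨hr, rfl⟩ | ⟨hr, rfl⟩ | ⟨hr, rfl⟩ | ⟨hr, rfl⟩ | ⟨hr, rfl⟩ <;>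
        first | exact Or.inl rfl | exact Or.inr ⟨by decide, by omega⟩ | omega
  · have hw := (h.sh _ _).1 hn
    rw [nS (ov_ne hn), ov_sG hn]
    have h2 : y + 1 = 0 := by omega
    rw [h2]; exact Or.inr ⟨by have := h.bot x; omega, by omega⟩
theorem ok_E {s S} (h : Inv s S) {x y : ℤ} (h0 : ov S (k1 s) (x,y) = none) (hf : f8 s x y = none) :
    gs (EE (ov S (k1 s)) (f8 s) x y) = 0 ∨ (gs (EE (ov S (k1 s)) (f8 s) x y) ≤ 6 ∧ (x = -1 ∧ 0 ≤ y ∧ y ≤ s)) := by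
  have h3 := h.hs
  have hx := h.ovn h0
  have hz := k1_nz h.hs hx.2
  have hx := hx.1
  have hz2 : ¬(x = s ∧ y = s) := fun e => by rw [f8_P e] at hf; cases hf
  have hz3 : ¬(x = s-1 ∧ y = s) := fun e => by rw [f8_Fx e] at hf; cases hf
  by_cases hn : S ((x+1), y) = none
  · have hw := h.nn hn
    cases hu : k1 s (x+1) y with
    | none =>
      cases hv : f8 s (x+1) y with
      | none => rw [eN (by rw [ov_new hn]; exact hu) hv]; exact Or.inl rfl
      | some u =>
        rw [eF (by rw [ov_new hn]; exact hu) hv]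
        rcases f8_cases hv with ⟨hr, rfl⟩ | ⟨hr, rfl⟩ <;>
          first | exact Or.inl rfl | exact Or.inr ⟨by decide, by omega⟩ | omega
    | some u =>
      rw [eO (h.k hu hw)]
      rcases k1_cases hu with ⟨hr, rfl⟩ | ⟨hr, rfl⟩ | ⟨hr, rfl⟩ | ⟨hr, rfl⟩ | ⟨hr, rfl⟩ | ⟨hr, rfl⟩ <;>
        first | exact Or.inl rfl | exact Or.inr ⟨by decide, by omega⟩ | omega
  · have hw := (h.sh _ _).1 hn
    rw [eS (ov_ne hn), ov_wG hn]
    have h2 : x + 1 = 0 := by omega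
    rw [h2]; exact Or.inr ⟨by have := h.lef y; omega, by omega⟩
theorem ok_S {s S} (h : Inv s S) {x y : ℤ} (h0 : ov S (k1 s) (x,y) = none) (hf : f8 s x y = none) :
    gs (ES (ov S (k1 s)) (f8 s) x y) = 0 ∨ (gs (ES (ov S (k1 s)) (f8 s) x y) ≤ 6 ∧ (y = s+1 ∧ 0 ≤ x ∧ x ≤ s)) := by
  have h3 := h.hs
  have hx := h.ovn h0
  have hz := k1_nz h.hs hx.2
  have hx := hx.1
  have hz2 : ¬(x = s ∧ y = s) := fun e => by rw [f8_P e] at hf; cases hf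
  have hz3 : ¬(x = s-1 ∧ y = s) := fun e => by rw [f8_Fx e] at hf; cases hf
  by_cases hn : S (x, (y-1)) = none
  · have hw := h.nn hn
    cases hu : k1 s x (y-1) with
    | none =>
      cases hv : f8 s x (y-1) with
      | none => rw [sN (by rw [ov_new hn]; exact hu) hv]; exact Or.inl rfl
      | some u =>
        rw [sF (by rw [ov_new hn]; exact hu) hv]
        rcases f8_cases hv with ⟨hr, rfl⟩ | ⟨hr, rfl⟩ <;>
          first | exact Or.inl rfl | exact Or.inr ⟨by decide, by omega⟩ | omega
    | some u =>
      rw [sO (h.k hu hw)]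
      rcases k1_cases hu with ⟨hr, rfl⟩ | ⟨hr, rfl⟩ | ⟨hr, rfl⟩ | ⟨hr, rfl⟩ | ⟨hr, rfl⟩ | ⟨hr, rfl⟩ <;>
        first | exact Or.inl rfl | exact Or.inr ⟨by decide, by omega⟩ | omega
  · have hw := (h.sh _ _).1 hn
    omega
theorem ok_W {s S} (h : Inv s S) {x y : ℤ} (h0 : ov S (k1 s) (x,y) = none) (hf : f8 s x y = none) :
    gs (EW (ov S (k1 s)) (f8 s) x y) = 0 ∨ (gs (EW (ov S (k1 s)) (f8 s) x y) ≤ 6 ∧ (x = s+1 ∧ 0 ≤ y ∧ y ≤ s)) := by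
  have h3 := h.hs
  have hx := h.ovn h0
  have hz := k1_nz h.hs hx.2
  have hx := hx.1
  have hz2 : ¬(x = s ∧ y = s) := fun e => by rw [f8_P e] at hf; cases hf
  have hz3 : ¬(x = s-1 ∧ y = s) := fun e => by rw [f8_Fx e] at hf; cases hf
  by_cases hn : S ((x-1), y) = none
  · have hw := h.nn hn
    cases hu : k1 s (x-1) y with
    | none =>
      cases hv : f8 s (x-1) y with
      | none => rw [wN (by rw [ov_new hn]; exact hu) hv]; exact Or.inl rfl
      | some u =>
        rw [wF (by rw [ov_new hn]; exact hu) hv]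
        rcases f8_cases hv with ⟨hr, rfl⟩ | ⟨hr, rfl⟩ <;>
          first | exact Or.inl rfl | exact Or.inr ⟨by decide, by omega⟩ | omega
    | some u =>
      rw [wO (h.k hu hw)]
      rcases k1_cases hu with ⟨hr, rfl⟩ | ⟨hr, rfl⟩ | ⟨hr, rfl⟩ | ⟨hr, rfl⟩ | ⟨hr, rfl⟩ | ⟨hr, rfl⟩ <;>
        first | exact Or.inl rfl | exact Or.inr ⟨by decide, by omega⟩ | omega
  · have hw := (h.sh _ _).1 hn
    omega

theorem locP {s S} (h : Inv s S) : Loc 8 (ov S (c1 s)) (fP s) := by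
  have h3 := h.hs
  refine ⟨?_, ?_, ?_⟩
  · intro x y h0 hf
    have a := oc_N h h0 hf
    have b := oc_E h h0 hf
    have c := oc_S h h0 hf
    have d := oc_W h h0 hf
    omega
  · intro x y t h0 hf
    obtain ⟨hr, rfl⟩ := fP_cases hf
    rw [nO (h.k (c1_X3 h3 (by omega)) (by omega)), eN (by rw [h.ov (by omega)]; exact c1_no h3 (by omega) (by omega)) (fP_no (by omega)),
      sO (h.k (c1_R3 h3 (by omega)) (by omega)), wO (h.k (c1_X h3 (by omega)) (by omega))]
    decide
  · intro C hC x y h0 hf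
    exact absurd (fP_cases hf).2 (by decide)

theorem loc8 {s S} (h : Inv s S) : Loc 8 (ov S (k1 s)) (f8 s) := by
  have h3 := h.hs
  refine ⟨?_, ?_, ?_⟩
  · intro x y h0 hf
    have a := ok_N h h0 hf
    have b := ok_E h h0 hf
    have c := ok_S h h0 hf
    have d := ok_W h h0 hf
    omega
  · intro x y t h0 hf
    rcases f8_cases hf with ⟨hr, rfl⟩ | ⟨hr, rfl⟩
    · rw [nN (by rw [h.ov (by omega)]; exact k1_no h3 (by omega)) (f8_no (by omega) (by omega)),
        eN (by rw [h.ov (by omega)]; exact k1_no h3 (by omega)) (f8_no (by omega) (by omega)),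
        sO (h.k (k1_R3 h3 (by omega)) (by omega)), wF (by rw [h.ov (by omega)]; exact k1_no h3 (by omega)) (f8_Fx (by omega))]
      decide
    · rw [nN (by rw [h.ov (by omega)]; exact k1_no h3 (by omega)) (f8_no (by omega) (by omega)),
        eF (by rw [h.ov (by omega)]; exact k1_no h3 (by omega)) (f8_P (by omega)),
        sS (ov_ne (h.ye (by omega))), ov_nG (h.ye (by omega)), wO (h.k (k1_Be h3 (by omega)) (by omega)),
        (by omega : y - 1 = s - 1), hr.1, h.cor]
      decide
  · intro C hC x y h0 hf
    rcases f8_cases hf with hh | hh <;> exact absurd hh.2 (by decide)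

theorem rk8 {s S} (h : Inv s S) : Rk (ov S (k1 s)) (f8 s) (fun x _ => -x) := by
  have h3 := h.hs
  intro x y t h0 hf
  rcases f8_cases hf with ⟨hr, rfl⟩ | ⟨hr, rfl⟩
  · refine ⟨fun hi => absurd hi (by decide), fun hi => absurd hi (by decide), fun hi => Or.inl (kin h (by omega)), fun hi => absurd hi (by decide)⟩
  · refine ⟨fun hi => absurd hi (by decide), fun hi => Or.inr (by simp), fun hi => absurd hi (by decide), fun hi => absurd hi (by decide)⟩

theorem fin8 {s S} (h : Inv s S) : (shape (ov (ov S (k1 s)) (f8 s))).Finite := by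
  have h3 := h.hs
  apply fin_of s
  intro x y hp
  rcases ov_some hp with h1 | h1
  · rcases ov_some h1 with h2 | h2
    · have := (h.sh x y).1 h2; omega
    · have := k1_box h3 h2; omega
  · by_contra hc; exact h1 (f8_no (by omega) (by omega))

end TT

set_option linter.all false
namespace TT

def inX (s x y : ℤ) : Prop := (x = s-1 ∧ y = s) ∨ (x = s-1 ∧ y = s+1) ∨ (x = s ∧ y = s+1) ∨ (x = s+1 ∧ y = s+1)
def setX (s : ℤ) : Finset (ℤ × ℤ) := {(s-1,s), (s-1,s+1), (s,s+1), (s+1,s+1)}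

theorem detX {s : ℤ} {B D : Config} (hB : Stable 8 B) (hle : Le B D) (hX : HX s D)
    (hsb : ∀ x y, D (x,y) ≠ none → B (x,y) = none → inX s x y) (hn : ∀ x y, inX s x y → B (x,y) = none)
    {Q : Finset (ℤ × ℤ)} (h0 : ((0,0) : ℤ × ℤ) ∉ Q) (hne : Q.Nonempty)
    (hsub : (↑Q : Set (ℤ × ℤ)) ⊆ shape D) (hc : cutStrength gs D Q < 8) :
    (fun q => if q ∈ Q then none else D q) = B := by
  have hk := avoid hle hB h0 hc
  obtain ⟨t1, t2, t3⟩ := hX.tie (Q := Q) hc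
  have hsb' : ∀ x y, (x,y) ∈ Q → inX s x y := fun x y hq => hsb x y (hsub hq) (hk _ hq)
  have hin : (s-1,s) ∈ Q ∧ (s-1,s+1) ∈ Q ∧ (s,s+1) ∈ Q ∧ (s+1,s+1) ∈ Q := by
    obtain ⟨⟨x,y⟩, hp⟩ := hne
    rcases hsb' _ _ hp with ⟨rfl, rfl⟩ | ⟨rfl, rfl⟩ | ⟨rfl, rfl⟩ | ⟨rfl, rfl⟩ <;> tauto
  funext ⟨x, y⟩
  by_cases hq : (x,y) ∈ Q
  · rw [if_pos hq, hk _ hq]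
  · rw [if_neg hq]
    by_cases hb : B (x,y) = none
    · rw [hb]; by_contra hd
      rcases hsb x y hd hb with ⟨rfl, rfl⟩ | ⟨rfl, rfl⟩ | ⟨rfl, rfl⟩ | ⟨rfl, rfl⟩ <;> tauto
    · exact hle _ hb

theorem g0 {D : Config} {x y : ℤ} (h : D (x,y) = none) : sG D x y = 0 ∧ wG D x y = 0 ∧ nG D x y = 0 := by
  unfold sG wG nG; rw [h]; exact ⟨rfl, rfl, rfl⟩

theorem cutX {s D} (h : HX s D) (hP : D (s,s) = none ∨ D (s,s) = some tP) (n1 : D (s-1,s+2) = none)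
    (n2 : D (s,s+2) = none) (n3 : D (s+2,s+1) = none) (n4 : D (s+1,s) = none) :
    cutStrength gs D (setX s) < 8 := by
  unfold cutStrength setX
  rw [Finset.sum_insert (by simp), Finset.sum_insert (by simp; omega), Finset.sum_insert (by simp), Finset.sum_singleton]
  set Q : Finset (ℤ × ℤ) := {(s-1,s), (s-1,s+1), (s,s+1), (s+1,s+1)} with hQ
  have m1 : (s-1,s) ∈ Q := by simp [hQ]
  have m2 : (s-1,s+1) ∈ Q := by simp [hQ]
  have m3 : (s,s+1) ∈ Q := by simp [hQ]
  have m4 : (s+1,s+1) ∈ Q := by simp [hQ]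
  rw [out_eq, out_eq, out_eq, out_eq, if_pos m2, if_pos (by simpa using m1 : (s-1,s+1-1) ∈ Q),
    if_pos (by simpa using m3 : (s-1+1,s+1) ∈ Q), if_pos m4, if_pos m2, if_pos (by simpa using m3 : (s+1-1,s+1) ∈ Q)]
  have z : ∀ (P : Prop) [Decidable P] (b : ℕ), b = 0 → (if P then 0 else b) = 0 := by
    intro P _ b hb; rw [hb, ite_self]
  have z6 : ∀ (P : Prop) [Decidable P] (b k : ℕ), b ≤ k → (if P then 0 else b) ≤ k := by
    intro P _ b k hb; split_ifs <;> omega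
  have a1 : bE D (s-1) s = 0 := by
    unfold bE; rw [sub_add_cancel]
    rcases hP with hP | hP
    · rw [(g0 hP).2.1, bd0]
    · unfold eG wG; rw [hP, h.X]; rfl
  have a2 : bS D s (s+1) = 0 := by
    unfold bS sG; rw [h.X3]; exact bd0' _
  have a3 : bW D (s-1) (s+1) = 0 := by
    unfold bW wG; rw [h.Xs]; exact bd0' _
  have a4 : bN D (s-1) (s+1) = 0 := by
    unfold bN; rw [(by ring : s+1+1 = s+2), (g0 n1).1, bd0]
  have a5 : bN D s (s+1) = 0 := by
    unfold bN; rw [(by ring : s+1+1 = s+2), (g0 n2).1, bd0]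
  have a6 : bN D (s+1) (s+1) = 0 := by
    unfold bN nG; rw [h.X4]; exact bd0' _
  have a7 : bE D (s+1) (s+1) = 0 := by
    unfold bE; rw [(by ring : s+1+1 = s+2), (g0 n3).2.1, bd0]
  have a8 : bS D (s+1) (s+1) = 0 := by
    unfold bS; rw [add_sub_cancel_right, (g0 n4).2.2, bd0]
  have c1 : bS D (s-1) s ≤ 6 := by
    unfold bS sG; rw [h.X]; exact bd_le' _ _
  have c2 : bW D (s-1) s ≤ 1 := by
    unfold bW wG; rw [h.X]; exact bd_le' _ _
  rw [z _ _ a1, z _ _ a2, z _ _ a3, z _ _ a4, z _ _ a5, z _ _ a6, z _ _ a7, z _ _ a8]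
  have d1 := z6 ((s-1,s-1) ∈ Q) _ _ c1
  have d2 := z6 ((s-1-1,s) ∈ Q) _ _ c2
  omega

theorem stepX {s : ℤ} {B D : Config} (h3 : 3 ≤ s) (hB : Stable 8 B) (hle : Le B D) (hX : HX s D)
    (hsb : ∀ x y, D (x,y) ≠ none → B (x,y) = none → inX s x y) (hn : ∀ x y, inX s x y → B (x,y) = none)
    (hP : D (s,s) = none ∨ D (s,s) = some tP) (n1 : D (s-1,s+2) = none)
    (n2 : D (s,s+2) = none) (n3 : D (s+2,s+1) = none) (n4 : D (s+1,s) = none) : Step TT gs 8 D B := by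
  have h1 : (setX s).Nonempty := ⟨(s,s+1), by simp [setX]⟩
  have h0 : ((0,0) : ℤ × ℤ) ∉ setX s := by simp [setX]; omega
  have hc := cutX hX hP n1 n2 n3 n4
  have hsub : (↑(setX s) : Set (ℤ × ℤ)) ⊆ shape D := by
    intro q hq
    simp [setX] at hq
    show D q ≠ none
    rcases hq with rfl | rfl | rfl | rfl
    · rw [hX.X]; simp
    · rw [hX.Xs]; simp
    · rw [hX.X3]; simp
    · rw [hX.X4]; simp
  have := Step.detach (T := TT) (G := gs) (τ := 8) D (setX s) h1 h0 hsub hc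
  rw [detX hB hle hX hsb hn h0 h1 hsub hc] at this
  exact this

theorem Inv.c {s S} (h : Inv s S) {x y : ℤ} (h1 : x < 0 ∨ y < 0 ∨ s ≤ x ∨ s ≤ y) (h2 : c1 s x y = none) :
    TT.ov S (c1 s) (x,y) = none := by rw [h.ov h1]; exact h2

theorem phase8 {s S} (h : Inv s S) : PhaseOK (Step TT gs 8) (ov S (f5 s)) (ov (ov S (k1 s)) (f8 s)) ∧
    Stable 8 (ov (ov S (k1 s)) (f8 s)) := by
  have h3 := h.hs
  have hK := k1_stable h
  obtain ⟨hg, hst⟩ := grow (loc8 h) (rk8 h) (fin8 h) hK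
  refine ⟨?_, hst⟩
  set C1 := ov S (c1 s) with hC1
  set K1 := ov S (k1 s) with hK1
  have kss : K1 (s,s) = none := by rw [hK1, h.ov (by omega)]; exact k1_no h3 (by omega)
  have css : C1 (s,s) = none := h.c (by omega) (c1_no h3 (by omega) (by omega))
  have kR : K1 (s,s-1) = some tR3 := h.k (k1_R3 h3 (by omega)) (by omega)
  have hk : ∀ x y, inX s x y → K1 (x,y) = none := by
    intro x y hx; rw [hK1, h.ov (by unfold inX at hx; omega)]; exact k1_no h3 (by unfold inX at hx; omega)
  have hTP : tP ∈ TT := by decide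
  have hatt : 8 ≤ attachStrength gs K1 tP (s,s) := by
    rw [att_eq]
    have : bond gs tP.south (nG K1 s (s-1)) = 8 := by unfold nG; rw [kR]; rfl
    omega
  have hKP : PhaseOK (Step TT gs 8) (Function.update K1 (s,s) (some tP)) (ov K1 (f8 s)) :=
    (grow_aux (loc8 h) (rk8 h) (fin8 h) _ _ (good_att (loc8 h) (good_refl _ _) hTP kss hatt) (stable_att hK kss hatt) rfl).1
  have hX := hx_c h
  have n1 : C1 (s-1,s+2) = none := h.c (by omega) (c1_no h3 (by omega) (by omega))
  have n2 : C1 (s,s+2) = none := h.c (by omega) (c1_no h3 (by omega) (by omega))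
  have n3 : C1 (s+2,s+1) = none := h.c (by omega) (c1_no h3 (by omega) (by omega))
  have n4 : C1 (s+1,s) = none := h.c (by omega) (c1_no h3 (by omega) (by omega))
  have hsb : ∀ x y, C1 (x,y) ≠ none → K1 (x,y) = none → inX s x y := fun x y a b => c_sub h a b
  have hst1 := stepX h3 hK (le_kc h) hX hsb hk (Or.inl css) n1 n2 n3 n4
  -- the configuration with the extra tile
  set CP := Function.update C1 (s,s) (some tP) with hCP
  set KP := Function.update K1 (s,s) (some tP) with hKPd
  have un : ∀ x y, ¬(x = s ∧ y = s) → CP (x,y) = C1 (x,y) ∧ KP (x,y) = K1 (x,y) := by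
    intro x y hne
    have : (x,y) ≠ (s,s) := by simpa using hne
    exact ⟨Function.update_of_ne this _ _, Function.update_of_ne this _ _⟩
  have us : CP (s,s) = some tP ∧ KP (s,s) = some tP := ⟨Function.update_self _ _ _, Function.update_self _ _ _⟩
  have hXP : HX s CP := by
    refine ⟨(un _ _ (by omega)).1.trans hX.X, (un _ _ (by omega)).1.trans hX.Xs, (un _ _ (by omega)).1.trans hX.X3,
      (un _ _ (by omega)).1.trans hX.X4, (un _ _ (by omega)).1.trans hX.Be, ?_⟩
    unfold nG; rw [(un _ _ (by omega)).1]; exact hX.co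
  have hleP : Le KP CP := by
    rintro ⟨x,y⟩ hp
    by_cases e : x = s ∧ y = s
    · rw [e.1, e.2, us.1, us.2]
    · rw [(un x y e).2] at hp ⊢; rw [(un x y e).1]; exact le_kc h _ hp
  have hsbP : ∀ x y, CP (x,y) ≠ none → KP (x,y) = none → inX s x y := by
    intro x y a b
    by_cases e : x = s ∧ y = s
    · rw [e.1, e.2, us.2] at b; cases b
    · rw [(un x y e).2] at b; rw [(un x y e).1] at a; exact hsb x y a b
  have hkP : ∀ x y, inX s x y → KP (x,y) = none := by
    intro x y hx
    rw [(un x y (by unfold inX at hx; omega)).2]; exact hk x y hx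
  have hst2 := stepX h3 (stable_att hK kss hatt) hleP hXP hsbP hkP (Or.inr us.1)
    ((un _ _ (by omega)).1.trans n1) ((un _ _ (by omega)).1.trans n2) ((un _ _ (by omega)).1.trans n3) ((un _ _ (by omega)).1.trans n4)
  have hLP := locP h
  have fP_c : ∀ {C : Config} {t x y}, Good C1 (fP s) C → t ∈ TT → C (x,y) = none → 8 ≤ attachStrength gs C t (x,y) →
      (x = s ∧ y = s) ∧ t = tP := fun hG ht hp ha => fP_cases (att_sound hLP hG ht hp ha).1
  have pCP : ∀ hG : Good C1 (fP s) CP, PhaseOK (Step TT gs 8) CP (ov K1 (f8 s)) := by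
    intro hG
    apply PhaseOK.of_step _ ⟨_, hst2⟩
    intro D hD
    cases hD with
    | attach t p ht hp ha =>
      obtain ⟨x, y⟩ := p
      obtain ⟨⟨rfl, rfl⟩, -⟩ := fP_c hG ht hp ha
      rw [us.1] at hp; cases hp
    | detach Q q1 q2 q3 q4 =>
      rw [detX (stable_att hK kss hatt) hleP hXP hsbP hkP q2 q1 q3 q4]; exact hKP
  have pC : PhaseOK (Step TT gs 8) C1 (ov K1 (f8 s)) := by
    apply PhaseOK.of_step _ ⟨_, hst1⟩
    intro D hD
    cases hD with
    | attach t p ht hp ha =>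
      obtain ⟨x, y⟩ := p
      have hG := good_att hLP (good_refl _ _) ht hp ha
      obtain ⟨⟨rfl, rfl⟩, rfl⟩ := fP_c (good_refl _ _) ht hp ha
      exact pCP hG
    | detach Q q1 q2 q3 q4 =>
      rw [detX hK (le_kc h) hX hsb hk q2 q1 q3 q4]; exact hg
  apply PhaseOK.of_step _ ⟨_, stepA h (by omega) (by omega)⟩
  intro D hD
  rw [onlyA h (by omega) (by omega) hD]; exact pC

end TT

set_option linter.all false
namespace TT

theorem n_of {C : Config} {x y : ℤ} {t} (h : C (x,y) = some t) : nG C x y = t.north := by unfold nG; rw [h]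
theorem e_of {C : Config} {x y : ℤ} {t} (h : C (x,y) = some t) : eG C x y = t.east := by unfold eG; rw [h]
theorem s_of {C : Config} {x y : ℤ} {t} (h : C (x,y) = some t) : sG C x y = t.south := by unfold sG; rw [h]
theorem w_of {C : Config} {x y : ℤ} {t} (h : C (x,y) = some t) : wG C x y = t.west := by unfold wG; rw [h]

theorem gz : gs 0 ≤ 4 := by decide

theorem inv8 {s S} (h : Inv s S) : Inv (s+1) (ov (ov S (k1 s)) (f8 s)) := by
  have h3 := h.hs
  set R := ov (ov S (k1 s)) (f8 s) with hR
  have rk : ∀ {x y : ℤ} {t}, k1 s x y = some t → (x < 0 ∨ y < 0 ∨ s ≤ x ∨ s ≤ y) → R (x,y) = some t := by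
    intro x y t hk ho
    have := h.k hk ho
    rw [hR, ov_old (by rw [this]; simp)]; exact this
  have r8 : ∀ {x y : ℤ}, k1 s x y = none → (x < 0 ∨ y < 0 ∨ s ≤ x ∨ s ≤ y) → R (x,y) = f8 s x y := by
    intro x y hk ho
    rw [hR, ov_new]; rw [h.ov ho]; exact hk
  have rS : ∀ {x y : ℤ}, S (x,y) ≠ none → R (x,y) = S (x,y) := by
    intro x y hS
    rw [hR, ov_old (ov_ne hS), ov_old hS]
  have rP : R (s,s) = some tP := (r8 (k1_no h3 (by omega)) (by omega)).trans (f8_P (by omega))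
  have rFx : R (s-1,s) = some tFx := (r8 (k1_no h3 (by omega)) (by omega)).trans (f8_Fx (by omega))
  have rF0 : R (s,0) = some tF0 := rk (k1_F0 h3 (by omega)) (by omega)
  have rno : ∀ {x y : ℤ}, (x < 0 ∨ y < 0 ∨ s+1 ≤ x ∨ s+1 ≤ y) → R (x,y) = none := by
    intro x y ho
    exact (r8 (k1_no h3 (by omega)) (by omega)).trans (f8_no (by omega) (by omega))
  refine ⟨by omega, ?_, ?_, ?_, ?_, ?_, ?_, ?_, ?_, ?_, (phase8 h).2⟩
  · intro x y
    constructor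
    · intro hp; by_contra hc; exact hp (rno (by omega))
    · intro hp
      by_cases e1 : x = s ∧ y = s
      · rw [e1.1, e1.2, rP]; simp
      by_cases e2 : x = s-1 ∧ y = s
      · rw [e2.1, e2.2, rFx]; simp
      exact ov_ne (kin h (by omega))
  · intro x hx hx'
    rw [add_sub_cancel_right]
    rcases (by omega : x = s-1 ∨ x = s-2 ∨ x ≤ s-3) with e | e | e
    · rw [e, n_of rFx]; rfl
    · rw [n_of (rk (k1_Be h3 (by omega)) (by omega))]; rfl
    · rw [n_of (rk (k1_Fl h3 (by omega)) (by omega))]; rfl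
  · rw [add_sub_cancel_right, n_of rP]; rfl
  · rw [add_sub_cancel_right, e_of rF0]; rfl
  · intro y hy hy'
    rw [add_sub_cancel_right]
    rcases (by omega : y = s-2 ∨ y ≤ s-3) with e | e
    · rw [e_of (rk (k1_Ga h3 (by omega)) (by omega))]; rfl
    · rw [e_of (rk (k1_Fc h3 (by omega)) (by omega))]; rfl
  · right; rw [add_sub_cancel_right, e_of (rk (k1_R3 h3 (by omega)) (by omega))]; rfl
  · rw [add_sub_cancel_right, e_of rP]; rfl
  · intro x
    by_cases hS : S (x,0) = none
    · have := h.nn hS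
      by_cases e : x = s
      · rw [e, s_of rF0]; decide
      · rw [(g0 (rno (by omega))).1]; decide
    · have := h.bot x
      unfold sG at this ⊢; rw [rS hS]; exact this
  · intro y
    by_cases hS : S (0,y) = none
    · have := h.nn hS
      by_cases e : y = s
      · rw [e, w_of (rk (k1_Fl h3 (by omega)) (by omega))]; decide
      · rw [(g0 (rno (by omega))).2.1]; decide
    · have := h.lef y
      unfold wG at this ⊢; rw [rS hS]; exact this

theorem opAdd {s S} (h : Inv s S) : ∃ R, Ch [5, 8] S R ∧ Inv (s+1) R :=
  ⟨_, Ch.cons (phase5 h) (Ch.cons (phase8 h).1 (Ch.nil _)), inv8 h⟩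

end TT

set_option linter.all false
namespace TT

abbrev gP (s x y : ℤ) : Prop := x = y ∧ s ≤ x ∧ x < 2*s ∧ x ≠ s+1
abbrev gJ (s x y : ℤ) : Prop := x = s+1 ∧ y = s
abbrev gAT (s x y : ℤ) : Prop := y = x-1 ∧ s+2 ≤ x ∧ x < 2*s
abbrev gF (s x y : ℤ) : Prop := y ≤ x-2 ∧ 2*s < x+y ∧ x < 2*s
abbrev gM1 (s x y : ℤ) : Prop := x = s+1 ∧ y = s-1
abbrev gD (s x y : ℤ) : Prop := x+y = 2*s ∧ s+2 ≤ x ∧ x < 2*s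
abbrev gA1 (s x y : ℤ) : Prop := x+y = 2*s-1 ∧ 1 ≤ y ∧ s+1 ≤ x
abbrev gAz (s x y : ℤ) : Prop := x = 2*s-1 ∧ y = 0
abbrev gF0 (s x y : ℤ) : Prop := y = 0 ∧ s+1 ≤ x ∧ x ≤ 2*s-2
abbrev gFc (s x y : ℤ) : Prop := 1 ≤ y ∧ s+1 ≤ x ∧ x+y ≤ 2*s-2
abbrev gFx (s x y : ℤ) : Prop := y = x+1 ∧ s+1 ≤ x ∧ y < 2*s
abbrev gT1 (s x y : ℤ) : Prop := x = s-1 ∧ y = s+2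
abbrev gT2 (s x y : ℤ) : Prop := x = s-2 ∧ y = s+2
abbrev gT3 (s x y : ℤ) : Prop := x = s-2 ∧ y = s+1
abbrev gFl (s x y : ℤ) : Prop := 0 ≤ x ∧ x+2 ≤ y ∧ s+1 ≤ y ∧ y < 2*s ∧ (y = s+1 → x ≤ s-3) ∧ (y = s+2 → x ≤ s-3 ∨ x = s)
abbrev kFl (s x y : ℤ) : Prop := y = s ∧ 0 ≤ x ∧ x ≤ s-3
abbrev kBe (s x y : ℤ) : Prop := y = s ∧ x = s-2
abbrev kR3 (s x y : ℤ) : Prop := x = s ∧ y = s-1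
abbrev kGa (s x y : ℤ) : Prop := x = s ∧ y = s-2
abbrev kFc (s x y : ℤ) : Prop := x = s ∧ 1 ≤ y ∧ y ≤ s-3
abbrev kF0 (s x y : ℤ) : Prop := x = s ∧ y = 0
abbrev kX (s x y : ℤ) : Prop := x = s-1 ∧ y = s
abbrev kXs (s x y : ℤ) : Prop := x = s-1 ∧ y = s+1
abbrev kX3 (s x y : ℤ) : Prop := x = s ∧ y = s+1
abbrev kX4 (s x y : ℤ) : Prop := x = s+1 ∧ y = s+1
abbrev kO (s x y : ℤ) : Prop := x < 0 ∨ y < 0 ∨ 2*s ≤ x ∨ 2*s ≤ y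
def n7L (s x y : ℤ) : Tile :=
  if y = x then tP
  else if y = x-1 then (if x = s+1 then tJ else tAT)
  else if 2*s < x+y then tF
  else if x+y = 2*s then (if x = s+1 then tM1 else tD)
  else if x+y = 2*s-1 then (if y = 0 then tAz else tA1)
  else if y = 0 then tF0 else tFc
def n7U (s x y : ℤ) : Tile :=
  if y = x+1 then tFx
  else if x = s-1 ∧ y = s+2 then tT1
  else if x = s-2 ∧ y = s+2 then tT2
  else if x = s-2 ∧ y = s+1 then tT3
  else tFl
def n7 (s x y : ℤ) : Option Tile :=
  if x < 0 ∨ y < 0 ∨ 2*s ≤ x ∨ 2*s ≤ y then none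
  else if y ≤ x then some (n7L s x y) else some (n7U s x y)

theorem Inv.cn {s S} (h : Inv s S) {x y : ℤ} (h1 : x < 0 ∨ y < 0 ∨ s ≤ x ∨ s ≤ y)
    (h2 : (y = s → x < 0 ∨ s ≤ x) ∧ (x = s → y < 0 ∨ (s ≤ y ∧ y ≠ s+1)) ∧ (y = s+1 → x < s-1 ∨ s+2 ≤ x)) :
    TT.ov S (c1 s) (x,y) = none := by
  have := h.hs
  exact h.c h1 (c1_no h.hs (by omega) (by omega))
theorem q_no {s S} (h : Inv s S) {x y : ℤ} (hr : x < 0 ∨ y < 0 ∨ 2*s ≤ x ∨ 2*s ≤ y) : ov S (c1 s) (x,y) = none ∧ n7 s x y = none := by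
  have h3 := h.hs
  exact ⟨h.cn (by omega) (by omega), if_pos hr⟩
theorem q_P {s S} (h : Inv s S) {x y : ℤ} (hr : gP s x y) : ov S (c1 s) (x,y) = none ∧ n7 s x y = some tP := by
  have h3 := h.hs
  refine ⟨h.cn (by omega) (by omega), ?_⟩
  unfold n7; rw [if_neg (by omega), if_pos (by omega)]; apply congrArg some
  unfold n7L; repeat' split
  all_goals first | rfl | omega
theorem q_J {s S} (h : Inv s S) {x y : ℤ} (hr : gJ s x y) : ov S (c1 s) (x,y) = none ∧ n7 s x y = some tJ := by
  have h3 := h.hs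
  refine ⟨h.cn (by omega) (by omega), ?_⟩
  unfold n7; rw [if_neg (by omega), if_pos (by omega)]; apply congrArg some
  unfold n7L; repeat' split
  all_goals first | rfl | omega
theorem q_AT {s S} (h : Inv s S) {x y : ℤ} (hr : gAT s x y) : ov S (c1 s) (x,y) = none ∧ n7 s x y = some tAT := by
  have h3 := h.hs
  refine ⟨h.cn (by omega) (by omega), ?_⟩
  unfold n7; rw [if_neg (by omega), if_pos (by omega)]; apply congrArg some
  unfold n7L; repeat' split
  all_goals first | rfl | omega
theorem q_F {s S} (h : Inv s S) {x y : ℤ} (hr : gF s x y) : ov S (c1 s) (x,y) = none ∧ n7 s x y = some tF := by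
  have h3 := h.hs
  refine ⟨h.cn (by omega) (by omega), ?_⟩
  unfold n7; rw [if_neg (by omega), if_pos (by omega)]; apply congrArg some
  unfold n7L; repeat' split
  all_goals first | rfl | omega
theorem q_M1 {s S} (h : Inv s S) {x y : ℤ} (hr : gM1 s x y) : ov S (c1 s) (x,y) = none ∧ n7 s x y = some tM1 := by
  have h3 := h.hs
  refine ⟨h.cn (by omega) (by omega), ?_⟩
  unfold n7; rw [if_neg (by omega), if_pos (by omega)]; apply congrArg some
  unfold n7L; repeat' split
  all_goals first | rfl | omega
theorem q_D {s S} (h : Inv s S) {x y : ℤ} (hr : gD s x y) : ov S (c1 s) (x,y) = none ∧ n7 s x y = some tD := by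
  have h3 := h.hs
  refine ⟨h.cn (by omega) (by omega), ?_⟩
  unfold n7; rw [if_neg (by omega), if_pos (by omega)]; apply congrArg some
  unfold n7L; repeat' split
  all_goals first | rfl | omega
theorem q_A1 {s S} (h : Inv s S) {x y : ℤ} (hr : gA1 s x y) : ov S (c1 s) (x,y) = none ∧ n7 s x y = some tA1 := by
  have h3 := h.hs
  refine ⟨h.cn (by omega) (by omega), ?_⟩
  unfold n7; rw [if_neg (by omega), if_pos (by omega)]; apply congrArg some
  unfold n7L; repeat' split
  all_goals first | rfl | omega
theorem q_Az {s S} (h : Inv s S) {x y : ℤ} (hr : gAz s x y) : ov S (c1 s) (x,y) = none ∧ n7 s x y = some tAz := by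
  have h3 := h.hs
  refine ⟨h.cn (by omega) (by omega), ?_⟩
  unfold n7; rw [if_neg (by omega), if_pos (by omega)]; apply congrArg some
  unfold n7L; repeat' split
  all_goals first | rfl | omega
theorem q_F0 {s S} (h : Inv s S) {x y : ℤ} (hr : gF0 s x y) : ov S (c1 s) (x,y) = none ∧ n7 s x y = some tF0 := by
  have h3 := h.hs
  refine ⟨h.cn (by omega) (by omega), ?_⟩
  unfold n7; rw [if_neg (by omega), if_pos (by omega)]; apply congrArg some
  unfold n7L; repeat' split
  all_goals first | rfl | omega
theorem q_Fc {s S} (h : Inv s S) {x y : ℤ} (hr : gFc s x y) : ov S (c1 s) (x,y) = none ∧ n7 s x y = some tFc := by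
  have h3 := h.hs
  refine ⟨h.cn (by omega) (by omega), ?_⟩
  unfold n7; rw [if_neg (by omega), if_pos (by omega)]; apply congrArg some
  unfold n7L; repeat' split
  all_goals first | rfl | omega
theorem q_Fx {s S} (h : Inv s S) {x y : ℤ} (hr : gFx s x y) : ov S (c1 s) (x,y) = none ∧ n7 s x y = some tFx := by
  have h3 := h.hs
  refine ⟨h.cn (by omega) (by omega), ?_⟩
  unfold n7; rw [if_neg (by omega), if_neg (by omega)]; apply congrArg some
  unfold n7U; repeat' split
  all_goals first | rfl | omega
theorem q_T1 {s S} (h : Inv s S) {x y : ℤ} (hr : gT1 s x y) : ov S (c1 s) (x,y) = none ∧ n7 s x y = some tT1 := by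
  have h3 := h.hs
  refine ⟨h.cn (by omega) (by omega), ?_⟩
  unfold n7; rw [if_neg (by omega), if_neg (by omega)]; apply congrArg some
  unfold n7U; repeat' split
  all_goals first | rfl | omega
theorem q_T2 {s S} (h : Inv s S) {x y : ℤ} (hr : gT2 s x y) : ov S (c1 s) (x,y) = none ∧ n7 s x y = some tT2 := by
  have h3 := h.hs
  refine ⟨h.cn (by omega) (by omega), ?_⟩
  unfold n7; rw [if_neg (by omega), if_neg (by omega)]; apply congrArg some
  unfold n7U; repeat' split
  all_goals first | rfl | omega
theorem q_T3 {s S} (h : Inv s S) {x y : ℤ} (hr : gT3 s x y) : ov S (c1 s) (x,y) = none ∧ n7 s x y = some tT3 := by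
  have h3 := h.hs
  refine ⟨h.cn (by omega) (by omega), ?_⟩
  unfold n7; rw [if_neg (by omega), if_neg (by omega)]; apply congrArg some
  unfold n7U; repeat' split
  all_goals first | rfl | omega
theorem q_Fl {s S} (h : Inv s S) {x y : ℤ} (hr : gFl s x y) : ov S (c1 s) (x,y) = none ∧ n7 s x y = some tFl := by
  have h3 := h.hs
  refine ⟨h.cn (by omega) (by omega), ?_⟩
  unfold n7; rw [if_neg (by omega), if_neg (by omega)]; apply congrArg some
  unfold n7U; repeat' split
  all_goals first | rfl | omega
theorem n7_ind {s S} (h : Inv s S) {x y : ℤ} {t} (h0 : ov S (c1 s) (x,y) = none) (hf : n7 s x y = some t) {P : Tile → Prop}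
    (hP : gP s x y → P tP)
    (hJ : gJ s x y → P tJ)
    (hAT : gAT s x y → P tAT)
    (hF : gF s x y → P tF)
    (hM1 : gM1 s x y → P tM1)
    (hD : gD s x y → P tD)
    (hA1 : gA1 s x y → P tA1)
    (hAz : gAz s x y → P tAz)
    (hF0 : gF0 s x y → P tF0)
    (hFc : gFc s x y → P tFc)
    (hFx : gFx s x y → P tFx)
    (hT1 : gT1 s x y → P tT1)
    (hT2 : gT2 s x y → P tT2)
    (hT3 : gT3 s x y → P tT3)
    (hFl : gFl s x y → P tFl) : P t := by
  have h3 := h.hs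
  have hx := h.ovn h0
  have hz := c1_nz h3 hx.2
  have hx := hx.1
  unfold n7 at hf
  split at hf
  · cases hf
  split at hf
  · cases hf
    unfold n7L; repeat' split
    · exact hP (by omega)
    · exact hJ (by omega)
    · exact hAT (by omega)
    · exact hF (by omega)
    · exact hM1 (by omega)
    · exact hD (by omega)
    · exact hAz (by omega)
    · exact hA1 (by omega)
    · exact hF0 (by omega)
    · exact hFc (by omega)
  · cases hf
    unfold n7U; repeat' split
    · exact hFx (by omega)
    · exact hT1 (by omega)
    · exact hT2 (by omega)
    · exact hT3 (by omega)
    · exact hFl (by omega)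
theorem n7_in {s x y : ℤ} (h : n7 s x y = none) : x < 0 ∨ y < 0 ∨ 2*s ≤ x ∨ 2*s ≤ y := by
  unfold n7 at h; split at h
  · assumption
  split at h <;> cases h
theorem nN' {C f} {x y : ℤ} (h : C (x,y+1) = none ∧ f x (y+1) = none) : EN C f x y = 0 := nN h.1 h.2
theorem nF' {C f} {x y : ℤ} {u} (h : C (x,y+1) = none ∧ f x (y+1) = some u) : EN C f x y = if inS u then 0 else u.south := nF h.1 h.2
theorem eN' {C f} {x y : ℤ} (h : C (x+1,y) = none ∧ f (x+1) y = none) : EE C f x y = 0 := eN h.1 h.2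
theorem eF' {C f} {x y : ℤ} {u} (h : C (x+1,y) = none ∧ f (x+1) y = some u) : EE C f x y = if inW u then 0 else u.west := eF h.1 h.2
theorem sN' {C f} {x y : ℤ} (h : C (x,y-1) = none ∧ f x (y-1) = none) : ES C f x y = 0 := sN h.1 h.2
theorem sF' {C f} {x y : ℤ} {u} (h : C (x,y-1) = none ∧ f x (y-1) = some u) : ES C f x y = if guN u then 0 else u.north := sF h.1 h.2
theorem wN' {C f} {x y : ℤ} (h : C (x-1,y) = none ∧ f (x-1) y = none) : EW C f x y = 0 := wN h.1 h.2
theorem wF' {C f} {x y : ℤ} {u} (h : C (x-1,y) = none ∧ f (x-1) y = some u) : EW C f x y = if inE u then 0 else u.east := wF h.1 h.2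
def L7 (S : Config) (s x y : ℤ) (t : Tile) : Prop :=
  chk 7 t (EN (ov S (c1 s)) (n7 s) x y) (EE (ov S (c1 s)) (n7 s) x y) (ES (ov S (c1 s)) (n7 s) x y) (EW (ov S (c1 s)) (n7 s) x y) ∧
    (t = tJ ∨ 8 ≤ isum t (EN (ov S (c1 s)) (n7 s) x y) (EE (ov S (c1 s)) (n7 s) x y) (ES (ov S (c1 s)) (n7 s) x y) (EW (ov S (c1 s)) (n7 s) x y))
theorem l7_P {s S} (h : Inv s S) {x y : ℤ} (hr : gP s x y) :
    L7 S s x y tP := by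
  have h3 := h.hs
  have g0 : EN (ov S (c1 s)) (n7 s) x y = 0 := by
    rcases (by omega : kO s x (y+1) ∨ kX3 s x (y+1) ∨ gFx s x (y+1)) with hh | hh | hh
    · exact (nN' (q_no h hh))
    · exact (nO (h.k (c1_X3 h3 hh) (by omega)))
    · exact (nF' (q_Fx h hh))
  have g1 : EE (ov S (c1 s)) (n7 s) x y = 0 := by
    rcases (by omega : kO s (x+1) y ∨ gAT s (x+1) y ∨ gJ s (x+1) y) with hh | hh | hh
    · exact (eN' (q_no h hh))
    · exact (eF' (q_AT h hh))
    · exact (eF' (q_J h hh))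
  have g2 : ES (ov S (c1 s)) (n7 s) x y = 9 := by
    rcases (by omega : kR3 s x (y-1) ∨ gAT s x (y-1)) with hh | hh
    · exact (sO (h.k (c1_R3 h3 hh) (by omega)))
    · exact (sF' (q_AT h hh))
  have g3 : EW (ov S (c1 s)) (n7 s) x y = 0 ∨ EW (ov S (c1 s)) (n7 s) x y = 13 := by
    rcases (by omega : kX s (x-1) y ∨ gFx s (x-1) y) with hh | hh
    · exact Or.inr (wO (h.k (c1_X h3 hh) (by omega)))
    · exact Or.inl (wF' (q_Fx h hh))
  rcases g3 with g3 | g3 <;> (unfold L7; rw [g0, g1, g2, g3]; decide)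
theorem l7_J {s S} (h : Inv s S) {x y : ℤ} (hr : gJ s x y) :
    L7 S s x y tJ := by
  have h3 := h.hs
  have g0 : EN (ov S (c1 s)) (n7 s) x y = 18 := by
    exact (nO (h.k (c1_X4 h3 (by omega)) (by omega)))
  have g1 : EE (ov S (c1 s)) (n7 s) x y = 0 := by
    exact (eF' (q_F h (by omega)))
  have g2 : ES (ov S (c1 s)) (n7 s) x y = 0 := by
    exact (sF' (q_M1 h (by omega)))
  have g3 : EW (ov S (c1 s)) (n7 s) x y = 6 := by
    exact (wF' (q_P h (by omega)))
  (unfold L7; rw [g0, g1, g2, g3]; decide)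
theorem l7_AT {s S} (h : Inv s S) {x y : ℤ} (hr : gAT s x y) :
    L7 S s x y tAT := by
  have h3 := h.hs
  have g0 : EN (ov S (c1 s)) (n7 s) x y = 0 := by
    exact (nF' (q_P h (by omega)))
  have g1 : EE (ov S (c1 s)) (n7 s) x y = 0 := by
    rcases (by omega : kO s (x+1) y ∨ gF s (x+1) y) with hh | hh
    · exact (eN' (q_no h hh))
    · exact (eF' (q_F h hh))
  have g2 : ES (ov S (c1 s)) (n7 s) x y = 1 := by
    exact (sF' (q_F h (by omega)))
  have g3 : EW (ov S (c1 s)) (n7 s) x y = 6 := by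
    rcases (by omega : kX4 s (x-1) y ∨ gP s (x-1) y) with hh | hh
    · exact (wO (h.k (c1_X4 h3 hh) (by omega)))
    · exact (wF' (q_P h hh))
  (unfold L7; rw [g0, g1, g2, g3]; decide)
theorem l7_F {s S} (h : Inv s S) {x y : ℤ} (hr : gF s x y) :
    L7 S s x y tF := by
  have h3 := h.hs
  have g0 : EN (ov S (c1 s)) (n7 s) x y = 0 := by
    rcases (by omega : gAT s x (y+1) ∨ gF s x (y+1)) with hh | hh
    · exact (nF' (q_AT h hh))
    · exact (nF' (q_F h hh))
  have g1 : EE (ov S (c1 s)) (n7 s) x y = 0 := by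
    rcases (by omega : kO s (x+1) y ∨ gF s (x+1) y) with hh | hh
    · exact (eN' (q_no h hh))
    · exact (eF' (q_F h hh))
  have g2 : ES (ov S (c1 s)) (n7 s) x y = 1 := by
    rcases (by omega : gD s x (y-1) ∨ gF s x (y-1)) with hh | hh
    · exact (sF' (q_D h hh))
    · exact (sF' (q_F h hh))
  have g3 : EW (ov S (c1 s)) (n7 s) x y = 2 := by
    rcases (by omega : gAT s (x-1) y ∨ gD s (x-1) y ∨ gF s (x-1) y ∨ gJ s (x-1) y ∨ gM1 s (x-1) y) with hh | hh | hh | hh | hh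
    · exact (wF' (q_AT h hh))
    · exact (wF' (q_D h hh))
    · exact (wF' (q_F h hh))
    · exact (wF' (q_J h hh))
    · exact (wF' (q_M1 h hh))
  (unfold L7; rw [g0, g1, g2, g3]; decide)
theorem l7_M1 {s S} (h : Inv s S) {x y : ℤ} (hr : gM1 s x y) :
    L7 S s x y tM1 := by
  have h3 := h.hs
  have g0 : EN (ov S (c1 s)) (n7 s) x y = 19 := by
    exact (nF' (q_J h (by omega)))
  have g1 : EE (ov S (c1 s)) (n7 s) x y = 0 := by
    exact (eF' (q_F h (by omega)))
  have g2 : ES (ov S (c1 s)) (n7 s) x y = 0 := by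
    exact (sF' (q_A1 h (by omega)))
  have g3 : EW (ov S (c1 s)) (n7 s) x y = 16 := by
    exact (wO (h.k (c1_R3 h3 (by omega)) (by omega)))
  (unfold L7; rw [g0, g1, g2, g3]; decide)
theorem l7_D {s S} (h : Inv s S) {x y : ℤ} (hr : gD s x y) :
    L7 S s x y tD := by
  have h3 := h.hs
  have g0 : EN (ov S (c1 s)) (n7 s) x y = 0 := by
    exact (nF' (q_F h (by omega)))
  have g1 : EE (ov S (c1 s)) (n7 s) x y = 0 := by
    rcases (by omega : kO s (x+1) y ∨ gF s (x+1) y) with hh | hh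
    · exact (eN' (q_no h hh))
    · exact (eF' (q_F h hh))
  have g2 : ES (ov S (c1 s)) (n7 s) x y = 0 := by
    rcases (by omega : gA1 s x (y-1) ∨ gAz s x (y-1)) with hh | hh
    · exact (sF' (q_A1 h hh))
    · exact (sF' (q_Az h hh))
  have g3 : EW (ov S (c1 s)) (n7 s) x y = 8 := by
    exact (wF' (q_A1 h (by omega)))
  (unfold L7; rw [g0, g1, g2, g3]; decide)
theorem l7_A1 {s S} (h : Inv s S) {x y : ℤ} (hr : gA1 s x y) :
    L7 S s x y tA1 := by
  have h3 := h.hs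
  have g0 : EN (ov S (c1 s)) (n7 s) x y = 7 := by
    rcases (by omega : gD s x (y+1) ∨ gM1 s x (y+1)) with hh | hh
    · exact (nF' (q_D h hh))
    · exact (nF' (q_M1 h hh))
  have g1 : EE (ov S (c1 s)) (n7 s) x y = 0 := by
    exact (eF' (q_D h (by omega)))
  have g2 : ES (ov S (c1 s)) (n7 s) x y = 0 := by
    rcases (by omega : gF0 s x (y-1) ∨ gFc s x (y-1)) with hh | hh
    · exact (sF' (q_F0 h hh))
    · exact (sF' (q_Fc h hh))
  have g3 : EW (ov S (c1 s)) (n7 s) x y = 2 := by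
    rcases (by omega : kGa s (x-1) y ∨ gFc s (x-1) y) with hh | hh
    · exact (wO (h.k (c1_Ga h3 hh) (by omega)))
    · exact (wF' (q_Fc h hh))
  (unfold L7; rw [g0, g1, g2, g3]; decide)
theorem l7_Az {s S} (h : Inv s S) {x y : ℤ} (hr : gAz s x y) :
    L7 S s x y tAz := by
  have h3 := h.hs
  have g0 : EN (ov S (c1 s)) (n7 s) x y = 7 := by
    exact (nF' (q_D h (by omega)))
  have g1 : EE (ov S (c1 s)) (n7 s) x y = 0 := by
    exact (eN' (q_no h (by omega)))
  have g2 : ES (ov S (c1 s)) (n7 s) x y = 0 := by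
    exact (sN' (q_no h (by omega)))
  have g3 : EW (ov S (c1 s)) (n7 s) x y = 5 := by
    exact (wF' (q_F0 h (by omega)))
  (unfold L7; rw [g0, g1, g2, g3]; decide)
theorem l7_F0 {s S} (h : Inv s S) {x y : ℤ} (hr : gF0 s x y) :
    L7 S s x y tF0 := by
  have h3 := h.hs
  have g0 : EN (ov S (c1 s)) (n7 s) x y = 3 := by
    rcases (by omega : gA1 s x (y+1) ∨ gFc s x (y+1)) with hh | hh
    · exact (nF' (q_A1 h hh))
    · exact (nF' (q_Fc h hh))
  have g1 : EE (ov S (c1 s)) (n7 s) x y = 0 := by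
    rcases (by omega : gAz s (x+1) y ∨ gF0 s (x+1) y) with hh | hh
    · exact (eF' (q_Az h hh))
    · exact (eF' (q_F0 h hh))
  have g2 : ES (ov S (c1 s)) (n7 s) x y = 0 := by
    exact (sN' (q_no h (by omega)))
  have g3 : EW (ov S (c1 s)) (n7 s) x y = 5 := by
    rcases (by omega : kF0 s (x-1) y ∨ gF0 s (x-1) y) with hh | hh
    · exact (wO (h.k (c1_F0 h3 hh) (by omega)))
    · exact (wF' (q_F0 h hh))
  (unfold L7; rw [g0, g1, g2, g3]; decide)
theorem l7_Fc {s S} (h : Inv s S) {x y : ℤ} (hr : gFc s x y) :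
    L7 S s x y tFc := by
  have h3 := h.hs
  have g0 : EN (ov S (c1 s)) (n7 s) x y = 3 := by
    rcases (by omega : gA1 s x (y+1) ∨ gFc s x (y+1)) with hh | hh
    · exact (nF' (q_A1 h hh))
    · exact (nF' (q_Fc h hh))
  have g1 : EE (ov S (c1 s)) (n7 s) x y = 0 := by
    rcases (by omega : gA1 s (x+1) y ∨ gFc s (x+1) y) with hh | hh
    · exact (eF' (q_A1 h hh))
    · exact (eF' (q_Fc h hh))
  have g2 : ES (ov S (c1 s)) (n7 s) x y = 0 := by
    rcases (by omega : gF0 s x (y-1) ∨ gFc s x (y-1)) with hh | hh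
    · exact (sF' (q_F0 h hh))
    · exact (sF' (q_Fc h hh))
  have g3 : EW (ov S (c1 s)) (n7 s) x y = 2 := by
    rcases (by omega : kFc s (x-1) y ∨ gFc s (x-1) y) with hh | hh
    · exact (wO (h.k (c1_Fc h3 hh) (by omega)))
    · exact (wF' (q_Fc h hh))
  (unfold L7; rw [g0, g1, g2, g3]; decide)
theorem l7_Fx {s S} (h : Inv s S) {x y : ℤ} (hr : gFx s x y) :
    L7 S s x y tFx := by
  have h3 := h.hs
  have g0 : EN (ov S (c1 s)) (n7 s) x y = 0 := by
    rcases (by omega : kO s x (y+1) ∨ gFl s x (y+1)) with hh | hh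
    · exact (nN' (q_no h hh))
    · exact (nF' (q_Fl h hh))
  have g1 : EE (ov S (c1 s)) (n7 s) x y = 10 := by
    exact (eF' (q_P h (by omega)))
  have g2 : ES (ov S (c1 s)) (n7 s) x y = 0 ∨ ES (ov S (c1 s)) (n7 s) x y = 11 := by
    rcases (by omega : kX4 s x (y-1) ∨ gP s x (y-1)) with hh | hh
    · exact Or.inl (sO (h.k (c1_X4 h3 hh) (by omega)))
    · exact Or.inr (sF' (q_P h hh))
  have g3 : EW (ov S (c1 s)) (n7 s) x y = 0 := by
    exact (wF' (q_Fl h (by omega)))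
  rcases g2 with g2 | g2 <;> (unfold L7; rw [g0, g1, g2, g3]; decide)
theorem l7_T1 {s S} (h : Inv s S) {x y : ℤ} (hr : gT1 s x y) :
    L7 S s x y tT1 := by
  have h3 := h.hs
  have g0 : EN (ov S (c1 s)) (n7 s) x y = 0 := by
    rcases (by omega : kO s x (y+1) ∨ gFl s x (y+1)) with hh | hh
    · exact (nN' (q_no h hh))
    · exact (nF' (q_Fl h hh))
  have g1 : EE (ov S (c1 s)) (n7 s) x y = 4 := by
    exact (eF' (q_Fl h (by omega)))
  have g2 : ES (ov S (c1 s)) (n7 s) x y = 20 := by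
    exact (sO (h.k (c1_Xs h3 (by omega)) (by omega)))
  have g3 : EW (ov S (c1 s)) (n7 s) x y = 0 := by
    exact (wF' (q_T2 h (by omega)))
  (unfold L7; rw [g0, g1, g2, g3]; decide)
theorem l7_T2 {s S} (h : Inv s S) {x y : ℤ} (hr : gT2 s x y) :
    L7 S s x y tT2 := by
  have h3 := h.hs
  have g0 : EN (ov S (c1 s)) (n7 s) x y = 0 := by
    rcases (by omega : kO s x (y+1) ∨ gFl s x (y+1)) with hh | hh
    · exact (nN' (q_no h hh))
    · exact (nF' (q_Fl h hh))
  have g1 : EE (ov S (c1 s)) (n7 s) x y = 21 := by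
    exact (eF' (q_T1 h (by omega)))
  have g2 : ES (ov S (c1 s)) (n7 s) x y = 0 := by
    exact (sF' (q_T3 h (by omega)))
  have g3 : EW (ov S (c1 s)) (n7 s) x y = 0 := by
    exact (wF' (q_Fl h (by omega)))
  (unfold L7; rw [g0, g1, g2, g3]; decide)
theorem l7_T3 {s S} (h : Inv s S) {x y : ℤ} (hr : gT3 s x y) :
    L7 S s x y tT3 := by
  have h3 := h.hs
  have g0 : EN (ov S (c1 s)) (n7 s) x y = 22 := by
    exact (nF' (q_T2 h (by omega)))
  have g1 : EE (ov S (c1 s)) (n7 s) x y = 0 := by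
    exact (eO (h.k (c1_Xs h3 (by omega)) (by omega)))
  have g2 : ES (ov S (c1 s)) (n7 s) x y = 1 := by
    exact (sO (h.k (c1_Be h3 (by omega)) (by omega)))
  have g3 : EW (ov S (c1 s)) (n7 s) x y = 0 := by
    exact (wF' (q_Fl h (by omega)))
  (unfold L7; rw [g0, g1, g2, g3]; decide)
theorem l7_Fl {s S} (h : Inv s S) {x y : ℤ} (hr : gFl s x y) :
    L7 S s x y tFl := by
  have h3 := h.hs
  have g0 : EN (ov S (c1 s)) (n7 s) x y = 0 := by
    rcases (by omega : kO s x (y+1) ∨ gFl s x (y+1)) with hh | hh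
    · exact (nN' (q_no h hh))
    · exact (nF' (q_Fl h hh))
  have g1 : EE (ov S (c1 s)) (n7 s) x y = 4 := by
    rcases (by omega : gFl s (x+1) y ∨ gFx s (x+1) y ∨ gT2 s (x+1) y ∨ gT3 s (x+1) y) with hh | hh | hh | hh
    · exact (eF' (q_Fl h hh))
    · exact (eF' (q_Fx h hh))
    · exact (eF' (q_T2 h hh))
    · exact (eF' (q_T3 h hh))
  have g2 : ES (ov S (c1 s)) (n7 s) x y = 1 := by
    rcases (by omega : kFl s x (y-1) ∨ kX3 s x (y-1) ∨ gFl s x (y-1) ∨ gFx s x (y-1) ∨ gT1 s x (y-1) ∨ gT2 s x (y-1)) with hh | hh | hh | hh | hh | hh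
    · exact (sO (h.k (c1_Fl h3 hh) (by omega)))
    · exact (sO (h.k (c1_X3 h3 hh) (by omega)))
    · exact (sF' (q_Fl h hh))
    · exact (sF' (q_Fx h hh))
    · exact (sF' (q_T1 h hh))
    · exact (sF' (q_T2 h hh))
  have g3 : EW (ov S (c1 s)) (n7 s) x y = 0 := by
    rcases (by omega : kO s (x-1) y ∨ gFl s (x-1) y ∨ gT1 s (x-1) y) with hh | hh | hh
    · exact (wN' (q_no h hh))
    · exact (wF' (q_Fl h hh))
    · exact (wF' (q_T1 h hh))
  (unfold L7; rw [g0, g1, g2, g3]; decide)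
theorem l7 {s S} (h : Inv s S) {x y : ℤ} {t} (h0 : ov S (c1 s) (x,y) = none) (hf : n7 s x y = some t) : L7 S s x y t := by
  apply n7_ind h h0 hf
  · exact l7_P h
  · exact l7_J h
  · exact l7_AT h
  · exact l7_F h
  · exact l7_M1 h
  · exact l7_D h
  · exact l7_A1 h
  · exact l7_Az h
  · exact l7_F0 h
  · exact l7_Fc h
  · exact l7_Fx h
  · exact l7_T1 h
  · exact l7_T2 h
  · exact l7_T3 h
  · exact l7_Fl h

end TT

set_option linter.all false
namespace TT

def ob (g : Glue) (c : Prop) : Prop := gs g = 0 ∨ (gs g ≤ 6 ∧ c)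
theorem o7_N {s S} (h : Inv s S) {x y : ℤ} (h0 : ov S (c1 s) (x,y) = none) (hf : n7 s x y = none) :
    ob (EN (ov S (c1 s)) (n7 s) x y) (y = -1 ∧ 0 ≤ x ∧ x < 2*s) := by
  have h3 := h.hs
  have hx := n7_in hf
  by_cases hn : S (x, (y+1)) = none
  · have hw := h.nn hn
    cases hu : c1 s x (y+1) with
    | none =>
      cases hv : n7 s x (y+1) with
      | none => rw [nN (by rw [ov_new hn]; exact hu) hv]; exact Or.inl rfl
      | some u =>
        rw [nF (by rw [ov_new hn]; exact hu) hv]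
        apply n7_ind h (by rw [ov_new hn]; exact hu) hv (P := fun u => ob (if inS u then 0 else u.south) (y = -1 ∧ 0 ≤ x ∧ x < 2*s)) <;> intro hr <;>
          (first | exact Or.inl rfl | exact Or.inr ⟨by decide, by omega⟩ | omega)
    | some u =>
      rw [nO (h.k hu hw)]
      rcases c1_cases hu with ⟨hr, rfl⟩ | ⟨hr, rfl⟩ | ⟨hr, rfl⟩ | ⟨hr, rfl⟩ | ⟨-, hu⟩ <;> try (first | exact Or.inl rfl | exact Or.inr ⟨by decide, by omega⟩ | omega)
      rcases k1_cases hu with ⟨hr, rfl⟩ | ⟨hr, rfl⟩ | ⟨hr, rfl⟩ | ⟨hr, rfl⟩ | ⟨hr, rfl⟩ | ⟨hr, rfl⟩ <;>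
        first | exact Or.inl rfl | exact Or.inr ⟨by decide, by omega⟩ | omega
  · have hw := (h.sh _ _).1 hn
    rw [nS (ov_ne hn), ov_sG hn]
    have h2 : y + 1 = 0 := by omega
    rw [h2]; exact Or.inr ⟨by have := h.bot x; omega, by omega⟩
theorem o7_E {s S} (h : Inv s S) {x y : ℤ} (h0 : ov S (c1 s) (x,y) = none) (hf : n7 s x y = none) :
    ob (EE (ov S (c1 s)) (n7 s) x y) (x = -1 ∧ 0 ≤ y ∧ y < 2*s) := by
  have h3 := h.hs
  have hx := n7_in hf
  by_cases hn : S ((x+1), y) = none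
  · have hw := h.nn hn
    cases hu : c1 s (x+1) y with
    | none =>
      cases hv : n7 s (x+1) y with
      | none => rw [eN (by rw [ov_new hn]; exact hu) hv]; exact Or.inl rfl
      | some u =>
        rw [eF (by rw [ov_new hn]; exact hu) hv]
        apply n7_ind h (by rw [ov_new hn]; exact hu) hv (P := fun u => ob (if inW u then 0 else u.west) (x = -1 ∧ 0 ≤ y ∧ y < 2*s)) <;> intro hr <;>
          (first | exact Or.inl rfl | exact Or.inr ⟨by decide, by omega⟩ | omega)
    | some u =>
      rw [eO (h.k hu hw)]
      rcases c1_cases hu with ⟨hr, rfl⟩ | ⟨hr, rfl⟩ | ⟨hr, rfl⟩ | ⟨hr, rfl⟩ | ⟨-, hu⟩ <;> try (first | exact Or.inl rfl | exact Or.inr ⟨by decide, by omega⟩ | omega)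
      rcases k1_cases hu with ⟨hr, rfl⟩ | ⟨hr, rfl⟩ | ⟨hr, rfl⟩ | ⟨hr, rfl⟩ | ⟨hr, rfl⟩ | ⟨hr, rfl⟩ <;>
        first | exact Or.inl rfl | exact Or.inr ⟨by decide, by omega⟩ | omega
  · have hw := (h.sh _ _).1 hn
    rw [eS (ov_ne hn), ov_wG hn]
    have h2 : x + 1 = 0 := by omega
    rw [h2]; exact Or.inr ⟨by have := h.lef y; omega, by omega⟩
theorem o7_S {s S} (h : Inv s S) {x y : ℤ} (h0 : ov S (c1 s) (x,y) = none) (hf : n7 s x y = none) :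
    ob (ES (ov S (c1 s)) (n7 s) x y) (y = 2*s ∧ 0 ≤ x ∧ x < 2*s) := by
  have h3 := h.hs
  have hx := n7_in hf
  by_cases hn : S (x, (y-1)) = none
  · have hw := h.nn hn
    cases hu : c1 s x (y-1) with
    | none =>
      cases hv : n7 s x (y-1) with
      | none => rw [sN (by rw [ov_new hn]; exact hu) hv]; exact Or.inl rfl
      | some u =>
        rw [sF (by rw [ov_new hn]; exact hu) hv]
        apply n7_ind h (by rw [ov_new hn]; exact hu) hv (P := fun u => ob (if guN u then 0 else u.north) (y = 2*s ∧ 0 ≤ x ∧ x < 2*s)) <;> intro hr <;>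
          (first | exact Or.inl rfl | exact Or.inr ⟨by decide, by omega⟩ | omega)
    | some u =>
      rw [sO (h.k hu hw)]
      rcases c1_cases hu with ⟨hr, rfl⟩ | ⟨hr, rfl⟩ | ⟨hr, rfl⟩ | ⟨hr, rfl⟩ | ⟨-, hu⟩ <;> try (first | exact Or.inl rfl | exact Or.inr ⟨by decide, by omega⟩ | omega)
      rcases k1_cases hu with ⟨hr, rfl⟩ | ⟨hr, rfl⟩ | ⟨hr, rfl⟩ | ⟨hr, rfl⟩ | ⟨hr, rfl⟩ | ⟨hr, rfl⟩ <;>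
        first | exact Or.inl rfl | exact Or.inr ⟨by decide, by omega⟩ | omega
  · have hw := (h.sh _ _).1 hn
    omega
theorem o7_W {s S} (h : Inv s S) {x y : ℤ} (h0 : ov S (c1 s) (x,y) = none) (hf : n7 s x y = none) :
    ob (EW (ov S (c1 s)) (n7 s) x y) (x = 2*s ∧ 0 ≤ y ∧ y < 2*s) := by
  have h3 := h.hs
  have hx := n7_in hf
  by_cases hn : S ((x-1), y) = none
  · have hw := h.nn hn
    cases hu : c1 s (x-1) y with
    | none =>
      cases hv : n7 s (x-1) y with
      | none => rw [wN (by rw [ov_new hn]; exact hu) hv]; exact Or.inl rfl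
      | some u =>
        rw [wF (by rw [ov_new hn]; exact hu) hv]
        apply n7_ind h (by rw [ov_new hn]; exact hu) hv (P := fun u => ob (if inE u then 0 else u.east) (x = 2*s ∧ 0 ≤ y ∧ y < 2*s)) <;> intro hr <;>
          (first | exact Or.inl rfl | exact Or.inr ⟨by decide, by omega⟩ | omega)
    | some u =>
      rw [wO (h.k hu hw)]
      rcases c1_cases hu with ⟨hr, rfl⟩ | ⟨hr, rfl⟩ | ⟨hr, rfl⟩ | ⟨hr, rfl⟩ | ⟨-, hu⟩ <;> try (first | exact Or.inl rfl | exact Or.inr ⟨by decide, by omega⟩ | omega)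
      rcases k1_cases hu with ⟨hr, rfl⟩ | ⟨hr, rfl⟩ | ⟨hr, rfl⟩ | ⟨hr, rfl⟩ | ⟨hr, rfl⟩ | ⟨hr, rfl⟩ <;>
        first | exact Or.inl rfl | exact Or.inr ⟨by decide, by omega⟩ | omega
  · have hw := (h.sh _ _).1 hn
    omega
theorem loc7 {s S} (h : Inv s S) : Loc 7 (ov S (c1 s)) (n7 s) := by
  have h3 := h.hs
  refine ⟨?_, ?_, ?_⟩
  · intro x y h0 hf
    have a := o7_N h h0 hf
    have b := o7_E h h0 hf
    have c := o7_S h h0 hf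
    have d := o7_W h h0 hf
    unfold ob at a b c d; omega
  · intro x y t h0 hf
    exact (l7 h h0 hf).1
  · intro C hC x y h0 hf
    exfalso
    have : tR3 ≠ tR3 := by
      apply n7_ind h h0 hf (P := fun t => t ≠ tR3) <;> intro _ <;> decide
    exact this rfl

def rk7 (s x y : ℤ) : ℤ := if y ≤ x then (if x+y ≤ 2*s ∨ (x = s+1 ∧ y = s) then 2*x-y else 10*s+x+y)
  else if y = s+2 ∧ s-2 ≤ x then 50*s-x else 100*s+2*y-x

abbrev za (s x y : ℤ) : Prop := y ≤ x ∧ (x+y ≤ 2*s ∨ (x = s+1 ∧ y = s))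
abbrev zb (s x y : ℤ) : Prop := y ≤ x ∧ ¬(x+y ≤ 2*s ∨ (x = s+1 ∧ y = s))
abbrev zc (s x y : ℤ) : Prop := ¬ y ≤ x ∧ (y = s+2 ∧ s-2 ≤ x)
abbrev zd (s x y : ℤ) : Prop := ¬ y ≤ x ∧ ¬ (y = s+2 ∧ s-2 ≤ x)
theorem r7a {s x y : ℤ} (h : za s x y) : rk7 s x y = 2*x-y := by
  unfold rk7; rw [if_pos h.1, if_pos h.2]
theorem r7b {s x y : ℤ} (h : zb s x y) : rk7 s x y = 10*s+x+y := by
  unfold rk7; rw [if_pos h.1, if_neg h.2]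
theorem r7c {s x y : ℤ} (h : zc s x y) : rk7 s x y = 50*s-x := by
  unfold rk7; rw [if_neg h.1, if_pos h.2]
theorem r7d {s x y : ℤ} (h : zd s x y) : rk7 s x y = 100*s+2*y-x := by
  unfold rk7; rw [if_neg h.1, if_neg h.2]
theorem cin {s S} (h : Inv s S) {x y : ℤ} (hp : (0 ≤ x ∧ x < s ∧ 0 ≤ y ∧ y < s) ∨ (y = s ∧ 0 ≤ x ∧ x ≤ s-1) ∨ (x = s ∧ 0 ≤ y ∧ y ≤ s-1) ∨ (y = s+1 ∧ s-1 ≤ x ∧ x ≤ s+1)) :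
    ov S (c1 s) (x,y) ≠ none := by
  intro h0
  have hx := h.ovn h0
  have hz := c1_nz h.hs hx.2
  omega
theorem rk7h {s S} (h : Inv s S) : Rk (ov S (c1 s)) (n7 s) (rk7 s) := by
  have h3 := h.hs
  intro x y t h0 hf
  apply n7_ind h h0 hf (P := fun t => (inN t = true → ov S (c1 s) (x,y+1) ≠ none ∨ rk7 s x (y+1) < rk7 s x y) ∧
    (inE t = true → ov S (c1 s) (x+1,y) ≠ none ∨ rk7 s (x+1) y < rk7 s x y) ∧
    (inS t = true → ov S (c1 s) (x,y-1) ≠ none ∨ rk7 s x (y-1) < rk7 s x y) ∧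
    (inW t = true → ov S (c1 s) (x-1,y) ≠ none ∨ rk7 s (x-1) y < rk7 s x y)) <;> clear h0 hf <;> intro hr <;>
  refine ⟨fun hi => ?_, fun hi => ?_, fun hi => ?_, fun hi => ?_⟩ <;> first | exact absurd hi (by decide) | clear hi
  · rcases (by omega : (kR3 s x (y-1)) ∨ (zb s x y ∧ zb s x (y-1))) with hh | hh
    · exact Or.inl (cin h (by omega))
    · right; rw [r7b hh.1, r7b hh.2]; omega
  · have hh : kX4 s x (y+1) := by omega
    exact Or.inl (cin h (by omega))
  · have hh : za s x y ∧ za s (x-1) y := by omega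
    right; rw [r7a hh.1, r7a hh.2]; omega
  · have hh : zb s x y ∧ zb s x (y-1) := by omega
    right; rw [r7b hh.1, r7b hh.2]; omega
  · rcases (by omega : (kX4 s (x-1) y) ∨ (zb s x y ∧ zb s (x-1) y)) with hh | hh
    · exact Or.inl (cin h (by omega))
    · right; rw [r7b hh.1, r7b hh.2]; omega
  · rcases (by omega : (zb s x y ∧ za s x (y-1)) ∨ (zb s x y ∧ zb s x (y-1))) with hh | hh
    · right; rw [r7b hh.1, r7a hh.2]; omega
    · right; rw [r7b hh.1, r7b hh.2]; omega
  · rcases (by omega : (zb s x y ∧ za s (x-1) y) ∨ (zb s x y ∧ zb s (x-1) y)) with hh | hh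
    · right; rw [r7b hh.1, r7a hh.2]; omega
    · right; rw [r7b hh.1, r7b hh.2]; omega
  · have hh : za s x y ∧ za s x (y+1) := by omega
    right; rw [r7a hh.1, r7a hh.2]; omega
  · have hh : za s x y ∧ za s (x-1) y := by omega
    right; rw [r7a hh.1, r7a hh.2]; omega
  · have hh : za s x y ∧ za s x (y+1) := by omega
    right; rw [r7a hh.1, r7a hh.2]; omega
  · rcases (by omega : (kGa s (x-1) y) ∨ (za s x y ∧ za s (x-1) y)) with hh | hh
    · exact Or.inl (cin h (by omega))
    · right; rw [r7a hh.1, r7a hh.2]; omega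
  · have hh : za s x y ∧ za s x (y+1) := by omega
    right; rw [r7a hh.1, r7a hh.2]; omega
  · have hh : za s x y ∧ za s (x-1) y := by omega
    right; rw [r7a hh.1, r7a hh.2]; omega
  · have hh : za s x y ∧ za s x (y+1) := by omega
    right; rw [r7a hh.1, r7a hh.2]; omega
  · rcases (by omega : (kF0 s (x-1) y) ∨ (za s x y ∧ za s (x-1) y)) with hh | hh
    · exact Or.inl (cin h (by omega))
    · right; rw [r7a hh.1, r7a hh.2]; omega
  · have hh : za s x y ∧ za s x (y+1) := by omega
    right; rw [r7a hh.1, r7a hh.2]; omega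
  · rcases (by omega : (kFc s (x-1) y) ∨ (za s x y ∧ za s (x-1) y)) with hh | hh
    · exact Or.inl (cin h (by omega))
    · right; rw [r7a hh.1, r7a hh.2]; omega
  · rcases (by omega : (zc s x y ∧ zb s (x+1) y) ∨ (zd s x y ∧ zb s (x+1) y)) with hh | hh
    · right; rw [r7c hh.1, r7b hh.2]; omega
    · right; rw [r7d hh.1, r7b hh.2]; omega
  · have hh : zc s x y ∧ zc s (x+1) y := by omega
    right; rw [r7c hh.1, r7c hh.2]; omega
  · have hh : kXs s x (y-1) := by omega
    exact Or.inl (cin h (by omega))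
  · have hh : zc s x y ∧ zc s (x+1) y := by omega
    right; rw [r7c hh.1, r7c hh.2]; omega
  · have hh : zd s x y ∧ zc s x (y+1) := by omega
    right; rw [r7d hh.1, r7c hh.2]; omega
  · rcases (by omega : (zc s x y ∧ zc s (x+1) y) ∨ (zd s x y ∧ zc s (x+1) y) ∨ (zd s x y ∧ zd s (x+1) y)) with hh | hh | hh
    · right; rw [r7c hh.1, r7c hh.2]; omega
    · right; rw [r7d hh.1, r7c hh.2]; omega
    · right; rw [r7d hh.1, r7d hh.2]; omega
  · rcases (by omega : (kFl s x (y-1)) ∨ (kX3 s x (y-1)) ∨ (zd s x y ∧ zc s x (y-1)) ∨ (zd s x y ∧ zd s x (y-1))) with hh | hh | hh | hh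
    · exact Or.inl (cin h (by omega))
    · exact Or.inl (cin h (by omega))
    · right; rw [r7d hh.1, r7c hh.2]; omega
    · right; rw [r7d hh.1, r7d hh.2]; omega

theorem fin7 {s S} (h : Inv s S) : (shape (ov (ov S (c1 s)) (n7 s))).Finite := by
  have h3 := h.hs
  apply fin_of (2*s)
  intro x y hp
  by_contra hc
  have := q_no h (x := x) (y := y) (by omega)
  rcases ov_some hp with h1 | h1
  · exact h1 this.1
  · exact h1 this.2

theorem phase7 {s S} (h : Inv s S) : PhaseOK (Step TT gs 7) (ov S (f5 s)) (ov (ov S (c1 s)) (n7 s)) := by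
  apply PhaseOK.of_step _ ⟨_, stepA h (by omega) (by omega)⟩
  intro D hD
  rw [onlyA h (by omega) (by omega) hD]; exact (grow (loc7 h) (rk7h h) (fin7 h) (c1_stable h)).1

end TT

set_option linter.all false
namespace TT

def ns (s x y : ℤ) : Option Tile := if (x = s ∧ y = s) ∨ (x = s+1 ∧ s-2 ≤ y ∧ y ≤ s) then n7 s x y else none

theorem ns_in {s x y : ℤ} (h : (x = s ∧ y = s) ∨ (x = s+1 ∧ s-2 ≤ y ∧ y ≤ s)) : ns s x y = n7 s x y := if_pos h
theorem ns_out {s x y : ℤ} (h : ¬((x = s ∧ y = s) ∨ (x = s+1 ∧ s-2 ≤ y ∧ y ≤ s))) : ns s x y = none := if_neg h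

theorem ov_k {C f} {p : ℤ × ℤ} {t} (h : C p = some t) : ov C f p = some t := by
  rw [ov_old (by rw [h]; simp)]; exact h

theorem ns_stable {s S} (h : Inv s S) : Stable 8 (ov (ov S (c1 s)) (ns s)) := by
  have h3 := h.hs
  have hle : Le (ov S (k1 s)) (ov (ov S (c1 s)) (ns s)) := by
    intro p hp
    have := le_kc h p hp
    rw [ov_old (by rw [this]; exact hp)]; exact this
  apply stable_ext hle (k1_stable h)
  intro Q hQ hQ2
  by_contra hc
  have hc : cutStrength gs (ov (ov S (c1 s)) (ns s)) Q < 8 := by omega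
  have hK : ∀ {x y : ℤ}, ((0 ≤ x ∧ x < s ∧ 0 ≤ y ∧ y < s) ∨ (y = s ∧ 0 ≤ x ∧ x ≤ s-2) ∨ (x = s ∧ 0 ≤ y ∧ y ≤ s-1)) → (x,y) ∉ Q :=
    fun hh hq => kin h hh (hQ2 _ hq).2
  have hin : ∀ x y, (x,y) ∈ Q → inX s x y ∨ ((x = s ∧ y = s) ∨ (x = s+1 ∧ s-2 ≤ y ∧ y ≤ s)) := by
    intro x y hq
    obtain ⟨a, b⟩ := hQ2 _ hq
    by_cases c : ov S (c1 s) (x,y) = none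
    · right; by_contra hn
      rw [ov_new c, ns_out hn] at a; exact a rfl
    · left; exact c_sub h c b
  have dn : ∀ {x y : ℤ} {t}, ov S (c1 s) (x,y) = none ∧ n7 s x y = some t → ((x = s ∧ y = s) ∨ (x = s+1 ∧ s-2 ≤ y ∧ y ≤ s)) →
      ov (ov S (c1 s)) (ns s) (x,y) = some t := by
    intro x y t h1 h2
    rw [ov_new h1.1, ns_in h2]; exact h1.2
  have dP := dn (q_P h (x := s) (y := s) (by omega)) (by omega)
  have dJ := dn (q_J h (x := s+1) (y := s) (by omega)) (by omega)
  have dM := dn (q_M1 h (x := s+1) (y := s-1) (by omega)) (by omega)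
  have dA := dn (q_A1 h (x := s+1) (y := s-2) (by omega)) (by omega)
  have dR : ov (ov S (c1 s)) (ns s) (s,s-1) = some tR3 := ov_k (h.k (c1_R3 h3 (by omega)) (by omega))
  have dG : ov (ov S (c1 s)) (ns s) (s,s-2) = some tGa := ov_k (h.k (c1_Ga h3 (by omega)) (by omega))
  have hX : HX s (ov (ov S (c1 s)) (ns s)) := by
    have k := hx_c h
    refine ⟨ov_k k.X, ov_k k.Xs, ov_k k.X3, ov_k k.X4, ov_k k.Be, ?_⟩
    rw [ov_nG (ov_ne (h.ye (by omega)))]; exact k.co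
  generalize ov (ov S (c1 s)) (ns s) = D at *
  obtain ⟨t1, t2, t3⟩ := hX.tie (Q := Q) hc
  have tP : (s,s) ∉ Q := fun hq => hK (by omega) ((tieV 8 dR dP (by omega) (by decide) hc).2 hq)
  have tM : (s+1,s-1) ∈ Q ↔ (s+1,s) ∈ Q := tieV 8 dM dJ (by omega) (by decide) hc
  have dP' : D (s+1-1,s) = some TT.tP := by rw [add_sub_cancel_right]; exact dP
  have dG' : D (s+1-1,s-2) = some tGa := by rw [add_sub_cancel_right]; exact dG
  have dA' : D (s+1,s-1-1) = some tA1 := by rw [(by ring : s-1-1 = s-2)]; exact dA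
  have dM' : D (s+1,s-2+1) = some tM1 := by rw [(by ring : s-2+1 = s-1)]; exact dM
  have dJ' : D (s+1,s+1-1) = some tJ := by rw [add_sub_cancel_right]; exact dJ
  have hGQ : (s+1-1,s-2) ∉ Q := hK (by omega)
  have bA : bW D (s+1) (s-2) = 4 := by rw [bW_of dA dG']; rfl
  by_cases hJ : (s+1,s) ∈ Q
  · have o1 := geW (C := D) (x := s+1) (y := s) (Q := Q) (by rw [add_sub_cancel_right]; exact tP)
    rw [bW_of dJ dP'] at o1
    have o1 : 4 ≤ _ := o1
    by_cases hA : (s+1,s-2) ∈ Q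
    · have o2 := geW (C := D) hGQ
      have := out2_le_cut (C := D) hJ hA (by simp <;> omega)
      omega
    · have o2 := geS (C := D) (x := s+1) (y := s-1) (Q := Q) (by rw [(by ring : s-1-1 = s-2)]; exact hA)
      rw [bS_of dM dA'] at o2
      have o2 : 4 ≤ _ := o2
      have := out2_le_cut (C := D) hJ (tM.2 hJ) (by simp <;> omega)
      omega
  · have hM : (s+1,s-1) ∉ Q := fun e => hJ (tM.1 e)
    by_cases hA : (s+1,s-2) ∈ Q
    · have o := out_le_cut (C := D) hA
      rw [out_eq, if_neg (by rw [(by ring : s-2+1 = s-1)]; exact hM : (s+1,s-2+1) ∉ Q), if_neg hGQ, bN_of dA dM', bA] at o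
      have e : bond gs tA1.north tM1.south = 4 := rfl
      omega
    · have hx : (s-1,s) ∈ Q ∧ (s+1,s+1) ∈ Q := by
        obtain ⟨⟨x,y⟩, hp⟩ := hQ
        rcases hin x y hp with hh | hh
        · rcases hh with ⟨rfl, rfl⟩ | ⟨rfl, rfl⟩ | ⟨rfl, rfl⟩ | ⟨rfl, rfl⟩ <;> tauto
        · exfalso
          rcases (by omega : (x = s ∧ y = s) ∨ (x = s+1 ∧ y = s) ∨ (x = s+1 ∧ y = s-1) ∨ (x = s+1 ∧ y = s-2)) with
            ⟨rfl, rfl⟩ | ⟨rfl, rfl⟩ | ⟨rfl, rfl⟩ | ⟨rfl, rfl⟩ <;> tauto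
      have o1 := hX.out (Q := Q) (hK (by omega)) (hK (by omega))
      have o2 := geS (C := D) (x := s+1) (y := s+1) (Q := Q) (by rw [add_sub_cancel_right]; exact hJ)
      rw [bS_of hX.X4 dJ'] at o2
      have o2 : 3 ≤ _ := o2
      have := out2_le_cut (C := D) hx.1 hx.2 (by simp)
      omega

theorem st7 {s S} (h : Inv s S) : Stable 8 (ov (ov S (c1 s)) (n7 s)) := by
  have h3 := h.hs
  apply stable_rank (rk7h h) (ov_le _ _) _ (ns_stable h)
  · intro x y t hd h0 hf
    have hn : ¬((x = s ∧ y = s) ∨ (x = s+1 ∧ s-2 ≤ y ∧ y ≤ s)) := by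
      intro hh
      rw [ov_new h0, ns_in hh, hf] at hd; cases hd
    have hJ : t ≠ tJ := by
      apply n7_ind h h0 hf (P := fun t => t ≠ tJ) <;> intro hr <;> first | decide | omega
    exact (l7 h h0 hf).2.resolve_left hJ
  · rintro ⟨x, y⟩ hp
    by_cases c : ov S (c1 s) (x,y) = none
    · rw [ov_new c] at hp
      have hn : (x = s ∧ y = s) ∨ (x = s+1 ∧ s-2 ≤ y ∧ y ≤ s) := by
        by_contra hn; exact hp (ns_out hn)
      rw [ov_new c, ov_new c, ns_in hn]
    · rw [ov_old c, ov_old c]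

theorem inv7 {s S} (h : Inv s S) : Inv (2*s) (ov (ov S (c1 s)) (n7 s)) := by
  have h3 := h.hs
  have hst := st7 h
  have rn : ∀ {x y : ℤ} {t}, ov S (c1 s) (x,y) = none ∧ n7 s x y = some t → ov (ov S (c1 s)) (n7 s) (x,y) = some t := by
    intro x y t hh; rw [ov_new hh.1]; exact hh.2
  have rno : ∀ {x y : ℤ}, (x < 0 ∨ y < 0 ∨ 2*s ≤ x ∨ 2*s ≤ y) → ov (ov S (c1 s)) (n7 s) (x,y) = none := by
    intro x y hh; rw [ov_new (q_no h hh).1]; exact (q_no h hh).2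
  have rc : ∀ {x y : ℤ} {t}, c1 s x y = some t → (x < 0 ∨ y < 0 ∨ s ≤ x ∨ s ≤ y) → ov (ov S (c1 s)) (n7 s) (x,y) = some t :=
    fun hk ho => ov_k (h.k hk ho)
  have rS : ∀ {x y : ℤ}, S (x,y) ≠ none → ov (ov S (c1 s)) (n7 s) (x,y) = S (x,y) := by
    intro x y hS
    rw [ov_old (ov_ne hS), ov_old hS]
  refine ⟨by omega, ?_, ?_, ?_, ?_, ?_, ?_, ?_, ?_, ?_, hst⟩
  · intro x y
    constructor
    · intro hp; by_contra hc; exact hp (rno (by omega))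
    · intro hp
      by_cases c : ov S (c1 s) (x,y) = none
      · intro e
        rw [ov_new c] at e
        have := n7_in e
        omega
      · exact ov_ne c
  · intro x hx hx'
    by_cases e : x = 2*s-2
    · rw [n_of (rn (q_Fx h (by omega)))]; rfl
    by_cases e : s = 3
    · rcases (by omega : x = 0 ∨ x = 1 ∨ x = 2 ∨ x = 3) with e1 | e1 | e1 | e1
      · rw [n_of (rn (q_Fl h (by omega)))]; rfl
      · rw [n_of (rn (q_T2 h (by omega)))]; rfl
      · rw [n_of (rn (q_T1 h (by omega)))]; rfl
      · rw [n_of (rn (q_Fl h (by omega)))]; rfl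
    · rw [n_of (rn (q_Fl h (by omega)))]; rfl
  · rw [n_of (rn (q_P h (by omega)))]; rfl
  · rw [e_of (rn (q_Az h (by omega)))]; rfl
  · intro y hy hy'
    by_cases e : y = 1
    · rw [e_of (rn (q_D h (by omega)))]; rfl
    · rw [e_of (rn (q_F h (by omega)))]; rfl
  · left; rw [e_of (rn (q_AT h (by omega)))]; rfl
  · rw [e_of (rn (q_P h (by omega)))]; rfl
  · intro x
    by_cases hS : S (x,0) = none
    · have := h.nn hS
      rcases (by omega : (x < 0 ∨ 2*s ≤ x) ∨ x = s ∨ (s+1 ≤ x ∧ x ≤ 2*s-2) ∨ x = 2*s-1) with e | e | e | e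
      · rw [(g0 (rno (by omega))).1]; decide
      · rw [s_of (rc (c1_F0 h3 (by omega)) (by omega))]; decide
      · rw [s_of (rn (q_F0 h (by omega)))]; decide
      · rw [s_of (rn (q_Az h (by omega)))]; decide
    · have := h.bot x
      unfold sG at this ⊢; rw [rS hS]; exact this
  · intro y
    by_cases hS : S (0,y) = none
    · have := h.nn hS
      rcases (by omega : (y < 0 ∨ 2*s ≤ y) ∨ y = s ∨ (s+1 ≤ y ∧ y < 2*s)) with e | e | e
      · rw [(g0 (rno (by omega))).2.1]; decide
      · rw [w_of (rc (c1_Fl h3 (by omega)) (by omega))]; decide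
      · rw [w_of (rn (q_Fl h (by omega)))]; decide
    · have := h.lef y
      unfold wG at this ⊢; rw [rS hS]; exact this

theorem opDbl {s S} (h : Inv s S) : ∃ R, Ch [5, 7] S R ∧ Inv (2*s) R :=
  ⟨_, Ch.cons (phase5 h) (Ch.cons (phase7 h) (Ch.nil _)), inv7 h⟩

end TT

set_option linter.all false
namespace TT

def fbT (x y : ℤ) : Tile :=
  if y = 0 then (if x = 0 then tS0 else if x = 1 then tB1 else tB2)
  else if y = 1 then (if x = 0 then tB5 else if x = 1 then tB4 else tB3)
  else (if x = 0 then tFl else if x = 1 then tFx else tP)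
def fb (x y : ℤ) : Option Tile := if 0 ≤ x ∧ x ≤ 2 ∧ 0 ≤ y ∧ y ≤ 2 then some (fbT x y) else none
def rkb (x y : ℤ) : ℤ :=
  if y = 0 then x else if y = 1 then 5 - x else 7 - x

theorem fb_t {x y : ℤ} {t} (h : fb x y = some t) : (0 ≤ x ∧ x ≤ 2 ∧ 0 ≤ y ∧ y ≤ 2) ∧ t = fbT x y := by
  unfold fb at h; split at h
  · next hh => exact ⟨hh, (Option.some.inj h).symm⟩
  · cases h
theorem fb_n {x y : ℤ} (h : ¬(0 ≤ x ∧ x ≤ 2 ∧ 0 ≤ y ∧ y ≤ 2)) : fb x y = none := if_neg h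
theorem fb_n' {x y : ℤ} (h : fb x y = none) : ¬(0 ≤ x ∧ x ≤ 2 ∧ 0 ≤ y ∧ y ≤ 2) := by
  intro hh; unfold fb at h; rw [if_pos hh] at h; cases h
theorem sd_n {x y : ℤ} (h : ¬(x = 0 ∧ y = 0)) : seedConfig tS0 (x,y) = none := by
  unfold seedConfig; rw [if_neg]; simpa using h

theorem locb : Loc 8 (seedConfig tS0) fb := by
  refine ⟨?_, ?_, ?_⟩
  · intro x y h0 hf
    have hb := fb_n' hf
    by_cases hh : -1 ≤ x ∧ x ≤ 3 ∧ -1 ≤ y ∧ y ≤ 3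
    · clear h0 hf
      obtain ⟨a, b, c, d⟩ := hh
      interval_cases x <;> interval_cases y <;> first | omega | decide
    · rw [nN (sd_n (by omega)) (fb_n (by omega)), eN (sd_n (by omega)) (fb_n (by omega)),
        sN (sd_n (by omega)) (fb_n (by omega)), wN (sd_n (by omega)) (fb_n (by omega))]
      decide
  · intro x y t h0 hf
    obtain ⟨⟨a, b, c, d⟩, rfl⟩ := fb_t hf
    clear hf
    revert h0
    interval_cases x <;> interval_cases y <;> decide
  · intro C hC x y h0 hf
    obtain ⟨⟨a, b, c, d⟩, e⟩ := fb_t hf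
    exfalso; clear hf h0; revert e
    interval_cases x <;> interval_cases y <;> decide

theorem rkbh : Rk (seedConfig tS0) fb rkb := by
  intro x y t h0 hf
  obtain ⟨⟨a, b, c, d⟩, rfl⟩ := fb_t hf
  clear hf
  revert h0
  interval_cases x <;> interval_cases y <;> decide

theorem b_n {x y : ℤ} (h : ¬(0 ≤ x ∧ x ≤ 2 ∧ 0 ≤ y ∧ y ≤ 2)) : ov (seedConfig tS0) fb (x,y) = none := by
  rw [ov_new (sd_n (by omega))]; exact fb_n h

theorem finb : (shape (ov (seedConfig tS0) fb)).Finite := by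
  apply fin_of 2
  intro x y hp
  by_contra hc
  exact hp (b_n (by omega))

theorem stb : Stable 8 (seedConfig tS0) := by
  intro Q h1 h2 h3
  exfalso
  obtain ⟨⟨x,y⟩, hq⟩ := h1
  apply h3 hq
  apply sd_n
  rintro ⟨rfl, rfl⟩
  exact h2 hq

theorem base : ∃ R, Ch [8] (seedConfig tS0) R ∧ Inv 3 R := by
  obtain ⟨hg, hst⟩ := grow locb rkbh finb stb
  refine ⟨_, Ch.cons hg (Ch.nil _), by omega, ?_, ?_, by decide, by decide, ?_, by decide, by decide, ?_, ?_, hst⟩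
  · intro x y
    constructor
    · intro hp; by_contra hc; exact hp (b_n (by omega))
    · rintro ⟨a, b, c, d⟩
      interval_cases x <;> interval_cases y <;> decide
  · intro x h1 h2
    interval_cases x <;> decide
  · intro y h1 h2
    omega
  · intro x
    by_cases hh : 0 ≤ x ∧ x ≤ 2
    · obtain ⟨a, b⟩ := hh
      interval_cases x <;> decide
    · rw [(g0 (b_n (by omega))).1]; decide
  · intro y
    by_cases hh : 0 ≤ y ∧ y ≤ 2
    · obtain ⟨a, b⟩ := hh
      interval_cases y <;> decide
    · rw [(g0 (b_n (by omega))).2.1]; decide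

/-- doubling-and-increment program -/
theorem prog (n : ℕ) (hn : 3 ≤ n) : ∃ τs R, Ch τs (seedConfig tS0) R ∧ Inv n R ∧ τs.length ≤ 4 * Nat.log 2 n + 5 ∧
    ∀ τ ∈ τs, 1 ≤ τ ∧ τ ≤ 9 := by
  induction n using Nat.strong_induction_on with
  | _ n ih =>
    by_cases h6 : n < 6
    · obtain ⟨R3, c3, i3⟩ := base
      obtain ⟨R4, c4, i4⟩ := opAdd i3
      obtain ⟨R5, c5, i5⟩ := opAdd i4
      rcases (by omega : n = 3 ∨ n = 4 ∨ n = 5) with rfl | rfl | rfl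
      · exact ⟨_, _, c3, i3, by simp, by decide⟩
      · exact ⟨_, _, c3.append c4, i4, by simp, by decide⟩
      · exact ⟨_, _, (c3.append c4).append c5, i5, by simp, by decide⟩
    · obtain ⟨τs, R, hc, hi, hl, ht⟩ := ih (n/2) (by omega) (by omega)
      have hlog : Nat.log 2 n = Nat.log 2 (n/2) + 1 := Nat.log_of_one_lt_of_le (by omega) (by omega)
      obtain ⟨R2, c2, i2⟩ := opDbl hi
      rcases Nat.even_or_odd' n with ⟨k, hk | hk⟩
      · refine ⟨_, _, hc.append c2, ?_, ?_, ?_⟩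
        · have : (n : ℤ) = 2 * ((n/2 : ℕ) : ℤ) := by omega
          rw [this]; exact i2
        · simp; omega
        · intro τ h
          rcases List.mem_append.1 h with h | h
          · exact ht τ h
          · simp at h; omega
      · obtain ⟨R4, c4, i4⟩ := opAdd i2
        refine ⟨_, _, (hc.append c2).append c4, ?_, ?_, ?_⟩
        · have : (n : ℤ) = 2 * ((n/2 : ℕ) : ℤ) + 1 := by omega
          rw [this]; exact i4
        · simp; omega
        · intro τ h
          rcases List.mem_append.1 h with h | h
          · rcases List.mem_append.1 h with h | h
            · exact ht τ h
            · simp at h; omega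
          · simp at h; omega

end TT

/-- There exist a constant `c > 0` and a fixed tile system data `(T, s, G)`
with all glue strengths at most 9, such that for every `n ≥ 22` some sequence of positive
integer temperatures, each at most 9, of length at most `c · log₂ n`, makes the multiple
temperature tile system uniquely assemble the `n × n` square (up to translation). -/
theorem stmt0 :
    ∃ c : ℝ, 0 < c ∧
    ∃ (T : Finset Tile) (s : Tile) (G : Glue → ℕ),
      s ∈ T ∧ G 0 = 0 ∧ (∀ x, G x ≤ 9) ∧
      ∀ n : ℕ, 22 ≤ n →
        ∃ τs : List ℕ,
          (∀ τ ∈ τs, 1 ≤ τ ∧ τ ≤ 9) ∧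
          (τs.length : ℝ) ≤ c * Real.logb 2 n ∧
          UniquelyAssembles (Step T G) s τs (square n) := by
  classical
  refine ⟨9, by norm_num, TT.TT, TT.tS0, TT.gs, by decide, TT.gs0, TT.gs_le, ?_⟩
  intro n hn
  obtain ⟨τs, R, hc, hi, hl, ht⟩ := TT.prog n (by omega)
  refine ⟨τs, ht, ?_, R, hc.run, (0,0), ?_⟩
  · have h1 : ((Nat.log 2 n : ℕ) : ℝ) ≤ Real.logb 2 n := by
      exact_mod_cast Real.natLog_le_logb n 2
    have h2 : 1 ≤ Nat.log 2 n := Nat.log_pos (by omega) (by omega)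
    have h2' : (1:ℝ) ≤ ((Nat.log 2 n : ℕ) : ℝ) := by exact_mod_cast h2
    have h3 : (τs.length : ℝ) ≤ 4 * ((Nat.log 2 n : ℕ) : ℝ) + 5 := by exact_mod_cast hl
    linarith
  · ext ⟨x, y⟩
    have := hi.sh x y
    simp only [translateSet, square, shape, Set.mem_image, Set.mem_setOf_eq, Prod.exists, Prod.mk_add_mk, Prod.mk.injEq, add_zero]
    constructor
    · intro hp
      exact ⟨x, y, by have := this.1 hp; omega, rfl, rfl⟩
    · rintro ⟨a, b, hab, rfl, rfl⟩
      exact this.2 (by omega)
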